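/- arXiv:math/0309235 — 5 statements merged into one kernel-verified Lean document; each statement's English description precedes it below -/
import Mathlib

section
/- Let p be a nearest-neighbor transition probability function on ℤ (p(x,y) = 0 whenever |x−y| ≠ 1) with inf_{|x−y|=1} p(x,y) > 0, and let π be a reversible measure for p. If lim_{x→+∞} π(x) = ∞ and the set {π(x) : x < 0} has a limit point in (0,∞), then the set of extremal invariant measures for the exclusion process is exactly {ν^c : 0 ≤ c ≤ ∞}. -/
open MeasureTheory Filter Topology

section Defs

variable {S : Type*}

/-- The configuration obtained from `η` by exchanging the values at sites `x` and `y`. -/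
def swapConfig [DecidableEq S] (x y : S) (η : S → Bool) : S → Bool :=
  fun u => if u = x then η y else if u = y then η x else η u

/-- A cylinder function depends on finitely many coordinates. -/
def IsCylinder (f : (S → Bool) → ℝ) : Prop :=
  ∃ F : Finset S, ∀ η ξ : S → Bool, (∀ x ∈ F, η x = ξ x) → f η = f ξ

/-- The exclusion process generator applied to a cylinder function. -/
noncomputable def exclGen [DecidableEq S] (p : S → S → ℝ) (f : (S → Bool) → ℝ)
    (η : S → Bool) : ℝ :=
  ∑' x : S, ∑' y : S,
    (if η x = true ∧ η y = false then p x y * (f (swapConfig x y η) - f η) else 0)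

/-- `p` is a transition probability function with bounded column sums. -/
def IsTransition (p : S → S → ℝ) : Prop :=
  (∀ x y, 0 ≤ p x y) ∧ (∀ x, HasSum (fun y => p x y) 1) ∧
    ∃ C : ℝ, ∀ (y : S) (F : Finset S), ∑ x ∈ F, p x y ≤ C

/-- A probability measure is invariant for the exclusion process. -/
def ExclInvariant [DecidableEq S] (p : S → S → ℝ) (μ : Measure (S → Bool)) : Prop :=
  IsProbabilityMeasure μ ∧ ∀ f : (S → Bool) → ℝ, IsCylinder f → ∫ η, exclGen p f η ∂μ = 0

/-- Extremal invariant probability measures. -/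
def IsExtremalInvariant [DecidableEq S] (p : S → S → ℝ) (μ : Measure (S → Bool)) : Prop :=
  ExclInvariant p μ ∧ ∀ (t : ℝ) (ν₁ ν₂ : Measure (S → Bool)), 0 < t → t < 1 →
    ExclInvariant p ν₁ → ExclInvariant p ν₂ →
    μ = ENNReal.ofReal t • ν₁ + ENNReal.ofReal (1 - t) • ν₂ → ν₁ = μ ∧ ν₂ = μ

/-- A reversible measure `π` for the kernel `p`. -/
def IsReversible (p : S → S → ℝ) (π : S → ℝ) : Prop :=
  (∀ x, 0 < π x) ∧ ∀ x y, π x * p x y = π y * p y x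

/-- Irreducibility of `p`. -/
def IrreducibleKernel (p : S → S → ℝ) : Prop :=
  ∀ x y : S, x ≠ y → ∃ (n : ℕ) (c : ℕ → S), c 0 = x ∧ c n = y ∧ ∀ i < n, 0 < p (c i) (c (i+1))

/-- `ν` is the product (Bernoulli) measure with marginals `α`. -/
def IsBernoulliProduct (ν : Measure (S → Bool)) (α : S → ℝ) : Prop :=
  IsProbabilityMeasure ν ∧ ∀ (F : Finset S) (a : S → Bool),
    ν {η | ∀ x ∈ F, η x = a x} = ∏ x ∈ F, ENNReal.ofReal (if a x then α x else 1 - α x)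

/-- A probability measure is reversible for the exclusion process. -/
def IsReversibleMeasure [DecidableEq S] (p : S → S → ℝ) (μ : Measure (S → Bool)) : Prop :=
  ∀ f g : (S → Bool) → ℝ, IsCylinder f → IsCylinder g →
    ∫ η, f η * exclGen p g η ∂μ = ∫ η, g η * exclGen p f η ∂μ

end Defs

namespace Exclusion

/-! ### Cylinder events -/

/-- The configuration whose set of occupied sites is `B`. -/
def cfg (B : Finset ℤ) : ℤ → Bool := fun x => decide (x ∈ B)

/-- The event that, inside `A`, the occupied sites are those of `B`. -/
def cyl (A B : Finset ℤ) : Set (ℤ → Bool) := {η | ∀ x ∈ A, η x = decide (x ∈ B)}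

/-- The event that the site `x` is occupied. -/
def occ (x : ℤ) : Set (ℤ → Bool) := {η | η x = true}

lemma measurableSet_occ (x : ℤ) : MeasurableSet (occ x) :=
  measurableSet_eq_fun (measurable_pi_apply x) measurable_const

lemma measurableSet_cyl (A B : Finset ℤ) : MeasurableSet (cyl A B) := by
  have : cyl A B = ⋂ x ∈ A, (fun η : ℤ → Bool => η x) ⁻¹' {decide (x ∈ B)} := by
    ext η; simp [cyl]
  rw [this]
  exact Finset.measurableSet_biInter _
    fun x _ => (measurable_pi_apply x) (measurableSet_singleton _)

lemma cyl_congr {A B B' : Finset ℤ} (h : ∀ x ∈ A, x ∈ B ↔ x ∈ B') : cyl A B = cyl A B' := by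
  ext η
  exact forall₂_congr fun x hx => by simp [h x hx]

lemma cyl_inter_occ {A B : Finset ℤ} {z : ℤ} (hz : z ∉ A) :
    cyl A B ∩ occ z = cyl (insert z A) (insert z B) := by
  ext η
  simp only [cyl, occ, Set.mem_inter_iff, Set.mem_ofPred_eq, Finset.forall_mem_insert,
    Finset.mem_insert_self, decide_true]
  rw [and_comm]
  refine and_congr_right fun _ => forall₂_congr fun x hx => ?_
  have : x ≠ z := fun h => hz (h ▸ hx)
  simp [this]

lemma cyl_diff_occ {A B : Finset ℤ} {z : ℤ} (hB : z ∉ B) :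
    cyl A B \ occ z = cyl (insert z A) B := by
  ext η
  simp only [cyl, occ, Set.mem_sdiff, Set.mem_ofPred_eq, Finset.forall_mem_insert, hB,
    decide_false, Bool.not_eq_true]
  rw [and_comm]

lemma real_cyl_inter_add_diff (μ : Measure (ℤ → Bool)) [IsFiniteMeasure μ] (E : Set (ℤ → Bool))
    (z : ℤ) : μ.real E = μ.real (E \ occ z) + μ.real (E ∩ occ z) := by
  rw [add_comm, measureReal_inter_add_sdiff (measurableSet_occ z)]

lemma real_cyl_split (μ : Measure (ℤ → Bool)) [IsFiniteMeasure μ] {A B : Finset ℤ} {z : ℤ}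
    (hA : z ∉ A) (hB : z ∉ B) :
    μ.real (cyl A B) =
      μ.real (cyl (insert z A) B) + μ.real (cyl (insert z A) (insert z B)) := by
  rw [real_cyl_inter_add_diff μ _ z, cyl_diff_occ hB, cyl_inter_occ hA]

lemma eq_on_cyl {A : Finset ℤ} {f : (ℤ → Bool) → ℝ} (hf : DependsOn f (A : Set ℤ))
    (η : ℤ → Bool) :
    f η = ∑ B ∈ A.powerset, (cyl A B).indicator (fun _ => f (cfg B)) η := by
  classical
  have hmem : η ∈ cyl A (A.filter fun x => η x = true) := fun x hx => by simp [hx]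
  rw [Finset.sum_eq_single_of_mem (A.filter fun x => η x = true)]
  · rw [Set.indicator_of_mem hmem]
    exact hf fun x hx => hmem x hx
  · simp
  · intro B hB hne
    refine Set.indicator_of_notMem (fun h => hne ?_) _
    ext x
    by_cases hx : x ∈ A
    · have := h x hx
      simp [hx, this]
    · simp only [Finset.mem_filter, hx, false_and, iff_false]
      exact fun h' => hx (Finset.mem_powerset.1 hB h')

lemma integrable_of_dependsOn (μ : Measure (ℤ → Bool)) [IsFiniteMeasure μ] {A : Finset ℤ}
    {f : (ℤ → Bool) → ℝ} (hf : DependsOn f (A : Set ℤ)) : Integrable f μ := by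
  rw [funext (eq_on_cyl hf)]
  exact integrable_finsetSum _ fun B _ => (integrable_const _).indicator (measurableSet_cyl A B)

lemma integral_eq_sum_cyl (μ : Measure (ℤ → Bool)) [IsFiniteMeasure μ] {A : Finset ℤ}
    {f : (ℤ → Bool) → ℝ} (hf : DependsOn f (A : Set ℤ)) :
    ∫ η, f η ∂μ = ∑ B ∈ A.powerset, μ.real (cyl A B) * f (cfg B) := by
  rw [integral_congr_ae (Eventually.of_forall (eq_on_cyl hf)),
    integral_finsetSum _ fun B _ => (integrable_const _).indicator (measurableSet_cyl A B)]
  exact Finset.sum_congr rfl fun B _ => integral_indicator_const _ (measurableSet_cyl A B)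

lemma sum_real_cyl (μ : Measure (ℤ → Bool)) [IsFiniteMeasure μ] (A : Finset ℤ) :
    ∑ B ∈ A.powerset, μ.real (cyl A B) = μ.real Set.univ := by
  have h := integral_eq_sum_cyl μ (A := A) (f := fun _ => 1) (fun _ _ _ => rfl)
  simpa using h.symm

/-- A finite measure on configurations is determined by the cylinder events. -/
lemma ext_of_cyl {μ ν : Measure (ℤ → Bool)} [IsFiniteMeasure μ] [IsFiniteMeasure ν]
    (h : ∀ A B : Finset ℤ, B ⊆ A → μ.real (cyl A B) = ν.real (cyl A B)) : μ = ν := by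
  have hmap : ∀ I : Finset ℤ, μ.map I.restrict = ν.map I.restrict := by
    intro I
    refine Measure.ext_of_singleton fun a => ?_
    rw [Measure.map_apply (Finset.measurable_restrict I) (measurableSet_singleton a),
      Measure.map_apply (Finset.measurable_restrict I) (measurableSet_singleton a)]
    set B : Finset ℤ := I.filter fun x => ∃ hx : x ∈ I, a ⟨x, hx⟩ = true with hB
    have : (I.restrict : (ℤ → Bool) → I → Bool) ⁻¹' {a} = cyl I B := by
      ext η
      simp only [Set.mem_preimage, Set.mem_singleton_iff, cyl, Set.mem_ofPred_eq, funext_iff,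
        Subtype.forall, Finset.restrict]
      refine forall₂_congr fun x hx => ?_
      simp [hB, hx]
    rw [this]
    exact (measureReal_eq_measureReal_iff).1 (h I B (Finset.filter_subset _ _))
  exact IsProjectiveLimit.unique (P := fun I : Finset ℤ => ν.map I.restrict)
    (fun I => hmap I) (fun I => rfl)

/-! ### The generator on cylinder functions -/

/-- The contribution of jumps from `x` to `y` to the generator. -/
noncomputable def jump (p : ℤ → ℤ → ℝ) (f : (ℤ → Bool) → ℝ) (x y : ℤ) (η : ℤ → Bool) : ℝ :=
  if η x = true ∧ η y = false then p x y * (f (swapConfig x y η) - f η) else 0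

/-- The two endpoints of the bond `{x, x + 1}` removed from `A`. -/
def off (x : ℤ) (A : Finset ℤ) : Finset ℤ := (A.erase x).erase (x + 1)

/-- The net mean flow from `x` to `x + 1` while `off x A` is in state `C`. -/
noncomputable def flux (p : ℤ → ℤ → ℝ) (μ : Measure (ℤ → Bool)) (x : ℤ) (K C : Finset ℤ) : ℝ :=
  p x (x + 1) * μ.real (cyl (insert x (insert (x + 1) K)) (insert x C)) -
    p (x + 1) x * μ.real (cyl (insert x (insert (x + 1) K)) (insert (x + 1) C))

lemma swapConfig_cfg_insert {x y : ℤ} (hxy : x ≠ y) {C : Finset ℤ} (hx : x ∉ C) (hy : y ∉ C) :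
    swapConfig x y (cfg (insert x C)) = cfg (insert y C) := by
  funext u
  by_cases h1 : u = x
  · subst h1; simp [swapConfig, cfg, hx, hy, hxy, hxy.symm]
  · by_cases h2 : u = y
    · subst h2; simp [swapConfig, cfg, h1]
    · simp [swapConfig, cfg, h1, h2]

lemma swapConfig_eq_on {A : Finset ℤ} {x y : ℤ} (η : ℤ → Bool) (hx : x ∉ A) (hy : y ∉ A) :
    ∀ u ∈ (A : Set ℤ), swapConfig x y η u = η u := by
  intro u hu
  have h1 : u ≠ x := fun h => hx (h ▸ hu)
  have h2 : u ≠ y := fun h => hy (h ▸ hu)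
  simp [swapConfig, h1, h2]

lemma swapConfig_agree {A : Finset ℤ} {x y : ℤ} (hx : x ∈ A) (hy : y ∈ A) {η ξ : ℤ → Bool}
    (h : ∀ u ∈ (A : Set ℤ), η u = ξ u) :
    ∀ u ∈ (A : Set ℤ), swapConfig x y η u = swapConfig x y ξ u := by
  intro u hu
  have := h x hx
  have := h y hy
  have := h u hu
  simp [swapConfig, *]

lemma jump_eq_zero_of_notMem {p : ℤ → ℤ → ℝ} {A : Finset ℤ} {f : (ℤ → Bool) → ℝ}
    (hf : DependsOn f (A : Set ℤ)) {x y : ℤ} (hx : x ∉ A) (hy : y ∉ A) (η : ℤ → Bool) :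
    jump p f x y η = 0 := by
  simp [jump, hf (swapConfig_eq_on η hx hy)]

lemma dependsOn_jump {p : ℤ → ℤ → ℝ} {A : Finset ℤ} {f : (ℤ → Bool) → ℝ}
    (hf : DependsOn f (A : Set ℤ)) {x y : ℤ} (hx : x ∈ A) (hy : y ∈ A) :
    DependsOn (jump p f x y) (A : Set ℤ) := by
  intro η ξ h
  have h1 := h x hx
  have h2 := h y hy
  simp only [jump, h1, h2, hf h, hf (swapConfig_agree hx hy h)]

lemma exclGen_eq_sum {p : ℤ → ℤ → ℝ} (hnn : ∀ x y : ℤ, |x - y| ≠ 1 → p x y = 0) {m n : ℤ}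
    {f : (ℤ → Bool) → ℝ} (hf : DependsOn f (Finset.Icc m n : Set ℤ)) (η : ℤ → Bool) :
    exclGen p f η =
      ∑ x ∈ Finset.Icc (m - 1) n, (jump p f x (x + 1) η + jump p f (x + 1) x η) := by
  have hinner : ∀ x : ℤ, ∑' y : ℤ, jump p f x y η =
      jump p f x (x + 1) η + jump p f x (x - 1) η := by
    intro x
    rw [tsum_eq_sum (s := {x + 1, x - 1}), Finset.sum_pair (by lia)]
    intro y hy
    have : |x - y| ≠ 1 := by
      intro h
      simp only [Finset.mem_insert, Finset.mem_singleton, not_or] at hy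
      rcases (abs_eq one_pos.le).1 h with h | h <;> lia
    simp [jump, hnn x y this]
  have hright : ∀ x ∉ Finset.Icc (m - 1) n, jump p f x (x + 1) η = 0 := by
    intro x hx
    simp only [Finset.mem_Icc, not_and, not_le] at hx
    refine jump_eq_zero_of_notMem hf ?_ ?_ η <;> simp only [Finset.mem_Icc] <;> lia
  have hleft : ∀ x ∉ Finset.Icc (m - 1) n, jump p f (x + 1) x η = 0 := by
    intro x hx
    simp only [Finset.mem_Icc, not_and, not_le] at hx
    refine jump_eq_zero_of_notMem hf ?_ ?_ η <;> simp only [Finset.mem_Icc] <;> lia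
  have hshift : (fun x : ℤ => jump p f x (x - 1) η) ∘ (Equiv.addRight (1 : ℤ)) =
      fun x => jump p f (x + 1) x η := by
    funext x; simp
  have hsum1 : Summable fun x : ℤ => jump p f x (x + 1) η :=
    summable_of_ne_finset_zero hright
  have hsum2 : Summable fun x : ℤ => jump p f x (x - 1) η := by
    rw [← (Equiv.addRight (1 : ℤ)).summable_iff, hshift]
    exact summable_of_ne_finset_zero hleft
  calc exclGen p f η = ∑' x : ℤ, ∑' y : ℤ, jump p f x y η := rfl
    _ = ∑' x : ℤ, (jump p f x (x + 1) η + jump p f x (x - 1) η) := tsum_congr hinner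
    _ = ∑' x : ℤ, jump p f x (x + 1) η + ∑' x : ℤ, jump p f x (x - 1) η :=
        hsum1.tsum_add hsum2
    _ = ∑' x : ℤ, jump p f x (x + 1) η + ∑' x : ℤ, jump p f (x + 1) x η := by
        rw [← (Equiv.addRight (1 : ℤ)).tsum_eq fun x : ℤ => jump p f x (x - 1) η]
        simp
    _ = _ := by
        rw [tsum_eq_sum hright, tsum_eq_sum hleft, Finset.sum_add_distrib]

lemma sum_powerset_insert_insert {K : Finset ℤ} {x y : ℤ} (hxy : x ≠ y) (hx : x ∉ K)
    (hy : y ∉ K) (g : Finset ℤ → ℝ) :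
    ∑ B ∈ (insert x (insert y K)).powerset, g B =
      ∑ C ∈ K.powerset, (g C + g (insert y C) + g (insert x C) + g (insert x (insert y C))) := by
  rw [Finset.sum_powerset_insert (by simp [hxy, hx]), Finset.sum_powerset_insert hy,
    Finset.sum_powerset_insert hy]
  simp only [Finset.sum_add_distrib]
  ring

lemma integral_jump_add_jump (p : ℤ → ℤ → ℝ) (μ : Measure (ℤ → Bool)) [IsFiniteMeasure μ]
    {K : Finset ℤ} {f : (ℤ → Bool) → ℝ} {x : ℤ} (hx : x ∉ K) (hy : x + 1 ∉ K)
    (hf : DependsOn f ((insert x (insert (x + 1) K) : Finset ℤ) : Set ℤ)) :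
    ∫ η, (jump p f x (x + 1) η + jump p f (x + 1) x η) ∂μ =
      ∑ C ∈ K.powerset, flux p μ x K C *
        (f (cfg (insert (x + 1) C)) - f (cfg (insert x C))) := by
  have hxy : x ≠ x + 1 := by lia
  set A := insert x (insert (x + 1) K) with hA
  have h1 : x ∈ A := by simp [hA]
  have h2 : x + 1 ∈ A := by simp [hA]
  have hdep : DependsOn (fun η => jump p f x (x + 1) η + jump p f (x + 1) x η) (A : Set ℤ) :=
    fun η ξ h => by
      simp only [dependsOn_jump (p := p) hf h1 h2 h, dependsOn_jump (p := p) hf h2 h1 h]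
  rw [integral_eq_sum_cyl μ hdep, hA, sum_powerset_insert_insert hxy hx hy]
  refine Finset.sum_congr rfl fun C hC => ?_
  have hxC : x ∉ C := fun h => hx (Finset.mem_powerset.1 hC h)
  have hyC : x + 1 ∉ C := fun h => hy (Finset.mem_powerset.1 hC h)
  have e1 := swapConfig_cfg_insert hxy hxC hyC
  have e2 := swapConfig_cfg_insert hxy.symm hyC hxC
  have c1 : ∀ B : Finset ℤ, ∀ z, cfg B z = decide (z ∈ B) := fun _ _ => rfl
  simp only [jump, c1, e1, e2, flux]
  simp [hxC, hyC]
  ring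

lemma subset_insert_off {x : ℤ} {A : Finset ℤ} : A ⊆ insert x (insert (x + 1) (off x A)) := by
  intro z hz
  by_cases h1 : z = x <;> by_cases h2 : z = x + 1 <;> simp [off, h1, h2, hz]

lemma left_notMem_off (x : ℤ) (A : Finset ℤ) : x ∉ off x A := by simp [off]

lemma right_notMem_off (x : ℤ) (A : Finset ℤ) : x + 1 ∉ off x A := by simp [off]

lemma integral_exclGen_eq_sum {p : ℤ → ℤ → ℝ} (hnn : ∀ x y : ℤ, |x - y| ≠ 1 → p x y = 0)
    (μ : Measure (ℤ → Bool)) [IsFiniteMeasure μ] {m n : ℤ}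
    {f : (ℤ → Bool) → ℝ} (hf : DependsOn f (Finset.Icc m n : Set ℤ)) :
    ∫ η, exclGen p f η ∂μ =
      ∑ x ∈ Finset.Icc (m - 1) n, ∑ C ∈ (off x (Finset.Icc m n)).powerset,
        flux p μ x (off x (Finset.Icc m n)) C *
          (f (cfg (insert (x + 1) C)) - f (cfg (insert x C))) := by
  have hdep : ∀ x : ℤ, DependsOn f
      ((insert x (insert (x + 1) (off x (Finset.Icc m n))) : Finset ℤ) : Set ℤ) := by
    refine fun x => hf.mono ?_
    have := subset_insert_off (x := x) (A := Finset.Icc m n)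
    exact_mod_cast this
  simp_rw [funext (exclGen_eq_sum hnn hf)]
  rw [integral_finsetSum]
  · exact Finset.sum_congr rfl fun x _ =>
      integral_jump_add_jump p μ (left_notMem_off _ _) (right_notMem_off _ _) (hdep x)
  · intro x _
    exact (integrable_of_dependsOn μ (dependsOn_jump (hdep x) (by simp) (by simp))).add
      (integrable_of_dependsOn μ (dependsOn_jump (hdep x) (by simp) (by simp)))

lemma exists_dependsOn_Icc {f : (ℤ → Bool) → ℝ} (hf : IsCylinder f) :
    ∃ m n : ℤ, DependsOn f (Finset.Icc m n : Set ℤ) := by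
  obtain ⟨F, hF⟩ := hf
  obtain ⟨m, hm⟩ := F.bddBelow
  obtain ⟨n, hn⟩ := F.bddAbove
  refine ⟨m, n, fun η ξ h => hF η ξ fun x hx => h x ?_⟩
  simpa using ⟨hm hx, hn hx⟩

lemma integrable_exclGen {p : ℤ → ℤ → ℝ} (hnn : ∀ x y : ℤ, |x - y| ≠ 1 → p x y = 0)
    (μ : Measure (ℤ → Bool)) [IsFiniteMeasure μ] {f : (ℤ → Bool) → ℝ} (hf : IsCylinder f) :
    Integrable (exclGen p f) μ := by
  obtain ⟨m, n, hf⟩ := exists_dependsOn_Icc hf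
  have hdep : ∀ x : ℤ, DependsOn f
      ((insert x (insert (x + 1) (off x (Finset.Icc m n))) : Finset ℤ) : Set ℤ) := by
    refine fun x => hf.mono ?_
    have := subset_insert_off (x := x) (A := Finset.Icc m n)
    exact_mod_cast this
  rw [funext (exclGen_eq_sum hnn hf)]
  refine integrable_finsetSum _ fun x _ => ?_
  exact (integrable_of_dependsOn μ (dependsOn_jump (hdep x) (by simp) (by simp))).add
      (integrable_of_dependsOn μ (dependsOn_jump (hdep x) (by simp) (by simp)))

/-- Absence of flux across every bond in every environment. -/
def Balanced (p : ℤ → ℤ → ℝ) (μ : Measure (ℤ → Bool)) : Prop :=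
  ∀ (x : ℤ) (K C : Finset ℤ), x ∉ K → x + 1 ∉ K → C ⊆ K → flux p μ x K C = 0

/-- Stationarity of a not necessarily normalised measure. -/
def Stationary (p : ℤ → ℤ → ℝ) (μ : Measure (ℤ → Bool)) : Prop :=
  ∀ f : (ℤ → Bool) → ℝ, IsCylinder f → ∫ η, exclGen p f η ∂μ = 0

lemma Balanced.stationary {p : ℤ → ℤ → ℝ} (hnn : ∀ x y : ℤ, |x - y| ≠ 1 → p x y = 0)
    {μ : Measure (ℤ → Bool)} [IsFiniteMeasure μ] (h : Balanced p μ) : Stationary p μ := by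
  intro f hf
  obtain ⟨m, n, hf⟩ := exists_dependsOn_Icc hf
  rw [integral_exclGen_eq_sum hnn μ hf]
  refine Finset.sum_eq_zero fun x _ => Finset.sum_eq_zero fun C hC => ?_
  rw [h x _ C (left_notMem_off _ _) (right_notMem_off _ _) (Finset.mem_powerset.1 hC), zero_mul]

lemma flux_split (p : ℤ → ℤ → ℝ) (μ : Measure (ℤ → Bool)) [IsFiniteMeasure μ] {x z : ℤ}
    {K C : Finset ℤ} (hzK : z ∉ K) (hzx : z ≠ x) (hzy : z ≠ x + 1) (hzC : z ∉ C) :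
    flux p μ x K C = flux p μ x (insert z K) C + flux p μ x (insert z K) (insert z C) := by
  have hA : z ∉ insert x (insert (x + 1) K) := by simp [hzK, hzx, hzy]
  have e : insert z (insert x (insert (x + 1) K)) = insert x (insert (x + 1) (insert z K)) := by
    rw [Finset.insert_comm z x, Finset.insert_comm z]
  simp only [flux]
  rw [real_cyl_split μ hA (B := insert x C) (by simp [hzC, hzx]),
    real_cyl_split μ hA (B := insert (x + 1) C) (by simp [hzC, hzy]), e,
    Finset.insert_comm z x, Finset.insert_comm z]
  ring

lemma flux_add_measure (p : ℤ → ℤ → ℝ) (μ ν : Measure (ℤ → Bool)) [IsFiniteMeasure μ]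
    [IsFiniteMeasure ν] (x : ℤ) (K C : Finset ℤ) :
    flux p (μ + ν) x K C = flux p μ x K C + flux p ν x K C := by
  have h : ∀ E : Set (ℤ → Bool), (μ + ν).real E = μ.real E + ν.real E :=
    fun E => measureReal_add_apply
  simp only [flux, h]
  ring

/-! ### The entropy inequality -/

/-- Nearest-neighbour rates on `ℤ`, positive across bonds and reversible with respect to `π`. -/
structure NNRates (p : ℤ → ℤ → ℝ) (π : ℤ → ℝ) : Prop where
  nn : ∀ x y : ℤ, |x - y| ≠ 1 → p x y = 0
  right_pos : ∀ x, 0 < p x (x + 1)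
  left_pos : ∀ x, 0 < p (x + 1) x
  right_le_one : ∀ x, p x (x + 1) ≤ 1
  left_le_one : ∀ x, p (x + 1) x ≤ 1
  weight_pos : ∀ x, 0 < π x
  rev : ∀ x, π x * p x (x + 1) = π (x + 1) * p (x + 1) x

/-- Total variation of the flux across the bond `{x, x + 1}` given the state of `A`. -/
noncomputable def absFlux (p : ℤ → ℤ → ℝ) (μ : Measure (ℤ → Bool)) (x : ℤ) (A : Finset ℤ) : ℝ :=
  ∑ C ∈ (off x A).powerset, |flux p μ x (off x A) C|

lemma absFlux_nonneg (p : ℤ → ℤ → ℝ) (μ : Measure (ℤ → Bool)) (x : ℤ) (A : Finset ℤ) :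
    0 ≤ absFlux p μ x A := Finset.sum_nonneg fun _ _ => abs_nonneg _

lemma absFlux_le_insert (p : ℤ → ℤ → ℝ) (μ : Measure (ℤ → Bool)) [IsFiniteMeasure μ] (x z : ℤ)
    (A : Finset ℤ) : absFlux p μ x A ≤ absFlux p μ x (insert z A) := by
  by_cases hz : z ∈ off x A ∨ z = x ∨ z = x + 1
  · have : off x (insert z A) = off x A := by
      ext u
      simp only [off, Finset.mem_erase, Finset.mem_insert] at hz ⊢
      grind
    simp [absFlux, this]
  · simp only [not_or] at hz
    obtain ⟨hzK, hzx, hzy⟩ := hz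
    have : off x (insert z A) = insert z (off x A) := by
      ext u
      simp only [off, Finset.mem_erase, Finset.mem_insert] at hzK ⊢
      grind
    rw [absFlux, absFlux, this, Finset.sum_powerset_insert hzK, ← Finset.sum_add_distrib]
    refine Finset.sum_le_sum fun C hC => ?_
    rw [flux_split p μ hzK hzx hzy fun h => hzK (Finset.mem_powerset.1 hC h)]
    exact abs_add_le _ _

lemma absFlux_mono (p : ℤ → ℤ → ℝ) (μ : Measure (ℤ → Bool)) [IsFiniteMeasure μ] (x : ℤ) :
    Monotone (absFlux p μ x) := by
  exact Finset.monotone_iff_forall_le_insert.2 fun A z _ => absFlux_le_insert p μ x z A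

lemma sum_flux (p : ℤ → ℤ → ℝ) (μ : Measure (ℤ → Bool)) [IsFiniteMeasure μ] {x : ℤ}
    {K : Finset ℤ} (hx : x ∉ K) (hy : x + 1 ∉ K) :
    ∑ C ∈ K.powerset, flux p μ x K C = flux p μ x ∅ ∅ := by
  induction K using Finset.induction_on with
  | empty => simp
  | insert z s hz ih =>
    simp only [Finset.mem_insert, not_or] at hx hy
    rw [Finset.sum_powerset_insert hz, ← Finset.sum_add_distrib, ← ih hx.2 hy.2]
    refine Finset.sum_congr rfl fun C hC => ?_
    exact (flux_split p μ hz (Ne.symm hx.1) (Ne.symm hy.1)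
      fun h => hz (Finset.mem_powerset.1 hC h)).symm

lemma abs_flux_le_absFlux (p : ℤ → ℤ → ℝ) (μ : Measure (ℤ → Bool)) [IsFiniteMeasure μ] (x : ℤ)
    (A : Finset ℤ) : |flux p μ x ∅ ∅| ≤ absFlux p μ x A := by
  rw [← sum_flux p μ (left_notMem_off x A) (right_notMem_off x A)]
  exact Finset.abs_sum_le_sum_abs _ _

lemma sum_exchange_le (μ : Measure (ℤ → Bool)) [IsFiniteMeasure μ] {x y : ℤ} (hxy : x ≠ y)
    {K : Finset ℤ} (hx : x ∉ K) (hy : y ∉ K) :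
    ∑ C ∈ K.powerset, (μ.real (cyl (insert x (insert y K)) (insert x C)) +
      μ.real (cyl (insert x (insert y K)) (insert y C))) ≤ μ.real Set.univ := by
  rw [← sum_real_cyl μ (insert x (insert y K)), sum_powerset_insert_insert hxy hx hy]
  refine Finset.sum_le_sum fun C _ => ?_
  have h1 := measureReal_nonneg (μ := μ) (s := cyl (insert x (insert y K)) C)
  have h2 := measureReal_nonneg (μ := μ)
    (s := cyl (insert x (insert y K)) (insert x (insert y C)))
  linarith

lemma flux_le {p : ℤ → ℤ → ℝ} {π : ℤ → ℝ} (hp : NNRates p π) (μ : Measure (ℤ → Bool)) (x : ℤ)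
    (K C : Finset ℤ) :
    flux p μ x K C ≤ μ.real (cyl (insert x (insert (x + 1) K)) (insert x C)) := by
  have h1 := mul_le_of_le_one_left (measureReal_nonneg (μ := μ)
    (s := cyl (insert x (insert (x + 1) K)) (insert x C))) (hp.right_le_one x)
  have h2 := mul_nonneg (hp.left_pos x).le (measureReal_nonneg (μ := μ)
    (s := cyl (insert x (insert (x + 1) K)) (insert (x + 1) C)))
  rw [flux]
  linarith

lemma neg_flux_le {p : ℤ → ℤ → ℝ} {π : ℤ → ℝ} (hp : NNRates p π) (μ : Measure (ℤ → Bool)) (x : ℤ)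
    (K C : Finset ℤ) :
    -flux p μ x K C ≤ μ.real (cyl (insert x (insert (x + 1) K)) (insert (x + 1) C)) := by
  have h1 := mul_le_of_le_one_left (measureReal_nonneg (μ := μ)
    (s := cyl (insert x (insert (x + 1) K)) (insert (x + 1) C))) (hp.left_le_one x)
  have h2 := mul_nonneg (hp.right_pos x).le (measureReal_nonneg (μ := μ)
    (s := cyl (insert x (insert (x + 1) K)) (insert x C)))
  rw [flux]
  linarith

lemma absFlux_le_mass {p : ℤ → ℤ → ℝ} {π : ℤ → ℝ} (hp : NNRates p π) (μ : Measure (ℤ → Bool))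
    [IsFiniteMeasure μ] (x : ℤ) (A : Finset ℤ) : absFlux p μ x A ≤ μ.real Set.univ := by
  refine le_trans (Finset.sum_le_sum fun C _ => ?_) (sum_exchange_le μ (by lia)
    (left_notMem_off x A) (right_notMem_off x A))
  have h1 := flux_le hp μ x (off x A) C
  have h2 := neg_flux_le hp μ x (off x A) C
  have h3 := measureReal_nonneg (μ := μ)
    (s := cyl (insert x (insert (x + 1) (off x A))) (insert x C))
  have h4 := measureReal_nonneg (μ := μ)
    (s := cyl (insert x (insert (x + 1) (off x A))) (insert (x + 1) C))
  exact abs_le.2 ⟨by linarith, by linarith⟩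

/-- The expected particle current of a stationary measure is the same across all bonds. -/
lemma Stationary.current_succ {p : ℤ → ℤ → ℝ} (hnn : ∀ x y : ℤ, |x - y| ≠ 1 → p x y = 0)
    {μ : Measure (ℤ → Bool)} [IsFiniteMeasure μ] (h : Stationary p μ) (n : ℤ) :
    flux p μ n ∅ ∅ = flux p μ (n - 1) ∅ ∅ := by
  set f : (ℤ → Bool) → ℝ := fun η => if η n = true then 1 else 0 with hf
  have hdep : DependsOn f (Finset.Icc n n : Set ℤ) := fun η ξ h => by
    simp [hf, h n (by simp)]
  have h0 := h f ⟨{n}, fun η ξ h => by simp [hf, h n (by simp)]⟩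
  rw [integral_exclGen_eq_sum hnn μ hdep] at h0
  have e1 : Finset.Icc (n - 1) n = {n - 1, n} := by ext u; simp; lia
  have e2 : off n {n} = ∅ := by simp [off]
  have e3 : off (n - 1) {n} = ∅ := by
    ext u; simp only [off, Finset.mem_erase, Finset.mem_singleton, Finset.notMem_empty]; lia
  have hn : n ≠ n - 1 := by lia
  rw [Finset.Icc_self, e1, Finset.sum_pair (by lia), e2, e3] at h0
  simp [hf, cfg, hn] at h0
  linarith

lemma Stationary.current_eq {p : ℤ → ℤ → ℝ} (hnn : ∀ x y : ℤ, |x - y| ≠ 1 → p x y = 0)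
    {μ : Measure (ℤ → Bool)} [IsFiniteMeasure μ] (h : Stationary p μ) (n : ℤ) :
    flux p μ n ∅ ∅ = flux p μ 0 ∅ ∅ := by
  induction n using Int.induction_on with
  | zero => rfl
  | succ i ih => rw [h.current_succ hnn, ← ih]; congr 1; lia
  | pred i ih => rw [← h.current_succ hnn, ih]

lemma sq_sub_div_le_mul_log_sub {a b : ℝ} (ha : 0 < a) (hb : 0 < b) :
    (a - b) ^ 2 / (a + b) ≤ (a - b) * (Real.log a - Real.log b) := by
  wlog h : b ≤ a generalizing a b
  · have := this hb ha (le_of_not_ge h)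
    rw [add_comm b a] at this
    rw [sub_sq_comm a b]
    linarith
  have h1 : (a - b) / (a + b) ≤ Real.log a - Real.log b := by
    rw [← Real.log_div ha.ne' hb.ne']
    refine le_trans ?_ (Real.one_sub_inv_le_log_of_pos (div_pos ha hb))
    rw [inv_div, div_le_iff₀ (by positivity)]
    have : (1 - b / a) * (a + b) = (a - b) + (a - b) * b / a := by field_simp
    rw [this]
    have : 0 ≤ (a - b) * b / a := div_nonneg (mul_nonneg (by linarith) hb.le) ha.le
    linarith
  calc (a - b) ^ 2 / (a + b) = (a - b) * ((a - b) / (a + b)) := by ring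
    _ ≤ _ := mul_le_mul_of_nonneg_left h1 (by linarith)

lemma mul_log_sub_le {g a b : ℝ} (ha : 0 < a) (hb : 0 < b) (hgb : g ≤ b) (hga : -g ≤ a) :
    g * (Real.log a - Real.log b) ≤ 2 * (√|g| * √(a + b)) := by
  wlog h : 0 ≤ g generalizing g a b
  · have := this (g := -g) hb ha hga (by simpa using hgb) (by linarith)
    rw [abs_neg, add_comm b a] at this
    linarith
  have h1 : Real.log a - Real.log b ≤ 2 * √(a / b) := by
    have h2 := Real.log_sqrt (div_pos ha hb).le
    have h3 := Real.log_le_self (Real.sqrt_nonneg (a / b))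
    rw [← Real.log_div ha.ne' hb.ne']
    linarith
  have h2 : g * √(a / b) ≤ √g * √(a + b) := by
    rw [← Real.sqrt_mul h]
    refine Real.le_sqrt_of_sq_le ?_
    rw [mul_pow, Real.sq_sqrt (div_pos ha hb).le]
    have : g ^ 2 * (a / b) = g * a * (g / b) := by ring
    rw [this]
    have h3 : g / b ≤ 1 := (div_le_one hb).2 hgb
    nlinarith [mul_nonneg h ha.le, mul_nonneg h hb.le]
  rw [abs_of_nonneg h]
  calc g * (Real.log a - Real.log b) ≤ g * (2 * √(a / b)) := mul_le_mul_of_nonneg_left h1 h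
    _ ≤ _ := by linarith

lemma sum_mul_log_sub_le {ι : Type*} (s : Finset ι) {g a b : ι → ℝ} {M : ℝ}
    (ha : ∀ i ∈ s, 0 < a i) (hb : ∀ i ∈ s, 0 < b i) (hgb : ∀ i ∈ s, g i ≤ b i)
    (hga : ∀ i ∈ s, -g i ≤ a i) (hM : ∑ i ∈ s, (a i + b i) ≤ M) :
    ∑ i ∈ s, g i * (Real.log (a i) - Real.log (b i)) ≤ 2 * (√(∑ i ∈ s, |g i|) * √M) := by
  calc ∑ i ∈ s, g i * (Real.log (a i) - Real.log (b i))
      ≤ ∑ i ∈ s, 2 * (√|g i| * √(a i + b i)) := Finset.sum_le_sum fun i hi =>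
        mul_log_sub_le (ha i hi) (hb i hi) (hgb i hi) (hga i hi)
    _ = 2 * ∑ i ∈ s, √|g i| * √(|a i + b i|) := by
        rw [Finset.mul_sum]
        exact Finset.sum_congr rfl fun i hi => by
          rw [abs_of_pos (add_pos (ha i hi) (hb i hi))]
    _ ≤ 2 * (√(∑ i ∈ s, |g i|) * √(∑ i ∈ s, |a i + b i|)) := by
        gcongr
        exact Real.sum_sqrt_mul_sqrt_le s (fun _ => abs_nonneg _) fun _ => abs_nonneg _
    _ ≤ _ := by
        gcongr
        refine le_trans (Finset.sum_le_sum fun i hi => ?_) hM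
        rw [abs_of_pos (add_pos (ha i hi) (hb i hi))]

/-- The logarithm of the density of `μ` in `A` with respect to the product weight `π`. -/
noncomputable def logDensity (π : ℤ → ℝ) (μ : Measure (ℤ → Bool)) (A B : Finset ℤ) : ℝ :=
  Real.log (μ.real (cyl A B)) - ∑ z ∈ A ∩ B, Real.log (π z)

lemma logDensity_congr (π : ℤ → ℝ) (μ : Measure (ℤ → Bool)) {A B B' : Finset ℤ}
    (h : ∀ x ∈ A, x ∈ B ↔ x ∈ B') : logDensity π μ A B = logDensity π μ A B' := by
  have : A ∩ B = A ∩ B' := by ext x; simp only [Finset.mem_inter]; exact and_congr_right (h x)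
  rw [logDensity, logDensity, cyl_congr h, this]

lemma logDensity_insert_of_notMem (π : ℤ → ℝ) (μ : Measure (ℤ → Bool)) {A B : Finset ℤ} {z : ℤ}
    (hz : z ∉ A) : logDensity π μ A (insert z B) = logDensity π μ A B :=
  logDensity_congr π μ fun x hx => by
    have : x ≠ z := fun h => hz (h ▸ hx)
    simp [this]

lemma logDensity_insert (π : ℤ → ℝ) (μ : Measure (ℤ → Bool)) {A B : Finset ℤ} {z : ℤ}
    (hz : z ∈ A) (hB : z ∉ B) : logDensity π μ A (insert z B) =
      Real.log (μ.real (cyl A (insert z B))) - Real.log (π z) - ∑ z ∈ A ∩ B, Real.log (π z) := by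
  rw [logDensity, Finset.inter_insert_of_mem hz, Finset.sum_insert (by simp [hB])]
  ring

lemma real_cyl_mono (μ : Measure (ℤ → Bool)) [IsFiniteMeasure μ] {A A' : Finset ℤ} (h : A ⊆ A')
    (B : Finset ℤ) : μ.real (cyl A' B) ≤ μ.real (cyl A B) :=
  measureReal_mono fun _ hη x hx => hη x (h hx)

/-- The entropy production of a bond inside `A` dominates its squared flux. -/
lemma sq_absFlux_le {p : ℤ → ℤ → ℝ} {π : ℤ → ℝ} (hp : NNRates p π) (μ : Measure (ℤ → Bool))
    [IsFiniteMeasure μ] (hpos : ∀ A B : Finset ℤ, 0 < μ.real (cyl A B)) {x : ℤ} {A : Finset ℤ}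
    (hx : x ∈ A) (hy : x + 1 ∈ A) :
    absFlux p μ x A ^ 2 ≤ μ.real Set.univ * -∑ C ∈ (off x A).powerset, flux p μ x (off x A) C *
      (logDensity π μ A (insert (x + 1) C) - logDensity π μ A (insert x C)) := by
  have hxy : x ≠ x + 1 := by lia
  have hA : insert x (insert (x + 1) (off x A)) = A := by
    ext u; simp only [off, Finset.mem_insert, Finset.mem_erase]; grind
  set a : Finset ℤ → ℝ := fun C => p x (x + 1) * μ.real (cyl A (insert x C)) with ha
  set b : Finset ℤ → ℝ := fun C => p (x + 1) x * μ.real (cyl A (insert (x + 1) C)) with hb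
  have ha0 : ∀ C, 0 < a C := fun C => mul_pos (hp.right_pos x) (hpos _ _)
  have hb0 : ∀ C, 0 < b C := fun C => mul_pos (hp.left_pos x) (hpos _ _)
  have hflux : ∀ C, flux p μ x (off x A) C = a C - b C := fun C => by rw [flux, hA]
  have hsum : ∑ C ∈ (off x A).powerset, (a C + b C) ≤ μ.real Set.univ := by
    refine le_trans (Finset.sum_le_sum fun C _ => ?_) (sum_exchange_le μ hxy
      (left_notMem_off x A) (right_notMem_off x A))
    rw [hA]
    exact add_le_add (mul_le_of_le_one_left (hpos _ _).le (hp.right_le_one x))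
      (mul_le_of_le_one_left (hpos _ _).le (hp.left_le_one x))
  have hterm : ∀ C ∈ (off x A).powerset, |a C - b C| ^ 2 / (a C + b C) ≤
      -(flux p μ x (off x A) C *
        (logDensity π μ A (insert (x + 1) C) - logDensity π μ A (insert x C))) := by
    intro C hC
    have hxC : x ∉ C := fun h => left_notMem_off x A (Finset.mem_powerset.1 hC h)
    have hyC : x + 1 ∉ C := fun h => right_notMem_off x A (Finset.mem_powerset.1 hC h)
    have hrev := congrArg Real.log (hp.rev x)
    rw [Real.log_mul (hp.weight_pos _).ne' (hp.right_pos _).ne',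
      Real.log_mul (hp.weight_pos _).ne' (hp.left_pos _).ne'] at hrev
    have hla : Real.log (a C) = Real.log (p x (x + 1)) + Real.log (μ.real (cyl A (insert x C))) :=
      Real.log_mul (hp.right_pos x).ne' (hpos _ _).ne'
    have hlb : Real.log (b C) =
        Real.log (p (x + 1) x) + Real.log (μ.real (cyl A (insert (x + 1) C))) :=
      Real.log_mul (hp.left_pos x).ne' (hpos _ _).ne'
    have hdiff : logDensity π μ A (insert (x + 1) C) - logDensity π μ A (insert x C) =
        -(Real.log (a C) - Real.log (b C)) := by
      rw [logDensity_insert π μ hy hyC, logDensity_insert π μ hx hxC, hla, hlb]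
      linarith
    rw [hflux, hdiff, mul_neg, neg_neg, sq_abs]
    exact sq_sub_div_le_mul_log_sub (ha0 C) (hb0 C)
  have hG : absFlux p μ x A = ∑ C ∈ (off x A).powerset, |a C - b C| :=
    Finset.sum_congr rfl fun C _ => by rw [hflux]
  have hpos' : 0 < ∑ C ∈ (off x A).powerset, (a C + b C) :=
    Finset.sum_pos (fun C _ => add_pos (ha0 C) (hb0 C)) ⟨∅, by simp⟩
  have hT := (Finset.sq_sum_div_le_sum_sq_div (off x A).powerset (fun C => |a C - b C|)
    (g := fun C => a C + b C) fun C _ => add_pos (ha0 C) (hb0 C)).trans (Finset.sum_le_sum hterm)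
  rw [Finset.sum_neg_distrib, ← hG] at hT
  rw [div_le_iff₀ hpos'] at hT
  refine hT.trans ?_
  rw [mul_comm]
  refine mul_le_mul_of_nonneg_right hsum ?_
  by_contra hneg
  have := mul_neg_of_neg_of_pos (not_le.1 hneg) hpos'
  nlinarith [sq_nonneg (absFlux p μ x A)]

/-- The entropy flow through the right end of `Icc m n`. -/
lemma right_boundary_le {p : ℤ → ℤ → ℝ} {π : ℤ → ℝ} (hp : NNRates p π) (μ : Measure (ℤ → Bool))
    [IsFiniteMeasure μ] (hpos : ∀ A B : Finset ℤ, 0 < μ.real (cyl A B)) {n : ℤ} {A : Finset ℤ}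
    (hn : n ∈ A) (hn' : n + 1 ∉ A) :
    ∑ C ∈ (off n A).powerset, flux p μ n (off n A) C *
      (logDensity π μ A (insert (n + 1) C) - logDensity π μ A (insert n C)) ≤
    2 * (√(absFlux p μ n A) * √(μ.real Set.univ)) + flux p μ n ∅ ∅ * Real.log (π n) := by
  have hoff : off n A = A.erase n := by
    ext u; simp only [off, Finset.mem_erase]; grind
  have hA : insert n (off n A) = A := by rw [hoff, Finset.insert_erase hn]
  have hsub : A ⊆ insert n (insert (n + 1) (off n A)) := subset_insert_off
  have hnC : ∀ C ∈ (off n A).powerset, n ∉ C := fun C hC h =>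
    left_notMem_off n A (Finset.mem_powerset.1 hC h)
  have hterm : ∀ C ∈ (off n A).powerset, flux p μ n (off n A) C *
      (logDensity π μ A (insert (n + 1) C) - logDensity π μ A (insert n C)) =
      flux p μ n (off n A) C * (Real.log (μ.real (cyl A C)) -
        Real.log (μ.real (cyl A (insert n C)))) +
      flux p μ n (off n A) C * Real.log (π n) := by
    intro C hC
    rw [logDensity_insert_of_notMem π μ hn', logDensity_insert π μ hn (hnC C hC), logDensity]
    ring
  rw [Finset.sum_congr rfl hterm, Finset.sum_add_distrib, ← Finset.sum_mul,
    sum_flux p μ (left_notMem_off n A) (right_notMem_off n A)]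
  refine add_le_add_left (sum_mul_log_sub_le _ (fun _ _ => hpos _ _) (fun _ _ => hpos _ _)
    (fun C _ => (flux_le hp μ n _ C).trans (real_cyl_mono μ hsub _)) (fun C _ => ?_) ?_) _
  · refine (neg_flux_le hp μ n _ C).trans ((real_cyl_mono μ hsub _).trans_eq ?_)
    rw [cyl_congr (B' := C) fun x hx => ?_]
    have : x ≠ n + 1 := fun h => hn' (h ▸ hx)
    simp [this]
  · rw [Finset.sum_add_distrib, ← sum_real_cyl μ A]
    conv_rhs => rw [← hA, Finset.sum_powerset_insert (left_notMem_off n A), hA]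

/-- The entropy flow through the left end of `Icc m n`. -/
lemma left_boundary_le {p : ℤ → ℤ → ℝ} {π : ℤ → ℝ} (hp : NNRates p π) (μ : Measure (ℤ → Bool))
    [IsFiniteMeasure μ] (hpos : ∀ A B : Finset ℤ, 0 < μ.real (cyl A B)) {n : ℤ} {A : Finset ℤ}
    (hn : n ∉ A) (hn' : n + 1 ∈ A) :
    ∑ C ∈ (off n A).powerset, flux p μ n (off n A) C *
      (logDensity π μ A (insert (n + 1) C) - logDensity π μ A (insert n C)) ≤
    2 * (√(absFlux p μ n A) * √(μ.real Set.univ)) - flux p μ n ∅ ∅ * Real.log (π (n + 1)) := by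
  have hoff : off n A = A.erase (n + 1) := by
    ext u; simp only [off, Finset.mem_erase]; grind
  have hA : insert (n + 1) (off n A) = A := by rw [hoff, Finset.insert_erase hn']
  have hsub : A ⊆ insert n (insert (n + 1) (off n A)) := subset_insert_off
  have hnC : ∀ C ∈ (off n A).powerset, n + 1 ∉ C := fun C hC h =>
    right_notMem_off n A (Finset.mem_powerset.1 hC h)
  have hterm : ∀ C ∈ (off n A).powerset, flux p μ n (off n A) C *
      (logDensity π μ A (insert (n + 1) C) - logDensity π μ A (insert n C)) =
      flux p μ n (off n A) C * (Real.log (μ.real (cyl A (insert (n + 1) C))) -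
        Real.log (μ.real (cyl A C))) -
      flux p μ n (off n A) C * Real.log (π (n + 1)) := by
    intro C hC
    rw [logDensity_insert_of_notMem π μ hn, logDensity_insert π μ hn' (hnC C hC), logDensity]
    ring
  rw [Finset.sum_congr rfl hterm, Finset.sum_sub_distrib, ← Finset.sum_mul,
    sum_flux p μ (left_notMem_off n A) (right_notMem_off n A)]
  refine sub_le_sub_right (sum_mul_log_sub_le _ (fun _ _ => hpos _ _) (fun _ _ => hpos _ _)
    (fun C _ => ?_) (fun C _ => (neg_flux_le hp μ n _ C).trans (real_cyl_mono μ hsub _)) ?_) _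
  · refine (flux_le hp μ n _ C).trans ((real_cyl_mono μ hsub _).trans_eq ?_)
    rw [cyl_congr (B' := C) fun x hx => ?_]
    have : x ≠ n := fun h => hn (h ▸ hx)
    simp [this]
  · rw [Finset.sum_add_distrib, ← sum_real_cyl μ A]
    conv_rhs => rw [← hA, Finset.sum_powerset_insert (right_notMem_off n A), hA]
    rw [add_comm]

lemma dependsOn_logDensity (π : ℤ → ℝ) (μ : Measure (ℤ → Bool)) (A : Finset ℤ) :
    DependsOn (fun η : ℤ → Bool => logDensity π μ A (A.filter fun z => η z = true))
      (A : Set ℤ) := fun η ξ h => logDensity_congr π μ fun x hx => by simp [h x hx]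

/-- In a stationary measure, the total squared flux in a box is controlled by the boundary. -/
lemma Stationary.sum_sq_absFlux_le {p : ℤ → ℤ → ℝ} {π : ℤ → ℝ} (hp : NNRates p π)
    {μ : Measure (ℤ → Bool)} [IsFiniteMeasure μ] (h : Stationary p μ)
    (hpos : ∀ A B : Finset ℤ, 0 < μ.real (cyl A B)) {m n : ℤ} (hmn : m ≤ n) :
    ∑ x ∈ Finset.Ico m n, absFlux p μ x (Finset.Icc m n) ^ 2 ≤ μ.real Set.univ *
      (2 * (√(absFlux p μ n (Finset.Icc m n)) * √(μ.real Set.univ)) +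
        2 * (√(absFlux p μ (m - 1) (Finset.Icc m n)) * √(μ.real Set.univ)) +
        flux p μ 0 ∅ ∅ * (Real.log (π n) - Real.log (π m))) := by
  set A := Finset.Icc m n with hA
  have hdep := dependsOn_logDensity π μ A
  have h0 := h _ ⟨A, fun η ξ h => hdep h⟩
  rw [integral_exclGen_eq_sum hp.nn μ hdep] at h0
  have hcfg : ∀ B : Finset ℤ, logDensity π μ A (A.filter fun z => cfg B z = true) =
      logDensity π μ A B := fun B => logDensity_congr π μ fun x hx => by simp [cfg, hx]
  simp only [hcfg, ← hA] at h0
  have hsplit : Finset.Icc (m - 1) n = insert (m - 1) (insert n (Finset.Ico m n)) := by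
    ext u; simp only [Finset.mem_Icc, Finset.mem_insert, Finset.mem_Ico]; lia
  rw [hsplit, Finset.sum_insert (by simp; lia), Finset.sum_insert (by simp)] at h0
  have hR := right_boundary_le hp μ hpos (n := n) (A := A) (by simp [hA, hmn]) (by simp [hA])
  have hL := left_boundary_le hp μ hpos (n := m - 1) (A := A) (by simp [hA]) (by simp [hA, hmn])
  have hI := Finset.sum_le_sum fun x (hx : x ∈ Finset.Ico m n) =>
    sq_absFlux_le hp μ hpos (x := x) (A := A)
      (by simp only [hA, Finset.mem_Icc, Finset.mem_Ico] at hx ⊢; lia)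
      (by simp only [hA, Finset.mem_Icc, Finset.mem_Ico] at hx ⊢; lia)
  rw [← Finset.mul_sum, Finset.sum_neg_distrib] at hI
  refine hI.trans (mul_le_mul_of_nonneg_left ?_ measureReal_nonneg)
  rw [h.current_eq hp.nn] at hR hL
  rw [sub_add_cancel] at hL
  simp only [sub_add_cancel] at h0 hL
  linarith

/-! ### Stationary measures are balanced -/

lemma Stationary.current_eq_zero {p : ℤ → ℤ → ℝ} {π : ℤ → ℝ} (hp : NNRates p π)
    {μ : Measure (ℤ → Bool)} [IsFiniteMeasure μ] (h : Stationary p μ)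
    (hpos : ∀ A B : Finset ℤ, 0 < μ.real (cyl A B))
    (hbdd : ∃ R : ℝ, ∀ N : ℤ, ∃ m ≤ N, |Real.log (π m)| ≤ R) : flux p μ 0 ∅ ∅ = 0 := by
  obtain ⟨R, hR⟩ := hbdd
  set J := flux p μ 0 ∅ ∅ with hJ
  set M := μ.real Set.univ with hM
  have hM0 : 0 ≤ M := measureReal_nonneg
  set D := M * (2 * (√M * √M) + 2 * (√M * √M) + |J| * (|Real.log (π 0)| + R)) with hD
  have key : ∀ N : ℕ, (N : ℝ) * J ^ 2 ≤ D := by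
    intro N
    obtain ⟨m, hm, hmR⟩ := hR (-N)
    have hm0 : m ≤ 0 := hm.trans (by simp)
    have h1 := h.sum_sq_absFlux_le hp hpos hm0
    have h2 : ∑ x ∈ Finset.Ico m 0, J ^ 2 ≤
        ∑ x ∈ Finset.Ico m 0, absFlux p μ x (Finset.Icc m 0) ^ 2 := by
      refine Finset.sum_le_sum fun x _ => ?_
      rw [← sq_abs J, hJ, ← h.current_eq hp.nn x]
      exact pow_le_pow_left₀ (abs_nonneg _) (abs_flux_le_absFlux p μ x _) 2
    rw [Finset.sum_const, Int.card_Ico, nsmul_eq_mul] at h2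
    have h3 : (N : ℝ) * J ^ 2 ≤ ((0 - m).toNat : ℝ) * J ^ 2 := by
      refine mul_le_mul_of_nonneg_right ?_ (sq_nonneg J)
      exact_mod_cast (by lia : N ≤ (0 - m).toNat)
    refine h3.trans (h2.trans (h1.trans ?_))
    have h4 : J * (Real.log (π 0) - Real.log (π m)) ≤ |J| * (|Real.log (π 0)| + R) := by
      refine (le_abs_self _).trans ?_
      rw [abs_mul]
      exact mul_le_mul_of_nonneg_left ((abs_sub _ _).trans (by linarith)) (abs_nonneg J)
    rw [hD]
    gcongr
    · exact absFlux_le_mass hp μ _ _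
    · exact absFlux_le_mass hp μ _ _
  by_contra hne
  have hJ2 : 0 < J ^ 2 := by positivity
  obtain ⟨N, hN⟩ := exists_nat_gt (D / J ^ 2)
  rw [div_lt_iff₀ hJ2] at hN
  exact absurd (key N) (not_le.2 hN)

/-- A stationary measure charging all cylinders is balanced, provided the reversible weight
stays away from `0` and `∞` along some sequence tending to `-∞`. -/
lemma Stationary.balanced_of_pos {p : ℤ → ℤ → ℝ} {π : ℤ → ℝ} (hp : NNRates p π)
    {μ : Measure (ℤ → Bool)} [IsFiniteMeasure μ] (h : Stationary p μ)
    (hpos : ∀ A B : Finset ℤ, 0 < μ.real (cyl A B))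
    (hbdd : ∃ R : ℝ, ∀ N : ℤ, ∃ m ≤ N, |Real.log (π m)| ≤ R) : Balanced p μ := by
  have hJ := h.current_eq_zero hp hpos hbdd
  set M := μ.real Set.univ with hM
  have hM0 : 0 ≤ M := measureReal_nonneg
  have hbound : ∀ m n : ℤ, m ≤ n →
      ∑ x ∈ Finset.Ico m n, absFlux p μ x (Finset.Icc m n) ^ 2 ≤
      M * (2 * (√(absFlux p μ n (Finset.Icc m n)) * √M) +
        2 * (√(absFlux p μ (m - 1) (Finset.Icc m n)) * √M)) := by
    intro m n hmn
    have := h.sum_sq_absFlux_le hp hpos hmn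
    rwa [hJ, zero_mul, add_zero] at this
  have hbddA : ∀ x, BddAbove (Set.range (absFlux p μ x)) := fun x =>
    ⟨M, by rintro _ ⟨A, rfl⟩; exact absFlux_le_mass hp μ x A⟩
  set g : ℤ → ℝ := fun x => ⨆ A : Finset ℤ, absFlux p μ x A with hg
  have hle : ∀ x A, absFlux p μ x A ≤ g x := fun x A => le_ciSup (hbddA x) A
  have hlim : ∀ x, Tendsto (absFlux p μ x) atTop (𝓝 (g x)) := fun x =>
    tendsto_atTop_ciSup (absFlux_mono p μ x) (hbddA x)
  have hsq : ∀ s : Finset ℤ, ∀ A : Finset ℤ, ∃ N₀ : ℕ, ∀ N : ℕ, N₀ ≤ N →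
      ∑ x ∈ s, absFlux p μ x A ^ 2 ≤
      ∑ x ∈ Finset.Ico (-N : ℤ) N, absFlux p μ x (Finset.Icc (-N) N) ^ 2 := by
    intro s A
    refine ⟨∑ x ∈ s ∪ A, (x.natAbs + 1), fun N hN => ?_⟩
    have hmem : ∀ x ∈ s ∪ A, -(N : ℤ) ≤ x ∧ x < N := by
      intro x hx
      have := Finset.single_le_sum (f := fun x : ℤ => x.natAbs + 1) (fun _ _ => Nat.zero_le _) hx
      lia
    have hs : s ⊆ Finset.Ico (-N : ℤ) N := fun x hx =>
      Finset.mem_Ico.2 (hmem x (Finset.mem_union_left _ hx))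
    have hA : A ⊆ Finset.Icc (-N : ℤ) N := fun x hx =>
      Finset.mem_Icc.2 ⟨(hmem x (Finset.mem_union_right _ hx)).1,
        (hmem x (Finset.mem_union_right _ hx)).2.le⟩
    refine (Finset.sum_le_sum fun x _ => ?_).trans
      (Finset.sum_le_sum_of_subset_of_nonneg hs fun _ _ _ => sq_nonneg _)
    exact pow_le_pow_left₀ (absFlux_nonneg p μ x A) (absFlux_mono p μ x hA) 2
  have hsum : Summable fun x => g x ^ 2 := by
    refine summable_of_sum_le (c := M * (2 * (√M * √M) + 2 * (√M * √M)))
      (fun x => sq_nonneg _) fun s => ?_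
    refine le_of_tendsto' (tendsto_finsetSum s fun x _ => (hlim x).pow 2) fun A => ?_
    obtain ⟨N, hN⟩ := hsq s A
    refine (hN N le_rfl).trans ((hbound (-N) N (by lia)).trans ?_)
    gcongr
    · exact absFlux_le_mass hp μ _ _
    · exact absFlux_le_mass hp μ _ _
  have hg0 : Tendsto (fun x => √(g x)) cofinite (𝓝 0) := by
    have h1 : Tendsto (fun t : ℝ => √(√t)) (𝓝 0) (𝓝 0) := by
      have : Continuous fun t : ℝ => √(√t) := by fun_prop
      have := this.tendsto 0
      rwa [Real.sqrt_zero, Real.sqrt_zero] at this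
    refine (h1.comp hsum.tendsto_cofinite_zero).congr fun x => ?_
    rw [Function.comp_apply, Real.sqrt_sq ((absFlux_nonneg p μ x ∅).trans (hle x ∅))]
  have hright : Tendsto (fun N : ℕ => √(g N)) atTop (𝓝 0) := by
    rw [← Nat.cofinite_eq_atTop]
    exact hg0.comp (Function.Injective.tendsto_cofinite (fun a b h => by simpa using h))
  have hleft : Tendsto (fun N : ℕ => √(g (-N - 1))) atTop (𝓝 0) := by
    rw [← Nat.cofinite_eq_atTop]
    exact hg0.comp (Function.Injective.tendsto_cofinite
      (f := fun N : ℕ => (-N - 1 : ℤ)) (fun a b h => by simpa using h))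
  have hzero : ∀ x A, absFlux p μ x A = 0 := by
    intro x A
    have ht : Tendsto (fun N : ℕ => M * (2 * (√(g N) * √M) + 2 * (√(g (-N - 1)) * √M))) atTop
        (𝓝 (M * (2 * (0 * √M) + 2 * (0 * √M)))) :=
      (((hright.mul_const _).const_mul _).add ((hleft.mul_const _).const_mul _)).const_mul _
    have h2 : absFlux p μ x A ^ 2 ≤ M * (2 * (0 * √M) + 2 * (0 * √M)) := by
      obtain ⟨N₀, hN₀⟩ := hsq {x} A
      refine ge_of_tendsto ht ((eventually_ge_atTop N₀).mono fun N hN => ?_)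
      have := hN₀ N hN
      rw [Finset.sum_singleton] at this
      refine this.trans ((hbound (-N) N (by lia)).trans ?_)
      gcongr <;> exact hle _ _
    have h3 : absFlux p μ x A ^ 2 = 0 := le_antisymm (by simpa using h2) (sq_nonneg _)
    exact pow_eq_zero_iff two_ne_zero |>.1 h3
  intro x K C hx hy hC
  have hoff : off x K = K := by rw [off, Finset.erase_eq_of_notMem hx, Finset.erase_eq_of_notMem hy]
  have := hzero x K
  rw [absFlux, hoff, Finset.sum_eq_zero_iff_of_nonneg fun _ _ => abs_nonneg _] at this
  exact abs_eq_zero.1 (this C (Finset.mem_powerset.2 hC))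

/-! ### Reduction to measures charging all cylinders -/

lemma bernoulli_real_cyl {ν : Measure (ℤ → Bool)} {α : ℤ → ℝ}
    (h : IsBernoulliProduct ν α) (hα : ∀ x, 0 ≤ α x) (hα' : ∀ x, α x ≤ 1) (A B : Finset ℤ) :
    ν.real (cyl A B) = ∏ x ∈ A, if x ∈ B then α x else 1 - α x := by
  rw [measureReal_def]
  have := h.2 A (cfg B)
  rw [show cyl A B = {η | ∀ x ∈ A, η x = cfg B x} from rfl, this, ENNReal.toReal_prod]
  refine Finset.prod_congr rfl fun x _ => ?_
  rw [ENNReal.toReal_ofReal]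
  · simp [cfg]
  · have := hα x
    have := hα' x
    split_ifs <;> linarith

lemma exists_isBernoulliProduct {α : ℤ → ℝ} (hα : ∀ x, 0 ≤ α x) (hα' : ∀ x, α x ≤ 1) :
    ∃ ν : Measure (ℤ → Bool), IsBernoulliProduct ν α := by
  let m : ℤ → Measure Bool := fun x =>
    ENNReal.ofReal (α x) • Measure.dirac true + ENNReal.ofReal (1 - α x) • Measure.dirac false
  have hm : ∀ x, IsProbabilityMeasure (m x) := fun x => ⟨by
    simp [m, ← ENNReal.ofReal_add (hα x) (sub_nonneg.2 (hα' x))]⟩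
  refine ⟨Measure.infinitePi m, inferInstance, fun F a => ?_⟩
  have : {η : ℤ → Bool | ∀ x ∈ F, η x = a x} = Set.pi F fun x => {a x} := by
    ext η; simp [Set.mem_pi]
  rw [this, Measure.infinitePi_pi _ fun _ _ => measurableSet_singleton _]
  refine Finset.prod_congr rfl fun x _ => ?_
  cases a x <;> simp [m]

/-- The one-site density of the reversible product measure whose density is `θ` wherever the
reversible weight equals `L`. -/
noncomputable def density (π : ℤ → ℝ) (L θ : ℝ) (x : ℤ) : ℝ := θ * π x / (L * (1 - θ) + θ * π x)

lemma density_denom_pos {L θ t : ℝ} (hL : 0 < L) (hθ : θ ∈ Set.Icc 0 1) (ht : 0 < t) :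
    0 < L * (1 - θ) + θ * t := by
  rcases hθ.1.eq_or_lt with rfl | h
  · simpa using hL
  · exact add_pos_of_nonneg_of_pos (mul_nonneg hL.le (sub_nonneg.2 hθ.2)) (mul_pos h ht)

lemma density_nonneg {π : ℤ → ℝ} (hπ : ∀ x, 0 < π x) {L θ : ℝ} (hL : 0 < L)
    (hθ : θ ∈ Set.Icc 0 1) (x : ℤ) : 0 ≤ density π L θ x :=
  div_nonneg (mul_nonneg hθ.1 (hπ x).le) (density_denom_pos hL hθ (hπ x)).le

lemma one_sub_density {π : ℤ → ℝ} (hπ : ∀ x, 0 < π x) {L θ : ℝ} (hL : 0 < L)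
    (hθ : θ ∈ Set.Icc 0 1) (x : ℤ) :
    1 - density π L θ x = L * (1 - θ) / (L * (1 - θ) + θ * π x) := by
  have := (density_denom_pos hL hθ (hπ x)).ne'
  rw [density]
  field_simp
  ring

lemma density_le_one {π : ℤ → ℝ} (hπ : ∀ x, 0 < π x) {L θ : ℝ} (hL : 0 < L)
    (hθ : θ ∈ Set.Icc 0 1) (x : ℤ) : density π L θ x ≤ 1 := by
  rw [← sub_nonneg, one_sub_density hπ hL hθ]
  exact div_nonneg (mul_nonneg hL.le (sub_nonneg.2 hθ.2)) (density_denom_pos hL hθ (hπ x)).le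

lemma density_reversible {π : ℤ → ℝ} (hπ : ∀ x, 0 < π x) {L θ : ℝ} (hL : 0 < L)
    (hθ : θ ∈ Set.Icc 0 1) (x y : ℤ) :
    π y * (density π L θ x * (1 - density π L θ y)) =
      π x * (density π L θ y * (1 - density π L θ x)) := by
  rw [one_sub_density hπ hL hθ, one_sub_density hπ hL hθ, density, density]
  have := (density_denom_pos hL hθ (hπ x)).ne'
  have := (density_denom_pos hL hθ (hπ y)).ne'
  field_simp

lemma bernoulli_density_real_cyl {π : ℤ → ℝ} (hπ : ∀ x, 0 < π x) {L θ : ℝ} (hL : 0 < L)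
    (hθ : θ ∈ Set.Icc 0 1)
    {ν : Measure (ℤ → Bool)} (h : IsBernoulliProduct ν (density π L θ)) (A B : Finset ℤ) :
    ν.real (cyl A B) = ∏ x ∈ A, if x ∈ B then density π L θ x else 1 - density π L θ x :=
  bernoulli_real_cyl h (density_nonneg hπ hL hθ) (density_le_one hπ hL hθ) A B

lemma bernoulli_density_balanced {π : ℤ → ℝ} (hπ : ∀ x, 0 < π x) {L θ : ℝ} (hL : 0 < L)
    (hθ : θ ∈ Set.Icc 0 1) {p : ℤ → ℤ → ℝ} (hp : NNRates p π)
    {ν : Measure (ℤ → Bool)} (h : IsBernoulliProduct ν (density π L θ)) : Balanced p ν := by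
  intro x K C hx hy hC
  have hxy : x ≠ x + 1 := by lia
  have hxC : x ∉ C := fun h => hx (hC h)
  have hyC : x + 1 ∉ C := fun h => hy (hC h)
  have hprod : ∀ z, z ∉ K → ∀ w : ℤ → ℝ, ∏ u ∈ K, (if u ∈ insert z C then w u else 1 - w u) =
      ∏ u ∈ K, (if u ∈ C then w u else 1 - w u) := fun z hz w =>
    Finset.prod_congr rfl fun u hu => by
      have : u ≠ z := fun h => hz (h ▸ hu)
      simp [this]
  have h1 := density_reversible hπ hL hθ x (x + 1)
  have h2 := hp.rev x
  rw [flux, bernoulli_density_real_cyl hπ hL hθ h, bernoulli_density_real_cyl hπ hL hθ h,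
    Finset.prod_insert (by simp [hx]), Finset.prod_insert hy, Finset.prod_insert (by simp [hx]),
    Finset.prod_insert hy, hprod x hx, hprod _ hy]
  set P := ∏ u ∈ K, (if u ∈ C then density π L θ u else 1 - density π L θ u)
  simp only [Finset.mem_insert, hxC, hyC, hxy, hxy.symm, or_false, if_true, if_false]
  refine (mul_eq_zero.1 ?_).resolve_left (hπ x).ne'
  linear_combination density π L θ x * (1 - density π L θ (x + 1)) * P * h2 +
    p (x + 1) x * P * h1

/-- Every stationary measure is balanced. -/
lemma Stationary.balanced {p : ℤ → ℤ → ℝ} {π : ℤ → ℝ} (hp : NNRates p π)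
    (hbdd : ∃ R : ℝ, ∀ N : ℤ, ∃ m ≤ N, |Real.log (π m)| ≤ R)
    {μ : Measure (ℤ → Bool)} [IsFiniteMeasure μ] (h : Stationary p μ) : Balanced p μ := by
  have hθ : (1 / 2 : ℝ) ∈ Set.Icc (0 : ℝ) 1 := by constructor <;> norm_num
  obtain ⟨ν, hν⟩ := exists_isBernoulliProduct (density_nonneg hp.weight_pos one_pos hθ)
    (density_le_one hp.weight_pos one_pos hθ)
  have := hν.1
  have hbal := bernoulli_density_balanced hp.weight_pos one_pos hθ hp hν
  have hstat : Stationary p (μ + ν) := fun f hf => by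
    rw [integral_add_measure (integrable_exclGen hp.nn μ hf) (integrable_exclGen hp.nn ν hf),
      h f hf, hbal.stationary hp.nn f hf, add_zero]
  have hpos : ∀ A B : Finset ℤ, 0 < (μ + ν).real (cyl A B) := fun A B => by
    rw [measureReal_add_apply]
    refine add_pos_of_nonneg_of_pos measureReal_nonneg ?_
    rw [bernoulli_density_real_cyl hp.weight_pos one_pos hθ hν]
    refine Finset.prod_pos fun x _ => ?_
    have hd := density_denom_pos one_pos hθ (hp.weight_pos x)
    have hx := hp.weight_pos x
    split_ifs
    · rw [density]
      positivity
    · rw [one_sub_density hp.weight_pos one_pos hθ]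
      exact div_pos (by norm_num) hd
  intro x K C hx hy hC
  have h1 := hstat.balanced_of_pos hp hpos hbdd x K C hx hy hC
  rwa [flux_add_measure, hbal x K C hx hy hC, add_zero] at h1

/-! ### Exchange identities between arbitrary sites -/

/-- Detailed balance for exchanging the contents of the sites `x` and `y`. -/
def Exchange (π : ℤ → ℝ) (μ : Measure (ℤ → Bool)) (x y : ℤ) : Prop :=
  ∀ A C : Finset ℤ, x ∈ A → y ∈ A → x ∉ C → y ∉ C →
    π y * μ.real (cyl A (insert x C)) = π x * μ.real (cyl A (insert y C))

lemma Exchange.symm {π : ℤ → ℝ} {μ : Measure (ℤ → Bool)} {x y : ℤ} (h : Exchange π μ x y) :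
    Exchange π μ y x := fun A C hy hx hyC hxC => (h A C hx hy hxC hyC).symm

lemma Balanced.exchange_succ {p : ℤ → ℤ → ℝ} {π : ℤ → ℝ} (hp : NNRates p π)
    {μ : Measure (ℤ → Bool)} (h : Balanced p μ) (x : ℤ) : Exchange π μ x (x + 1) := by
  intro A C hx hy hxC hyC
  set K := off x A with hK
  have hA : insert x (insert (x + 1) K) = A := by
    rw [hK, off, Finset.insert_erase (Finset.mem_erase.2 ⟨by lia, hy⟩), Finset.insert_erase hx]
  have hcyl : ∀ z, (z = x ∨ z = x + 1) → cyl A (insert z C) = cyl A (insert z (C ∩ K)) := by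
    intro z hz
    refine cyl_congr fun u hu => ?_
    rw [← hA] at hu
    have h1 : u ∈ C → u ≠ x := fun h1 h2 => hxC (h2 ▸ h1)
    have h2 : u ∈ C → u ≠ x + 1 := fun h1 h2 => hyC (h2 ▸ h1)
    simp only [Finset.mem_insert, Finset.mem_inter] at hu ⊢
    tauto
  have hflux := h x K (C ∩ K) (left_notMem_off x A) (right_notMem_off x A)
    Finset.inter_subset_right
  rw [flux, hA, ← hcyl x (Or.inl rfl), ← hcyl (x + 1) (Or.inr rfl)] at hflux
  refine mul_left_cancel₀ (hp.right_pos x).ne' ?_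
  linear_combination π (x + 1) * hflux - μ.real (cyl A (insert (x + 1) C)) * hp.rev x

lemma Exchange.trans {π : ℤ → ℝ} (hπ : ∀ x, 0 < π x) {μ : Measure (ℤ → Bool)}
    [IsFiniteMeasure μ] {x y z : ℤ} (hxy : x ≠ y) (hyz : y ≠ z) (hxz : x ≠ z)
    (h₁ : Exchange π μ x y) (h₂ : Exchange π μ y z) : Exchange π μ x z := by
  have key : ∀ A C : Finset ℤ, x ∈ A → y ∈ A → z ∈ A → x ∉ C → z ∉ C →
      π z * μ.real (cyl A (insert x C)) = π x * μ.real (cyl A (insert z C)) := by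
    intro A C hx hy hz hxC hzC
    by_cases hyC : y ∈ C
    · obtain ⟨C, hy', rfl⟩ : ∃ C', y ∉ C' ∧ insert y C' = C :=
        ⟨C.erase y, Finset.notMem_erase y C, Finset.insert_erase hyC⟩
      simp only [Finset.mem_insert, not_or] at hxC hzC
      have e₂ := h₂ A (insert x C) hy hz (by simp [hxy.symm, hy']) (by simp [hxz.symm, hzC.2])
      have e₁ := h₁ A (insert z C) hx hy (by simp [hxz, hxC.2]) (by simp [hyz, hy'])
      rw [Finset.insert_comm x y, e₂, Finset.insert_comm z x, e₁, Finset.insert_comm y z]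
    · have e₁ := h₁ A C hx hy hxC hyC
      have e₂ := h₂ A C hy hz hyC hzC
      refine mul_left_cancel₀ (hπ y).ne' ?_
      linear_combination π z * e₁ + π x * e₂
  intro A C hx hz hxC hzC
  by_cases hy : y ∈ A
  · exact key A C hx hy hz hxC hzC
  have hcyl : ∀ w, cyl A (insert w C) = cyl A (insert w (C.erase y)) := fun w => by
    refine cyl_congr fun u hu => ?_
    have : u ≠ y := fun h => hy (h ▸ hu)
    simp [this]
  have hxC' : x ∉ C.erase y := fun h => hxC (Finset.mem_of_mem_erase h)
  have hzC' : z ∉ C.erase y := fun h => hzC (Finset.mem_of_mem_erase h)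
  rw [hcyl, hcyl, real_cyl_split μ hy (B := insert x (C.erase y)) (by simp [hxy.symm]),
    real_cyl_split μ hy (B := insert z (C.erase y)) (by simp [hyz]),
    Finset.insert_comm y x, Finset.insert_comm y z]
  have hA : ∀ w, w ∈ A → w ∈ insert y A := fun w h => Finset.mem_insert_of_mem h
  have e₁ := key (insert y A) (C.erase y) (hA x hx) (Finset.mem_insert_self _ _) (hA z hz)
    hxC' hzC'
  have e₂ := key (insert y A) (insert y (C.erase y)) (hA x hx) (Finset.mem_insert_self _ _)
    (hA z hz) (by simp [hxy, hxC]) (by simp [hyz.symm, hzC])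
  linear_combination e₁ + e₂

lemma Balanced.exchange {p : ℤ → ℤ → ℝ} {π : ℤ → ℝ} (hp : NNRates p π)
    {μ : Measure (ℤ → Bool)} [IsFiniteMeasure μ] (h : Balanced p μ) {x y : ℤ} (hxy : x ≠ y) :
    Exchange π μ x y := by
  have key : ∀ x y : ℤ, x + 1 ≤ y → Exchange π μ x y := by
    intro x y hxy
    induction y, hxy using Int.leInduction with
    | base => exact h.exchange_succ hp x
    | succ y hy ih =>
      exact ih.trans hp.weight_pos (by lia) (by lia) (by lia) (h.exchange_succ hp y)
  rcases lt_or_gt_of_ne hxy with h | h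
  · exact key x y h
  · exact (key y x h).symm

/-! ### Mixing along an ultrafilter forces the product form -/

/-- Asymptotic independence of far away sites along `U`, where the density is `θ`. -/
def Mixes (U : Filter ℤ) (θ : ℝ) (μ : Measure (ℤ → Bool)) : Prop :=
  ∀ A B : Finset ℤ, Tendsto (fun y => μ.real (cyl A B ∩ occ y)) U (𝓝 (θ * μ.real (cyl A B)))

lemma eventually_notMem_of_le_cofinite {U : Filter ℤ} (hU : U ≤ cofinite) (A : Finset ℤ) :
    ∀ᶠ y in U, y ∉ A := hU A.finite_toSet.compl_mem_cofinite

lemma Mixes.real_cyl_insert {π : ℤ → ℝ} (hπ : ∀ x, 0 < π x) {L θ : ℝ} (hL : 0 < L)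
    (hθ : θ ∈ Set.Icc 0 1) {U : Filter ℤ} [U.NeBot] (hU : U ≤ cofinite)
    (hUπ : Tendsto π U (𝓝 L)) {μ : Measure (ℤ → Bool)} [IsFiniteMeasure μ]
    (hex : ∀ x y : ℤ, x ≠ y → Exchange π μ x y) (hmix : Mixes U θ μ) {x : ℤ} {A B : Finset ℤ}
    (hxA : x ∉ A) (hxB : x ∉ B) :
    μ.real (cyl (insert x A) (insert x B)) = density π L θ x * μ.real (cyl A B) := by
  have h1 : Tendsto (fun y => π y * (μ.real (cyl (insert x A) (insert x B)) -
      μ.real (cyl (insert x A) (insert x B) ∩ occ y))) U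
      (𝓝 (L * (μ.real (cyl (insert x A) (insert x B)) -
        θ * μ.real (cyl (insert x A) (insert x B))))) :=
    hUπ.mul (tendsto_const_nhds.sub (hmix _ _))
  have h2 : Tendsto (fun y => π x * μ.real (cyl (insert x A) B ∩ occ y)) U
      (𝓝 (π x * (θ * μ.real (cyl (insert x A) B)))) := (hmix _ _).const_mul _
  have h3 := tendsto_nhds_unique_of_eventuallyEq h1 h2 <| by
    filter_upwards [eventually_notMem_of_le_cofinite hU (insert x (A ∪ B))] with y hy
    simp only [Finset.mem_insert, Finset.mem_union, not_or] at hy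
    have hyA : y ∉ insert x A := by simp [hy]
    have hyB : y ∉ insert x B := by simp [hy]
    rw [real_cyl_inter_add_diff μ _ y, add_sub_cancel_right, cyl_diff_occ hyB, cyl_inter_occ hyA]
    exact hex x y (Ne.symm hy.1) _ _ (by simp) (by simp) hxB hy.2.2
  have h4 := real_cyl_split μ hxA hxB
  have hd := (density_denom_pos hL hθ (hπ x)).ne'
  rw [density]
  field_simp
  linear_combination h3 - θ * π x * h4

lemma Mixes.real_cyl {π : ℤ → ℝ} (hπ : ∀ x, 0 < π x) {L θ : ℝ} (hL : 0 < L)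
    (hθ : θ ∈ Set.Icc 0 1) {U : Filter ℤ} [U.NeBot] (hU : U ≤ cofinite)
    (hUπ : Tendsto π U (𝓝 L)) {μ : Measure (ℤ → Bool)} [IsFiniteMeasure μ]
    (hex : ∀ x y : ℤ, x ≠ y → Exchange π μ x y) (hmix : Mixes U θ μ) (A B : Finset ℤ) :
    μ.real (cyl A B) =
      μ.real Set.univ * ∏ x ∈ A, if x ∈ B then density π L θ x else 1 - density π L θ x := by
  induction A using Finset.induction_on with
  | empty => simp [cyl]
  | insert x A hx ih =>
    have hB : cyl A (B.erase x) = cyl A B := cyl_congr fun u hu => by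
      have : u ≠ x := fun h => hx (h ▸ hu)
      simp [this]
    have h1 := hmix.real_cyl_insert hπ hL hθ hU hUπ hex hx (Finset.notMem_erase x B)
    rw [Finset.prod_insert hx]
    by_cases hxB : x ∈ B
    · rw [Finset.insert_erase hxB, hB] at h1
      rw [if_pos hxB, h1, ih]
      ring
    · have h2 := real_cyl_split μ hx hxB
      rw [Finset.erase_eq_of_notMem hxB] at h1
      rw [if_neg hxB]
      linear_combination ih * (1 - density π L θ x) - h1 - h2

lemma isBernoulliProduct_of_real_cyl {μ : Measure (ℤ → Bool)} [IsProbabilityMeasure μ] {α : ℤ → ℝ}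
    (hα : ∀ x, 0 ≤ α x) (hα' : ∀ x, α x ≤ 1)
    (h : ∀ A B : Finset ℤ, μ.real (cyl A B) = ∏ x ∈ A, if x ∈ B then α x else 1 - α x) :
    IsBernoulliProduct μ α := by
  refine ⟨inferInstance, fun F a => ?_⟩
  have : {η : ℤ → Bool | ∀ x ∈ F, η x = a x} = cyl F (F.filter fun x => a x = true) := by
    ext η
    exact forall₂_congr fun x hx => by simp [hx]
  rw [this, ← ofReal_measureReal, h, ENNReal.ofReal_prod_of_nonneg]
  · exact Finset.prod_congr rfl fun x hx => by simp [hx]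
  · intro x _
    have := hα' x
    split_ifs
    exacts [hα x, by linarith]

lemma bernoulli_unique {μ ν : Measure (ℤ → Bool)} {α : ℤ → ℝ} (hα : ∀ x, 0 ≤ α x)
    (hα' : ∀ x, α x ≤ 1) (hμ : IsBernoulliProduct μ α) (hν : IsBernoulliProduct ν α) : μ = ν := by
  have := hμ.1
  have := hν.1
  exact ext_of_cyl fun A B _ => by
    rw [bernoulli_real_cyl hμ hα hα', bernoulli_real_cyl hν hα hα']

/-- A balanced mixing probability measure is a product measure. -/
lemma Mixes.isBernoulliProduct {π : ℤ → ℝ} (hπ : ∀ x, 0 < π x) {L θ : ℝ} (hL : 0 < L)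
    (hθ : θ ∈ Set.Icc 0 1) {U : Filter ℤ} [U.NeBot] (hU : U ≤ cofinite)
    (hUπ : Tendsto π U (𝓝 L)) {μ : Measure (ℤ → Bool)} [IsProbabilityMeasure μ]
    (hex : ∀ x y : ℤ, x ≠ y → Exchange π μ x y) (hmix : Mixes U θ μ) :
    IsBernoulliProduct μ (density π L θ) :=
  isBernoulliProduct_of_real_cyl (density_nonneg hπ hL hθ) (density_le_one hπ hL hθ) fun A B => by
    rw [hmix.real_cyl hπ hL hθ hU hUπ hex, probReal_univ, one_mul]

/-! ### Limits of restrictions of a measure -/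

lemma exists_tendsto_restrict {ι Ω : Type*} [MeasurableSpace Ω] (μ : Measure Ω) [IsFiniteMeasure μ]
    (U : Ultrafilter ι) (E : ι → Set Ω) :
    ∃ ν : Measure Ω, ∀ A, MeasurableSet A →
      Tendsto (fun i => μ.restrict (E i) A) U (𝓝 (ν A)) := by
  let l : Set Ω → ENNReal := fun A => (U.map fun i => μ.restrict (E i) A).lim
  have hl : ∀ A, Tendsto (fun i => μ.restrict (E i) A) U (𝓝 (l A)) := fun A =>
    (U.map fun i => μ.restrict (E i) A).le_nhds_lim
  refine ⟨Measure.ofMeasurable (fun A _ => l A) ?_ ?_, fun A hA => ?_⟩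
  · exact tendsto_nhds_unique (hl ∅) (by simp)
  · intro A hA hdisj
    have hfin : ∀ N : ℕ, Tendsto (fun i => ∑ n ∈ Finset.range N, μ.restrict (E i) (A n)) U
        (𝓝 (∑ n ∈ Finset.range N, l (A n))) := fun N => tendsto_finsetSum _ fun n _ => hl (A n)
    have hmeas : ∀ i, μ.restrict (E i) (⋃ n, A n) = ∑' n, μ.restrict (E i) (A n) := fun i =>
      measure_iUnion hdisj hA
    refine le_antisymm ?_ ?_
    · have h1 : ∀ N : ℕ, l (⋃ n, A n) ≤ ∑' n, l (A n) + ∑' n, μ (A (n + N)) := fun N => by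
        refine le_trans ?_ (add_le_add_left (ENNReal.sum_le_tsum (Finset.range N)) _)
        refine le_of_tendsto_of_tendsto' (hl _) ((hfin N).add_const _) fun i => ?_
        rw [hmeas, ← ENNReal.summable.sum_add_tsum_nat_add' (k := N)]
        gcongr
        exact Measure.restrict_le_self
      have h2 : Tendsto (fun N => ∑' n, μ (A (n + N))) atTop (𝓝 0) := by
        refine ENNReal.tendsto_sum_nat_add (fun n => μ (A n)) ?_
        rw [← measure_iUnion hdisj hA]
        exact measure_ne_top _ _
      refine ge_of_tendsto' (x := atTop) (f := fun N : ℕ => _) ?_ h1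
      simpa using h2.const_add (∑' n, l (A n))
    · refine ENNReal.tsum_le_of_sum_range_le fun N => ?_
      refine le_of_tendsto_of_tendsto' (hfin N) (hl _) fun i => ?_
      rw [hmeas]
      exact ENNReal.sum_le_tsum _
  · rw [Measure.ofMeasurable_apply A hA]
    exact hl A

/-! ### Extremal invariant measures mix -/

lemma Stationary.exclInvariant_smul {p : ℤ → ℤ → ℝ} {μ : Measure (ℤ → Bool)}
    (h : Stationary p μ) {r : ℝ} (hr : 0 < r) (hμ : μ Set.univ = ENNReal.ofReal r) :
    ExclInvariant p ((ENNReal.ofReal r)⁻¹ • μ) := by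
  refine ⟨⟨?_⟩, fun f hf => by rw [integral_smul_measure, h f hf, smul_zero]⟩
  rw [Measure.smul_apply, hμ, smul_eq_mul,
    ENNReal.inv_mul_cancel (by simpa using hr) ENNReal.ofReal_ne_top]

/-- Splitting an extremal invariant measure into two balanced parts only rescales it. -/
lemma eq_smul_of_extremal {p : ℤ → ℤ → ℝ} (hnn : ∀ x y : ℤ, |x - y| ≠ 1 → p x y = 0)
    {μ ν₁ ν₂ : Measure (ℤ → Bool)} [IsFiniteMeasure ν₁] [IsFiniteMeasure ν₂]
    (hμ : IsExtremalInvariant p μ) (hsum : ν₁ + ν₂ = μ) (h₁ : Balanced p ν₁)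
    (h₂ : Balanced p ν₂) : ν₁ = ENNReal.ofReal (ν₁.real Set.univ) • μ := by
  have := hμ.1.1
  have hone : ν₁.real Set.univ + ν₂.real Set.univ = 1 := by
    rw [← measureReal_add_apply, hsum, probReal_univ]
  rcases (measureReal_nonneg (μ := ν₁) (s := Set.univ)).eq_or_lt with h0 | h0
  · rw [← h0]
    have : ν₁ = 0 := by
      rw [← Measure.measure_univ_eq_zero]
      exact (measureReal_eq_zero_iff).1 h0.symm
    simpa using this
  rcases (measureReal_nonneg (μ := ν₂) (s := Set.univ)).eq_or_lt with h0' | h0'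
  · have : ν₂ = 0 := by
      rw [← Measure.measure_univ_eq_zero]
      exact (measureReal_eq_zero_iff).1 h0'.symm
    rw [← h0', add_zero] at hone
    rw [hone, ← hsum, this]
    simp
  set r := ν₁.real Set.univ with hr
  have h2 : ν₂.real Set.univ = 1 - r := by linarith
  rw [h2] at h0'
  have hm₁ : ν₁ Set.univ = ENNReal.ofReal r := (ofReal_measureReal).symm
  have hm₂ : ν₂ Set.univ = ENNReal.ofReal (1 - r) := by rw [← h2, ofReal_measureReal]
  have hc : ∀ s : ℝ, 0 < s → ∀ ν : Measure (ℤ → Bool),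
      ENNReal.ofReal s • (ENNReal.ofReal s)⁻¹ • ν = ν := fun s hs ν => by
    rw [smul_smul, ENNReal.mul_inv_cancel (by simpa using hs) ENNReal.ofReal_ne_top, one_smul]
  have := (hμ.2 r _ _ h0 (by linarith) ((h₁.stationary hnn).exclInvariant_smul h0 hm₁)
    ((h₂.stationary hnn).exclInvariant_smul h0' hm₂) (by rw [hc r h0, hc _ h0', hsum])).1
  rw [← this, hc r h0]

lemma flux_inter_occ (p : ℤ → ℤ → ℝ) (μ : Measure (ℤ → Bool)) {x y : ℤ} {K C : Finset ℤ}
    (hyx : y ≠ x) (hyx' : y ≠ x + 1) (hyK : y ∉ K) :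
    p x (x + 1) * μ.real (cyl (insert x (insert (x + 1) K)) (insert x C) ∩ occ y) -
      p (x + 1) x * μ.real (cyl (insert x (insert (x + 1) K)) (insert (x + 1) C) ∩ occ y) =
    flux p μ x (insert y K) (insert y C) := by
  have hA : y ∉ insert x (insert (x + 1) K) := by simp [hyx, hyx', hyK]
  rw [cyl_inter_occ hA, cyl_inter_occ hA, flux, Finset.insert_comm y x (insert _ K),
    Finset.insert_comm y (x + 1) K, Finset.insert_comm y x C, Finset.insert_comm y (x + 1) C]

lemma exists_mixes_of_extremal {p : ℤ → ℤ → ℝ} (hnn : ∀ x y : ℤ, |x - y| ≠ 1 → p x y = 0)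
    {μ : Measure (ℤ → Bool)} (hμ : IsExtremalInvariant p μ) (hbal : Balanced p μ)
    (U : Ultrafilter ℤ) (hU : (U : Filter ℤ) ≤ cofinite) :
    ∃ θ ∈ Set.Icc (0 : ℝ) 1, Mixes U θ μ := by
  have := hμ.1.1
  obtain ⟨ν, hν⟩ := exists_tendsto_restrict μ U occ
  have hle : ν ≤ μ := Measure.le_iff.2 fun A hA =>
    le_of_tendsto' (hν A hA) fun y => Measure.restrict_le_self A
  have hfin : IsFiniteMeasure ν := isFiniteMeasure_of_le μ hle
  have hlim : ∀ A B : Finset ℤ, Tendsto (fun y => μ.real (cyl A B ∩ occ y)) U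
      (𝓝 (ν.real (cyl A B))) := fun A B => by
    refine ((ENNReal.tendsto_toReal (measure_ne_top ν _)).comp
      (hν _ (measurableSet_cyl A B))).congr fun y => ?_
    rw [Function.comp_apply, Measure.restrict_apply (measurableSet_cyl A B), measureReal_def]
  have hbal₁ : Balanced p ν := by
    intro x K C hx hy hC
    refine tendsto_nhds_unique_of_eventuallyEq
      (((hlim _ _).const_mul _).sub ((hlim _ _).const_mul _)) tendsto_const_nhds ?_
    filter_upwards [eventually_notMem_of_le_cofinite hU (insert x (insert (x + 1) K))] with y hyA
    simp only [Finset.mem_insert, not_or] at hyA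
    rw [flux_inter_occ p μ hyA.1 hyA.2.1 hyA.2.2]
    exact hbal x _ _ (by simp [hx, Ne.symm hyA.1]) (by simp [hy, Ne.symm hyA.2.1])
      (Finset.insert_subset_insert _ hC)
  have hsum : μ - ν + ν = μ := Measure.sub_add_cancel_of_le hle
  have hbal₂ : Balanced p (μ - ν) := by
    intro x K C hx hy hC
    have h := flux_add_measure p (μ - ν) ν x K C
    rwa [hsum, hbal x K C hx hy hC, hbal₁ x K C hx hy hC, add_zero, eq_comm] at h
  have heq := eq_smul_of_extremal hnn hμ ((add_comm _ _).trans hsum) hbal₁ hbal₂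
  refine ⟨ν.real Set.univ, ⟨measureReal_nonneg, ?_⟩, fun A B => ?_⟩
  · rw [← probReal_univ (μ := μ)]
    exact ENNReal.toReal_mono (measure_ne_top _ _) (hle _)
  · convert hlim A B using 2
    conv_rhs => rw [heq]
    rw [measureReal_ennreal_smul_apply, ENNReal.toReal_ofReal measureReal_nonneg]

/-! ### Measures dominated by a product measure mix -/

/-- The centred occupation variable of the site `x`. -/
noncomputable def centred (α : ℤ → ℝ) (x : ℤ) (η : ℤ → Bool) : ℝ := (if η x then 1 else 0) - α x

lemma dependsOn_centred (α : ℤ → ℝ) (x : ℤ) : DependsOn (centred α x) ({x} : Set ℤ) :=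
  fun η ξ h => by simp [centred, h x rfl]

lemma integral_centred_mul {ν : Measure (ℤ → Bool)} {α : ℤ → ℝ} (hα : ∀ x, 0 ≤ α x)
    (hα' : ∀ x, α x ≤ 1) (h : IsBernoulliProduct ν α) (x y : ℤ) :
    ∫ η, centred α x η * centred α y η ∂ν = if x = y then α x * (1 - α x) else 0 := by
  have := h.1
  have hdep : DependsOn (fun η => centred α x η * centred α y η)
      ((insert x {y} : Finset ℤ) : Set ℤ) := fun η ξ hηξ => by
    simp [centred, hηξ x (by simp), hηξ y (by simp)]
  rw [integral_eq_sum_cyl ν hdep]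
  split_ifs with hxy
  · subst hxy
    have e : (insert x {x} : Finset ℤ) = insert x ∅ := by simp
    rw [e, Finset.sum_powerset_insert (by simp)]
    simp [bernoulli_real_cyl h hα hα', centred, cfg]
    ring
  · rw [Finset.sum_powerset_insert (by simpa using hxy), ← insert_empty_eq y,
      Finset.sum_powerset_insert (by simp), Finset.sum_powerset_insert (by simp)]
    simp [bernoulli_real_cyl h hα hα', Finset.prod_insert (by simpa using hxy : x ∉ ({y} : Finset ℤ)),
      centred, cfg, hxy, Ne.symm hxy]
    ring

lemma integral_sq_sum_centred_le {ν : Measure (ℤ → Bool)} {α : ℤ → ℝ} (hα : ∀ x, 0 ≤ α x)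
    (hα' : ∀ x, α x ≤ 1) (h : IsBernoulliProduct ν α) (s : Finset ℤ) (d : ℤ → ℝ) :
    ∫ η, (∑ x ∈ s, d x * centred α x η) ^ 2 ∂ν ≤ ∑ x ∈ s, d x ^ 2 := by
  have := h.1
  have hint : ∀ x y, Integrable (fun η => d x * d y * (centred α x η * centred α y η)) ν :=
    fun x y => (integrable_of_dependsOn ν (A := {x, y}) fun η ξ hηξ => by
      simp [centred, hηξ x (by simp), hηξ y (by simp)]).const_mul _
  have e : ∀ η, (∑ x ∈ s, d x * centred α x η) ^ 2 =
      ∑ x ∈ s, ∑ y ∈ s, d x * d y * (centred α x η * centred α y η) := fun η => by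
    rw [sq, Finset.sum_mul_sum]
    exact Finset.sum_congr rfl fun x _ => Finset.sum_congr rfl fun y _ => by ring
  simp_rw [e]
  rw [integral_finsetSum _ fun x _ => integrable_finsetSum _ fun y _ => hint x y]
  refine Finset.sum_le_sum fun x hx => ?_
  rw [integral_finsetSum _ fun y _ => hint x y]
  simp_rw [integral_const_mul, integral_centred_mul hα hα' h]
  simp only [mul_ite, mul_zero, Finset.sum_ite_eq, hx, if_true]
  rw [← sq]
  refine mul_le_of_le_one_right (sq_nonneg _) ?_
  nlinarith [hα x, hα' x]

lemma sum_sq_le_of_le_smul {ν ν' : Measure (ℤ → Bool)} [IsFiniteMeasure ν'] {α : ℤ → ℝ}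
    (hα : ∀ x, 0 ≤ α x) (hα' : ∀ x, α x ≤ 1) (h : IsBernoulliProduct ν α) {r : ℝ} (hr : 0 < r)
    (hle : ν' ≤ ENNReal.ofReal r • ν) (E : Set (ℤ → Bool)) (s : Finset ℤ) :
    ∑ x ∈ s, (ν'.real (E ∩ occ x) - α x * ν'.real E) ^ 2 ≤ r * ν'.real Set.univ := by
  have := h.1
  set d : ℤ → ℝ := fun x => ν'.real (E ∩ occ x) - α x * ν'.real E with hd
  set S : (ℤ → Bool) → ℝ := fun η => ∑ x ∈ s, d x * centred α x η with hS
  have hSdep : DependsOn S (s : Set ℤ) := fun η ξ hηξ =>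
    Finset.sum_congr rfl fun x hx => by simp [centred, hηξ x hx]
  have hcint : ∀ x, Integrable (centred α x) ν' := fun x =>
    integrable_of_dependsOn ν' (A := {x}) (by simpa using dependsOn_centred α x)
  have hSint : Integrable S ν' := integrable_of_dependsOn ν' hSdep
  have hS2dep : DependsOn (fun η => S η ^ 2) (s : Set ℤ) := fun η ξ hηξ => by
    simp only [hSdep hηξ]
  have hS2int := integrable_of_dependsOn ν' hS2dep
  have hS2int' := integrable_of_dependsOn ν hS2dep
  have hcE : ∀ x, ∫ η in E, centred α x η ∂ν' = d x := fun x => by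
    have e : centred α x = fun η => (occ x).indicator (fun _ => (1 : ℝ)) η - α x := by
      funext η
      simp [centred, occ, Set.indicator_apply]
    rw [e, integral_sub ((integrable_const _).indicator (measurableSet_occ x))
      (integrable_const _), integral_indicator_const _ (measurableSet_occ x), integral_const,
      measureReal_restrict_apply (measurableSet_occ x), measureReal_restrict_apply_univ,
      Set.inter_comm]
    simp [hd, mul_comm]
  have hQ : ∫ η in E, S η ∂ν' = ∑ x ∈ s, d x ^ 2 := by
    rw [hS, integral_finsetSum _ fun x _ => ((hcint x).integrableOn.const_mul _)]
    exact Finset.sum_congr rfl fun x _ => by rw [integral_const_mul, hcE, sq]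
  have h1 : 2 * r * ∫ η in E, S η ∂ν' ≤ ∫ η, (r ^ 2 + S η ^ 2) ∂ν' := by
    rw [← integral_const_mul]
    refine (integral_mono (hSint.integrableOn.const_mul _)
      ((integrable_const _).add hS2int).integrableOn fun η => ?_).trans
      (setIntegral_le_integral ((integrable_const _).add hS2int)
        (Eventually.of_forall fun η => ?_))
    · simp only [Pi.add_apply]
      nlinarith [sq_nonneg (r - S η)]
    · simp only [Pi.add_apply, Pi.zero_apply]
      positivity
  have h2 : ∫ η, S η ^ 2 ∂ν' ≤ r * ∑ x ∈ s, d x ^ 2 := by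
    refine (integral_mono_measure hle (Eventually.of_forall fun η => sq_nonneg _)
      (hS2int'.smul_measure ENNReal.ofReal_ne_top)).trans ?_
    rw [integral_smul_measure, ENNReal.toReal_ofReal hr.le, smul_eq_mul]
    exact mul_le_mul_of_nonneg_left (integral_sq_sum_centred_le hα hα' h s d) hr.le
  rw [integral_add (integrable_const _) hS2int, integral_const, hQ, smul_eq_mul] at h1
  refine le_of_mul_le_mul_left ?_ hr
  linarith

lemma mixes_of_le_smul {π : ℤ → ℝ} (hπ : ∀ x, 0 < π x) {L θ : ℝ} (hL : 0 < L)
    (hθ : θ ∈ Set.Icc 0 1) {U : Filter ℤ} (hU : U ≤ cofinite)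
    (hUπ : Tendsto π U (𝓝 L)) {ν ν' : Measure (ℤ → Bool)} [IsFiniteMeasure ν']
    (h : IsBernoulliProduct ν (density π L θ)) {r : ℝ} (hr : 0 < r)
    (hle : ν' ≤ ENNReal.ofReal r • ν) : Mixes U θ ν' := by
  intro A B
  have hsum : Summable fun x =>
      (ν'.real (cyl A B ∩ occ x) - density π L θ x * ν'.real (cyl A B)) ^ 2 :=
    summable_of_sum_le (fun x => sq_nonneg _) fun s => sum_sq_le_of_le_smul
      (density_nonneg hπ hL hθ) (density_le_one hπ hL hθ) h hr hle (cyl A B) s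
  have h0 : Tendsto (fun x => ν'.real (cyl A B ∩ occ x) -
      density π L θ x * ν'.real (cyl A B)) U (𝓝 0) := by
    have := (Real.continuous_sqrt.tendsto 0).comp (hsum.tendsto_cofinite_zero.mono_left hU)
    rw [Real.sqrt_zero] at this
    refine tendsto_zero_iff_abs_tendsto_zero _ |>.2 (this.congr fun x => ?_)
    exact Real.sqrt_sq_eq_abs _
  have hdens : Tendsto (density π L θ) U (𝓝 θ) := by
    have h1 : Tendsto (fun x => θ * π x / (L * (1 - θ) + θ * π x)) U
        (𝓝 (θ * L / (L * (1 - θ) + θ * L))) :=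
      (hUπ.const_mul θ).div ((hUπ.const_mul θ).const_add _) (density_denom_pos hL hθ hL).ne'
    rwa [show θ * L / (L * (1 - θ) + θ * L) = θ by
      rw [show L * (1 - θ) + θ * L = L by ring, mul_div_cancel_right₀ _ hL.ne']] at h1
  simpa using h0.add (hdens.mul_const (ν'.real (cyl A B)))

/-! ### Classification -/

lemma isExtremalInvariant_iff {p : ℤ → ℤ → ℝ} {π : ℤ → ℝ} (hp : NNRates p π) {L : ℝ} (hL : 0 < L)
    (hbdd : ∃ R : ℝ, ∀ N : ℤ, ∃ m ≤ N, |Real.log (π m)| ≤ R)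
    {U : Ultrafilter ℤ} (hU : (U : Filter ℤ) ≤ cofinite) (hUπ : Tendsto π U (𝓝 L))
    (μ : Measure (ℤ → Bool)) :
    IsExtremalInvariant p μ ↔ ∃ θ ∈ Set.Icc (0 : ℝ) 1, IsBernoulliProduct μ (density π L θ) := by
  constructor
  · intro hμ
    have := hμ.1.1
    have hbal := Stationary.balanced hp hbdd hμ.1.2
    obtain ⟨θ, hθ, hmix⟩ := exists_mixes_of_extremal hp.nn hμ hbal U hU
    exact ⟨θ, hθ, hmix.isBernoulliProduct hp.weight_pos hL hθ hU hUπ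
      fun x y hxy => hbal.exchange hp hxy⟩
  · rintro ⟨θ, hθ, hμ⟩
    have := hμ.1
    refine ⟨⟨hμ.1, (bernoulli_density_balanced hp.weight_pos hL hθ hp hμ).stationary hp.nn⟩, ?_⟩
    have key : ∀ (t : ℝ) (ν : Measure (ℤ → Bool)), 0 < t → ExclInvariant p ν →
        ENNReal.ofReal t • ν ≤ μ → ν = μ := by
      intro t ν ht hν hle
      have := hν.1
      have hle' : ν ≤ ENNReal.ofReal t⁻¹ • μ := by
        have hne : ENNReal.ofReal t ≠ 0 := by simpa using ht
        have h1 : ν = (ENNReal.ofReal t)⁻¹ • ENNReal.ofReal t • ν := by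
          rw [smul_smul, ENNReal.inv_mul_cancel hne ENNReal.ofReal_ne_top, one_smul]
        rw [ENNReal.ofReal_inv_of_pos ht, h1]
        gcongr
      have hmix := mixes_of_le_smul hp.weight_pos hL hθ hU hUπ hμ (inv_pos.2 ht) hle'
      exact bernoulli_unique (density_nonneg hp.weight_pos hL hθ)
        (density_le_one hp.weight_pos hL hθ)
        (hmix.isBernoulliProduct hp.weight_pos hL hθ hU hUπ
          fun x y hxy => (Stationary.balanced hp hbdd hν.2).exchange hp hxy) hμ
    intro t ν₁ ν₂ ht ht' h₁ h₂ heq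
    exact ⟨key t ν₁ ht h₁ (heq ▸ Measure.le_add_right le_rfl),
      key (1 - t) ν₂ (by linarith) h₂ (heq ▸ Measure.le_add_left le_rfl)⟩

lemma isBernoulliProduct_dirac (b : Bool) :
    IsBernoulliProduct (Measure.dirac fun _ : ℤ => b) fun _ => if b then 1 else 0 := by
  refine isBernoulliProduct_of_real_cyl (fun x => ?_) (fun x => ?_) fun A B => ?_
  · split_ifs <;> norm_num
  · split_ifs <;> norm_num
  · rw [measureReal_def, Measure.dirac_apply' _ (measurableSet_cyl A B)]
    by_cases h : (fun _ : ℤ => b) ∈ cyl A B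
    · rw [Set.indicator_of_mem h, Pi.one_apply, ENNReal.toReal_one, Finset.prod_eq_one]
      intro x hx
      have := h x hx
      cases b <;> simp_all
    · rw [Set.indicator_of_notMem h, ENNReal.toReal_zero, eq_comm, Finset.prod_eq_zero_iff]
      obtain ⟨x, hx, hxb⟩ : ∃ x ∈ A, b ≠ decide (x ∈ B) := by
        by_contra! h'
        exact h h'
      refine ⟨x, hx, ?_⟩
      cases b <;> simp_all

lemma density_zero (π : ℤ → ℝ) (L : ℝ) : density π L 0 = fun _ => 0 := by
  funext x
  simp [density]

lemma density_one {π : ℤ → ℝ} (hπ : ∀ x, 0 < π x) (L : ℝ) : density π L 1 = fun _ => 1 := by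
  funext x
  simp [density, (hπ x).ne']

lemma density_mul_div {π : ℤ → ℝ} {L c : ℝ} (hL : 0 < L) (hc : 0 < c) :
    density π L (c * L / (1 + c * L)) = fun x => c * π x / (1 + c * π x) := by
  funext x
  have h1 : 1 + c * L ≠ 0 := by positivity
  have h2 : L * (1 - c * L / (1 + c * L)) + c * L / (1 + c * L) * π x =
      L / (1 + c * L) * (1 + c * π x) := by
    field_simp
    ring
  rw [density, h2, show c * L / (1 + c * L) * π x = L / (1 + c * L) * (c * π x) by ring,
    mul_div_mul_left _ _ (by positivity)]

/-- The product measures, parametrised by their density at weight `L` or by their fugacity. -/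
lemma exists_density_iff {π : ℤ → ℝ} (hπ : ∀ x, 0 < π x) {L : ℝ} (hL : 0 < L)
    (μ : Measure (ℤ → Bool)) :
    (∃ θ ∈ Set.Icc (0 : ℝ) 1, IsBernoulliProduct μ (density π L θ)) ↔
      (μ = Measure.dirac (fun _ : ℤ => false) ∨ μ = Measure.dirac (fun _ : ℤ => true) ∨
        ∃ c : ℝ, 0 < c ∧ IsBernoulliProduct μ (fun x => c * π x / (1 + c * π x))) := by
  constructor
  · rintro ⟨θ, hθ, h⟩
    rcases hθ.1.eq_or_lt with rfl | h0
    · rw [density_zero] at h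
      exact Or.inl (bernoulli_unique (by simp) (by simp) h
        (by simpa using isBernoulliProduct_dirac false))
    rcases hθ.2.eq_or_lt with rfl | h1
    · rw [density_one hπ] at h
      exact Or.inr (Or.inl (bernoulli_unique (by simp) (by simp) h
        (by simpa using isBernoulliProduct_dirac true)))
    have h1' : 0 < 1 - θ := sub_pos.2 h1
    refine Or.inr (Or.inr ⟨θ / (L * (1 - θ)), by positivity, ?_⟩)
    rw [← density_mul_div hL (by positivity)]
    convert h using 2
    field_simp
    ring
  · rintro (rfl | rfl | ⟨c, hc, h⟩)
    · refine ⟨0, by simp, ?_⟩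
      rw [density_zero]
      simpa using isBernoulliProduct_dirac false
    · refine ⟨1, by simp, ?_⟩
      rw [density_one hπ]
      simpa using isBernoulliProduct_dirac true
    · have := mul_pos hc hL
      refine ⟨c * L / (1 + c * L), ⟨by positivity, ?_⟩, by rwa [density_mul_div hL hc]⟩
      exact (div_le_one (by positivity)).2 (by linarith)

/-! ### Limit points of the reversible weight -/

lemma exists_ultrafilter_tendsto {π : ℤ → ℝ} {L : ℝ}
    (h : ∀ ε : ℝ, 0 < ε → {x : ℤ | x < 0 ∧ |π x - L| < ε}.Infinite) :
    ∃ U : Ultrafilter ℤ, (U : Filter ℤ) ≤ cofinite ∧ Tendsto π U (𝓝 L) := by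
  have hne : (comap π (𝓝 L) ⊓ cofinite).NeBot := by
    rw [(Metric.nhds_basis_ball.comap π).inf_neBot_iff]
    intro ε hε s hs
    have hinf := (h ε hε).sdiff (mem_cofinite.1 hs)
    obtain ⟨x, ⟨-, hx⟩, hxs⟩ := hinf.nonempty
    exact ⟨x, by simpa [Real.dist_eq] using hx, by simpa using hxs⟩
  refine ⟨Ultrafilter.of (comap π (𝓝 L) ⊓ cofinite), (Ultrafilter.of_le _).trans inf_le_right, ?_⟩
  exact tendsto_iff_comap.2 ((Ultrafilter.of_le _).trans inf_le_left)

lemma exists_log_bound {π : ℤ → ℝ} {L : ℝ} (hL : 0 < L)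
    (h : ∀ ε : ℝ, 0 < ε → {x : ℤ | x < 0 ∧ |π x - L| < ε}.Infinite) :
    ∃ R : ℝ, ∀ N : ℤ, ∃ m ≤ N, |Real.log (π m)| ≤ R := by
  refine ⟨max |Real.log (L / 2)| |Real.log (2 * L)|, fun N => ?_⟩
  obtain ⟨m, ⟨⟨hm0, hm⟩, hmN⟩⟩ :=
    ((h (L / 2) (half_pos hL)).sdiff (Set.finite_Icc N 0)).nonempty
  rw [abs_lt] at hm
  have hmN' : m ≤ N := by
    simp only [Set.mem_Icc] at hmN
    lia
  exact ⟨m, hmN', abs_le_max_abs_abs (Real.log_le_log (half_pos hL) (by linarith))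
    (Real.log_le_log (by linarith) (by linarith))⟩

lemma nnRates_of_isTransition {p : ℤ → ℤ → ℝ} {π : ℤ → ℝ} (hp : IsTransition p)
    (hnn : ∀ x y : ℤ, |x - y| ≠ 1 → p x y = 0)
    (hinf : ∃ δ : ℝ, 0 < δ ∧ ∀ x y : ℤ, |x - y| = 1 → δ ≤ p x y)
    (hrev : IsReversible p π) : NNRates p π := by
  obtain ⟨δ, hδ, hinf⟩ := hinf
  have hle : ∀ x y, p x y ≤ 1 := fun x y => le_hasSum (hp.2.1 x) y fun z _ => hp.1 x z
  exact
    { nn := hnn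
      right_pos := fun x => hδ.trans_le (hinf _ _ (by simp))
      left_pos := fun x => hδ.trans_le (hinf _ _ (by simp))
      right_le_one := fun x => hle _ _
      left_le_one := fun x => hle _ _
      weight_pos := hrev.1
      rev := fun x => hrev.2 _ _ }

end Exclusion

/-- For a nearest-neighbor kernel on `ℤ` with rates bounded below, if
`π(x) → ∞` as `x → +∞` and `π` has a finite nonzero limit point along `x → -∞`, then the
extremal invariant measures are exactly `{ν^c : 0 ≤ c ≤ ∞}`. -/
theorem extremal_set_eq_reversible_of_tendsto_top
    (p : ℤ → ℤ → ℝ) (π : ℤ → ℝ) (hp : IsTransition p)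
    (hnn : ∀ x y : ℤ, |x - y| ≠ 1 → p x y = 0)
    (hinf : ∃ δ : ℝ, 0 < δ ∧ ∀ x y : ℤ, |x - y| = 1 → δ ≤ p x y)
    (hrev : IsReversible p π)
    (hplus : Tendsto π atTop atTop)
    (hminus : ∃ L : ℝ, 0 < L ∧ ∀ ε : ℝ, 0 < ε → {x : ℤ | x < 0 ∧ |π x - L| < ε}.Infinite) :
    ∀ μ : Measure (ℤ → Bool), IsExtremalInvariant p μ ↔
      (μ = Measure.dirac (fun _ : ℤ => false) ∨ μ = Measure.dirac (fun _ : ℤ => true) ∨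
        ∃ c : ℝ, 0 < c ∧ IsBernoulliProduct μ (fun x => c * π x / (1 + c * π x))) := by
  intro μ
  obtain ⟨L, hL, hlim⟩ := hminus
  obtain ⟨U, hU, hUπ⟩ := Exclusion.exists_ultrafilter_tendsto hlim
  have hrates := Exclusion.nnRates_of_isTransition hp hnn hinf hrev
  exact (Exclusion.isExtremalInvariant_iff hrates hL
    (Exclusion.exists_log_bound hL hlim) hU hUπ μ).trans
    (Exclusion.exists_density_iff hrev.1 hL μ)
end

section
/- Let p be a nearest-neighbor transition probability function on ℤ (p(x,y) = 0 whenever |x−y| ≠ 1) with inf_{|x−y|=1} p(x,y) > 0, and let π be a reversible measure for p. Let L⁻ and L⁺ be the sets of limit points, in the extended interval [0,∞], of {π(x) : x < 0} and {π(x) : x > 0} respectively. If it is not the case that either (L⁻ = {0} and L⁺ = {∞}) or (L⁻ = {∞} and L⁺ = {0}), then every invariant probability measure μ is reversible, i.e. ∫ f · Ωg dμ = ∫ g · Ωf dμ for all cylinder functions f and g. -/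
open MeasureTheory Filter Topology

/-- The set of limit points, in `[0,∞]`, of `{π(x) : x > 0}` (as `x → +∞`). -/
def limPtsAtTop (π : ℤ → ℝ) : Set ENNReal :=
  {l | MapClusterPt l atTop (fun x : ℤ => ENNReal.ofReal (π x))}

/-- The set of limit points, in `[0,∞]`, of `{π(x) : x < 0}` (as `x → -∞`). -/
def limPtsAtBot (π : ℤ → ℝ) : Set ENNReal :=
  {l | MapClusterPt l atBot (fun x : ℤ => ENNReal.ofReal (π x))}

lemma two_mul_sq_sqrt_sub_le_mul_log {a b : ℝ} (ha : 0 < a) (hb : 0 < b) :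
    2 * (√a - √b) ^ 2 ≤ (a - b) * (Real.log a - Real.log b) := by
  wlog hab : b ≤ a generalizing a b
  · have := this hb ha (le_of_not_ge hab)
    nlinarith
  obtain ⟨s, hs, rfl⟩ : ∃ s : ℝ, 0 < s ∧ s ^ 2 = a := ⟨√a, by positivity, Real.sq_sqrt ha.le⟩
  obtain ⟨t, ht, rfl⟩ : ∃ t : ℝ, 0 < t ∧ t ^ 2 = b := ⟨√b, by positivity, Real.sq_sqrt hb.le⟩
  have hts : t ≤ s := by nlinarith
  rw [Real.sqrt_sq hs.le, Real.sqrt_sq ht.le, Real.log_pow, Real.log_pow]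
  have hlog : (s - t) / s ≤ Real.log s - Real.log t := by
    have := Real.one_sub_inv_le_log_of_pos (div_pos hs ht)
    rw [Real.log_div hs.ne' ht.ne', inv_div] at this
    rwa [sub_div, div_self hs.ne']
  have h2 : s - t ≤ s * (Real.log s - Real.log t) := by
    rwa [div_le_iff₀' hs] at hlog
  have h3 : 0 ≤ Real.log s - Real.log t := (div_nonneg (by linarith) hs.le).trans hlog
  push_cast
  nlinarith [mul_le_mul_of_nonneg_left h2 (sub_nonneg.2 hts),
    mul_nonneg (mul_nonneg (sub_nonneg.2 hts) ht.le) h3]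

lemma mul_log_sub_le_of_le {a b P Q : ℝ} (ha : 0 < a) (hb : 0 < b) (hP : b ≤ P) (hQ : a ≤ Q) :
    (a - b) * (Real.log P - Real.log Q) ≤ 4 * (|√a - √b| * (√P + √Q)) := by
  wlog hab : b ≤ a generalizing a b P Q
  · have := this hb ha hQ hP (le_of_not_ge hab)
    rw [abs_sub_comm, add_comm (√P)]
    linarith
  have hP0 : 0 < P := hb.trans_le hP
  have hQ0 : 0 < Q := ha.trans_le hQ
  have hs : √b ≤ √a := Real.sqrt_le_sqrt hab
  have hsa : 0 < √a := Real.sqrt_pos.2 ha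
  have hsP : 0 < √P := Real.sqrt_pos.2 hP0
  have hsQ : √a ≤ √Q := Real.sqrt_le_sqrt hQ
  have hlog : √a * (Real.log P - Real.log Q) ≤ 2 * √P := by
    have h1 : Real.log P - Real.log Q = 2 * Real.log (√P / √Q) := by
      rw [Real.log_div hsP.ne' (hsa.trans_le hsQ).ne', Real.log_sqrt hP0.le, Real.log_sqrt hQ0.le]
      ring
    have h2 : Real.log (√P / √Q) ≤ √P / √a :=
      (Real.log_le_self (by positivity)).trans (by gcongr)
    rw [le_div_iff₀ hsa] at h2
    rw [h1]
    linarith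
  have hfac : a - b = (√a - √b) * (√a + √b) := by
    linear_combination -Real.sq_sqrt ha.le + Real.sq_sqrt hb.le
  rw [abs_of_nonneg (sub_nonneg.2 hs)]
  by_cases h0 : 0 ≤ Real.log P - Real.log Q
  · have h3 : a - b ≤ 2 * √a * (√a - √b) := by
      rw [hfac]; nlinarith [sub_nonneg.2 hs]
    calc (a - b) * (Real.log P - Real.log Q)
        ≤ 2 * √a * (√a - √b) * (Real.log P - Real.log Q) := by gcongr
      _ = 2 * (√a - √b) * (√a * (Real.log P - Real.log Q)) := by ring
      _ ≤ 2 * (√a - √b) * (2 * √P) := by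
        gcongr
      _ ≤ _ := by nlinarith [mul_nonneg (sub_nonneg.2 hs) (Real.sqrt_nonneg Q)]
  · have : 0 ≤ (√a - √b) * (√P + √Q) := mul_nonneg (sub_nonneg.2 hs) (by positivity)
    nlinarith [sub_nonneg.2 hab]

lemma sq_sqrt_add_sub_sqrt_add_le {a a' b b' : ℝ} (ha : 0 ≤ a) (ha' : 0 ≤ a') (hb : 0 ≤ b)
    (hb' : 0 ≤ b') :
    (√(a + a') - √(b + b')) ^ 2 ≤ (√a - √b) ^ 2 + (√a' - √b') ^ 2 := by
  have key : √a * √b + √a' * √b' ≤ √(a + a') * √(b + b') := by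
    rw [← Real.sqrt_mul (add_nonneg ha ha')]
    apply Real.le_sqrt_of_sq_le
    have h1 := Real.sq_sqrt ha
    have h2 := Real.sq_sqrt ha'
    have h3 := Real.sq_sqrt hb
    have h4 := Real.sq_sqrt hb'
    calc _ ≤ (√a ^ 2 + √a' ^ 2) * (√b ^ 2 + √b' ^ 2) := by
          nlinarith [sq_nonneg (√a * √b' - √a' * √b)]
      _ = _ := by rw [h1, h2, h3, h4]
  nlinarith [Real.sq_sqrt ha, Real.sq_sqrt ha', Real.sq_sqrt hb, Real.sq_sqrt hb',
    Real.sq_sqrt (add_nonneg ha ha'), Real.sq_sqrt (add_nonneg hb hb')]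

lemma sum_mul_log_sub_le {ι : Type*} (s : Finset ι) (a b P Q : ι → ℝ) (ha : ∀ i ∈ s, 0 < a i)
    (hb : ∀ i ∈ s, 0 < b i) (hP : ∀ i ∈ s, b i ≤ P i) (hQ : ∀ i ∈ s, a i ≤ Q i)
    (hsum : ∑ i ∈ s, (P i + Q i) ≤ 2) :
    ∑ i ∈ s, (a i - b i) * (Real.log (P i) - Real.log (Q i)) ≤
      8 * √(∑ i ∈ s, (√(a i) - √(b i)) ^ 2) := by
  have hPQ : √(∑ i ∈ s, (√(P i) + √(Q i)) ^ 2) ≤ 2 := by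
    rw [Real.sqrt_le_left (by norm_num)]
    calc ∑ i ∈ s, (√(P i) + √(Q i)) ^ 2 ≤ ∑ i ∈ s, 2 * (P i + Q i) := by
          refine Finset.sum_le_sum fun i hi => ?_
          have h1 := Real.sq_sqrt ((hb i hi).le.trans (hP i hi))
          have h2 := Real.sq_sqrt ((ha i hi).le.trans (hQ i hi))
          nlinarith [sq_nonneg (√(P i) - √(Q i))]
      _ ≤ 2 ^ 2 := by rw [← Finset.mul_sum]; linarith
  calc ∑ i ∈ s, (a i - b i) * (Real.log (P i) - Real.log (Q i))
      ≤ ∑ i ∈ s, 4 * (|√(a i) - √(b i)| * (√(P i) + √(Q i))) :=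
        Finset.sum_le_sum fun i hi =>
          mul_log_sub_le_of_le (ha i hi) (hb i hi) (hP i hi) (hQ i hi)
    _ = 4 * ∑ i ∈ s, |√(a i) - √(b i)| * (√(P i) + √(Q i)) := (Finset.mul_sum _ _ _).symm
    _ ≤ 4 * (√(∑ i ∈ s, |√(a i) - √(b i)| ^ 2) * √(∑ i ∈ s, (√(P i) + √(Q i)) ^ 2)) := by
        gcongr
        exact Real.sum_mul_le_sqrt_mul_sqrt _ _ _
    _ ≤ 4 * (√(∑ i ∈ s, |√(a i) - √(b i)| ^ 2) * 2) := by gcongr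
    _ = _ := by simp only [sq_abs]; ring

/-- If the increments of `V` are bounded and `V` does not diverge to infinities of opposite sign
at the two ends of `ℤ`, then `V` takes nearby values at arbitrarily distant points. -/
lemma exists_far_pair_of_not_tendsto {V : ℤ → ℝ} {M : ℝ} (hM : ∀ x, |V (x + 1) - V x| ≤ M)
    (h : ¬ ((Tendsto V atBot atBot ∧ Tendsto V atTop atTop) ∨
      (Tendsto V atBot atTop ∧ Tendsto V atTop atBot))) :
    ∃ K : ℝ, ∀ N : ℕ, ∃ m n : ℤ, m + N ≤ n ∧ |V n - V m| ≤ K := by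
  by_contra! hcon
  obtain ⟨N, hN⟩ := hcon M
  have hright : ∀ m n : ℤ, m + N ≤ n → (0 < V n - V m ↔ 0 < V (m + N) - V m) := by
    intro m n hmn
    induction n, hmn using Int.leInduction with
    | base => rfl
    | succ n hn ih =>
      rw [← ih]
      have h1 := hN m n hn
      have h2 := hN m (n + 1) (by omega)
      have h3 := abs_le.1 (hM n)
      rcases lt_abs.1 h1 with h1 | h1 <;> rcases lt_abs.1 h2 with h2 | h2 <;>
        constructor <;> intro _ <;> linarith
  have hstep : ∀ m : ℤ, 0 < V (m + 1 + N) - V (m + 1) ↔ 0 < V (m + N) - V m := by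
    intro m
    rw [← hright m (m + 1 + N) (by omega)]
    have h1 := hN m (m + 1 + N) (by omega)
    have h2 := hN (m + 1) (m + 1 + N) (by omega)
    have h3 := abs_le.1 (hM m)
    rcases lt_abs.1 h1 with h1 | h1 <;> rcases lt_abs.1 h2 with h2 | h2 <;>
      constructor <;> intro _ <;> linarith
  have hbase : ∀ m : ℤ, 0 < V (m + N) - V m ↔ 0 < V (0 + N) - V 0 := by
    intro m
    induction m using Int.induction_on with
    | zero => rfl
    | succ i ih => rw [hstep, ih]
    | pred i ih =>
      rw [← ih, ← hstep (-i - 1)]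
      simp
  have hsign : ∀ m n : ℤ, m + N ≤ n → (0 < V n - V m ↔ 0 < V (0 + N) - V 0) :=
    fun m n hmn => (hright m n hmn).trans (hbase m)
  have hlarge : ∀ K : ℝ, ∃ N' : ℕ, ∀ m n : ℤ, m + N' ≤ n →
      m + N ≤ n ∧ K < |V n - V m| := by
    intro K
    obtain ⟨N', hN'⟩ := hcon K
    exact ⟨max N N', fun m n hmn =>
      ⟨by push_cast at hmn; omega, hN' m n (by push_cast at hmn; omega)⟩⟩
  apply h
  by_cases hpos : 0 < V (0 + N) - V 0
  · left
    have habs : ∀ m n : ℤ, m + N ≤ n → |V n - V m| = V n - V m :=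
      fun m n hmn => abs_of_pos ((hsign m n hmn).2 hpos)
    constructor
    · rw [tendsto_atBot]
      intro b
      obtain ⟨N', hN'⟩ := hlarge (V 0 - b)
      filter_upwards [eventually_le_atBot (-N' : ℤ)] with m hm
      obtain ⟨h1, h2⟩ := hN' m 0 (by omega)
      rw [habs _ _ h1] at h2
      linarith
    · rw [tendsto_atTop]
      intro b
      obtain ⟨N', hN'⟩ := hlarge (b - V 0)
      filter_upwards [eventually_ge_atTop (N' : ℤ)] with m hm
      obtain ⟨h1, h2⟩ := hN' 0 m (by omega)
      rw [habs _ _ h1] at h2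
      linarith
  · right
    have habs : ∀ m n : ℤ, m + N ≤ n → |V n - V m| = -(V n - V m) :=
      fun m n hmn => abs_of_nonpos (not_lt.1 (mt (hsign m n hmn).1 hpos))
    constructor
    · rw [tendsto_atTop]
      intro b
      obtain ⟨N', hN'⟩ := hlarge (b - V 0)
      filter_upwards [eventually_le_atBot (-N' : ℤ)] with m hm
      obtain ⟨h1, h2⟩ := hN' m 0 (by omega)
      rw [habs _ _ h1] at h2
      linarith
    · rw [tendsto_atBot]
      intro b
      obtain ⟨N', hN'⟩ := hlarge (V 0 - b)
      filter_upwards [eventually_ge_atTop (N' : ℤ)] with m hm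
      obtain ⟨h1, h2⟩ := hN' 0 m (by omega)
      rw [habs _ _ h1] at h2
      linarith

lemma exists_subset_Icc_neg (Δ : Finset ℤ) : ∃ k : ℕ, Δ ⊆ Finset.Icc (-k : ℤ) k := by
  refine ⟨Δ.sup Int.natAbs, fun u hu => ?_⟩
  have := Finset.le_sup (f := Int.natAbs) hu
  rw [Finset.mem_Icc]
  omega

/-- Positive consistent cylinder weights `W Λ A` (the mass of the configurations whose set of
occupied sites in `Λ` is `A`), stationary for the nearest-neighbor exclusion dynamics on `ℤ` with
rate `r x` for a jump `x → x + 1`, rate `l x` for a jump `x + 1 → x`, and potential `V`. -/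
structure StationaryWeight (r l V : ℤ → ℝ) (W : Finset ℤ → Finset ℤ → ℝ) : Prop where
  r_pos : ∀ x, 0 < r x
  r_le : ∀ x, r x ≤ 1
  l_pos : ∀ x, 0 < l x
  l_le : ∀ x, l x ≤ 1
  balance : ∀ x, V x + Real.log (r x) = V (x + 1) + Real.log (l x)
  pos : ∀ Λ A, 0 < W Λ A
  total : W ∅ ∅ = 2
  consistent : ∀ Λ A y, y ∉ Λ → A ⊆ Λ → W Λ A = W (insert y Λ) A + W (insert y Λ) (insert y A)
  stationary : ∀ m n : ℤ, m ≤ n → ∀ f : Finset ℤ → ℝ,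
    ∑ x ∈ Finset.Icc (m - 1) n, ∑ A ∈ (Finset.Icc m n \ {x, x + 1}).powerset,
      (r x * W (insert x (insert (x + 1) (Finset.Icc m n \ {x, x + 1}))) (insert x A) -
        l x * W (insert x (insert (x + 1) (Finset.Icc m n \ {x, x + 1}))) (insert (x + 1) A)) *
      (f (insert (x + 1) A ∩ Finset.Icc m n) - f (insert x A ∩ Finset.Icc m n)) = 0

/-- The Dirichlet form of the bond `{x, x + 1}` seen from the environment in `Γ`. -/
noncomputable def bondEnergy (r l : ℤ → ℝ) (W : Finset ℤ → Finset ℤ → ℝ) (x : ℤ) (Γ : Finset ℤ) :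
    ℝ :=
  ∑ A ∈ Γ.powerset, (√(r x * W (insert x (insert (x + 1) Γ)) (insert x A)) -
    √(l x * W (insert x (insert (x + 1) Γ)) (insert (x + 1) A))) ^ 2

lemma bondEnergy_nonneg (r l : ℤ → ℝ) (W : Finset ℤ → Finset ℤ → ℝ) (x : ℤ) (Γ : Finset ℤ) :
    0 ≤ bondEnergy r l W x Γ :=
  Finset.sum_nonneg fun _ _ => sq_nonneg _

namespace StationaryWeight

variable {r l V : ℤ → ℝ} {W : Finset ℤ → Finset ℤ → ℝ}

lemma consistent_bond (hW : StationaryWeight r l V W) {x y z : ℤ} {Γ A : Finset ℤ}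
    (hx : y ≠ x) (hx' : y ≠ x + 1) (hy : y ∉ Γ) (hz : z = x ∨ z = x + 1) (hA : A ⊆ Γ) :
    W (insert x (insert (x + 1) Γ)) (insert z A) =
      W (insert x (insert (x + 1) (insert y Γ))) (insert z A) +
      W (insert x (insert (x + 1) (insert y Γ))) (insert z (insert y A)) := by
  rw [hW.consistent _ _ y (by simp [hx, hx', hy]), Finset.insert_comm y x,
    Finset.insert_comm y (x + 1), Finset.insert_comm y z]
  rcases hz with rfl | rfl
  · exact Finset.insert_subset_insert _ (hA.trans (Finset.subset_insert _ _))
  · rw [Finset.insert_comm]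
    exact Finset.insert_subset_insert _ (hA.trans (Finset.subset_insert _ _))

lemma sum_weight (hW : StationaryWeight r l V W) (Λ : Finset ℤ) :
    ∑ A ∈ Λ.powerset, W Λ A = 2 := by
  induction Λ using Finset.induction_on with
  | empty => simp [hW.total]
  | insert y Λ hy ih =>
    rw [Finset.sum_powerset_insert hy, ← Finset.sum_add_distrib, ← ih]
    exact Finset.sum_congr rfl fun A hA =>
      (hW.consistent Λ A y hy (Finset.mem_powerset.1 hA)).symm

lemma sum_weight_bond (hW : StationaryWeight r l V W) {x z : ℤ} (hz : z = x ∨ z = x + 1)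
    (Γ : Finset ℤ) (hx : x ∉ Γ) (hx' : x + 1 ∉ Γ) :
    ∑ A ∈ Γ.powerset, W (insert x (insert (x + 1) Γ)) (insert z A) = W {x, x + 1} {z} := by
  induction Γ using Finset.induction_on with
  | empty => simp
  | insert y Γ hy ih =>
    simp only [Finset.mem_insert, not_or] at hx hx'
    rw [Finset.sum_powerset_insert hy, ← Finset.sum_add_distrib, ← ih hx.2 hx'.2]
    exact Finset.sum_congr rfl fun A hA =>
      (hW.consistent_bond (Ne.symm hx.1) (Ne.symm hx'.1) hy hz (Finset.mem_powerset.1 hA)).symm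

lemma bondEnergy_le_insert (hW : StationaryWeight r l V W) {x y : ℤ} {Γ : Finset ℤ}
    (hx : y ≠ x) (hx' : y ≠ x + 1) :
    bondEnergy r l W x Γ ≤ bondEnergy r l W x (insert y Γ) := by
  by_cases hy : y ∈ Γ
  · rw [Finset.insert_eq_of_mem hy]
  unfold bondEnergy
  rw [Finset.sum_powerset_insert hy, ← Finset.sum_add_distrib]
  refine Finset.sum_le_sum fun A hA => ?_
  have hA := Finset.mem_powerset.1 hA
  rw [hW.consistent_bond hx hx' hy (Or.inl rfl) hA, hW.consistent_bond hx hx' hy (Or.inr rfl) hA,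
    mul_add, mul_add]
  exact sq_sqrt_add_sub_sqrt_add_le (mul_nonneg (hW.r_pos x).le (hW.pos _ _).le)
    (mul_nonneg (hW.r_pos x).le (hW.pos _ _).le) (mul_nonneg (hW.l_pos x).le (hW.pos _ _).le)
    (mul_nonneg (hW.l_pos x).le (hW.pos _ _).le)

lemma bondEnergy_mono (hW : StationaryWeight r l V W) {x : ℤ} {Γ Δ : Finset ℤ} (h : Γ ⊆ Δ)
    (hx : x ∉ Δ) (hx' : x + 1 ∉ Δ) : bondEnergy r l W x Γ ≤ bondEnergy r l W x Δ := by
  suffices H : ∀ T : Finset ℤ, x ∉ T → x + 1 ∉ T →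
      bondEnergy r l W x Γ ≤ bondEnergy r l W x (Γ ∪ T) by
    rw [← Finset.union_eq_right.2 h]
    exact H Δ hx hx'
  intro T
  induction T using Finset.induction_on with
  | empty => simp
  | insert y T hy ih =>
    simp only [Finset.mem_insert, not_or]
    intro hx hx'
    rw [Finset.union_insert]
    exact (ih hx.2 hx'.2).trans (hW.bondEnergy_le_insert (Ne.symm hx.1) (Ne.symm hx'.1))

/-- The stationary current through the bond `{x, x + 1}`. -/
def current (r l : ℤ → ℝ) (W : Finset ℤ → Finset ℤ → ℝ) (x : ℤ) : ℝ :=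
  r x * W {x, x + 1} {x} - l x * W {x, x + 1} {x + 1}

lemma sum_current (hW : StationaryWeight r l V W) {x : ℤ} (Γ : Finset ℤ) (hx : x ∉ Γ)
    (hx' : x + 1 ∉ Γ) :
    ∑ A ∈ Γ.powerset, (r x * W (insert x (insert (x + 1) Γ)) (insert x A) -
      l x * W (insert x (insert (x + 1) Γ)) (insert (x + 1) A)) = current r l W x := by
  rw [Finset.sum_sub_distrib, ← Finset.mul_sum, ← Finset.mul_sum,
    hW.sum_weight_bond (Or.inl rfl) Γ hx hx', hW.sum_weight_bond (Or.inr rfl) Γ hx hx', current]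

lemma current_succ (hW : StationaryWeight r l V W) (x : ℤ) :
    current r l W (x + 1) = current r l W x := by
  have h := hW.stationary (x + 1) (x + 1) le_rfl (fun A => if x + 1 ∈ A then 1 else 0)
  have hIcc : Finset.Icc (x + 1 - 1) (x + 1) = {x, x + 1} := by
    ext u; simp only [Finset.mem_Icc, Finset.mem_insert, Finset.mem_singleton]; omega
  rw [hIcc, Finset.sum_pair (by omega), Finset.Icc_self,
    Finset.sdiff_eq_empty_iff_subset.2 (by simp : ({x + 1} : Finset ℤ) ⊆ {x, x + 1}),
    Finset.sdiff_eq_empty_iff_subset.2 (by simp : ({x + 1} : Finset ℤ) ⊆ {x + 1, x + 1 + 1})] at h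
  simp [-mul_eq_zero] at h
  unfold current
  linarith

lemma current_eq (hW : StationaryWeight r l V W) (x y : ℤ) :
    current r l W x = current r l W y := by
  have H : ∀ x, current r l W x = current r l W 0 := by
    intro x
    induction x using Int.induction_on with
    | zero => rfl
    | succ i ih => rw [hW.current_succ, ih]
    | pred i ih => rw [← ih, ← hW.current_succ (-i - 1), sub_add_cancel]
  rw [H x, H y]

lemma weight_bond_le (hW : StationaryWeight r l V W) {x y z : ℤ} {Γ A : Finset ℤ} (hxy : y ≠ x)
    (hy : y ∉ Γ) (hz : z = x ∨ z = y) (hA : A ⊆ Γ) :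
    W (insert y (insert x Γ)) (insert z A) ≤
      if z = x then W (insert x Γ) (insert x A) else W (insert x Γ) A := by
  have hy' : y ∉ insert x Γ := by simp [hxy, hy]
  rcases hz with rfl | rfl
  · rw [if_pos rfl, hW.consistent _ _ y hy' (Finset.insert_subset_insert _ hA)]
    linarith [hW.pos (insert y (insert z Γ)) (insert y (insert z A))]
  · rw [if_neg hxy, hW.consistent _ _ z hy' (hA.trans (Finset.subset_insert _ _))]
    linarith [hW.pos (insert z (insert x Γ)) A]

/-- The entropy balance in the box `[m, n]`. -/
lemma energy_le (hW : StationaryWeight r l V W) {m n : ℤ} (hmn : m ≤ n) :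
    2 * ∑ x ∈ Finset.Ico m n, bondEnergy r l W x (Finset.Icc m n \ {x, x + 1}) ≤
      current r l W 0 * (V n - V m) +
      8 * √(bondEnergy r l W n (Finset.Icc m n \ {n, n + 1})) +
      8 * √(bondEnergy r l W (m - 1) (Finset.Icc m n \ {m - 1, m})) := by
  set Λ := Finset.Icc m n with hΛ
  set f : Finset ℤ → ℝ := fun A => Real.log (W Λ A) - ∑ x ∈ A, V x with hf
  have h := hW.stationary m n hmn f
  have hIcc : Finset.Icc (m - 1) n = insert (m - 1) (insert n (Finset.Ico m n)) := by
    ext u; simp only [Finset.mem_Icc, Finset.mem_insert, Finset.mem_Ico]; omega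
  rw [hIcc, Finset.sum_insert (by simp; omega), Finset.sum_insert (by simp), ← hΛ] at h
  have bulk : ∀ x ∈ Finset.Ico m n, ∑ A ∈ (Λ \ {x, x + 1}).powerset,
      (r x * W (insert x (insert (x + 1) (Λ \ {x, x + 1}))) (insert x A) -
        l x * W (insert x (insert (x + 1) (Λ \ {x, x + 1}))) (insert (x + 1) A)) *
      (f (insert (x + 1) A ∩ Λ) - f (insert x A ∩ Λ)) ≤
      - (2 * bondEnergy r l W x (Λ \ {x, x + 1})) := by
    intro x hx
    rw [Finset.mem_Ico] at hx
    have hx1 : x ∈ Λ := by simp [hΛ]; omega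
    have hx2 : x + 1 ∈ Λ := by simp [hΛ]; omega
    have hbox : insert x (insert (x + 1) (Λ \ {x, x + 1})) = Λ := by
      ext u; simp only [Finset.mem_insert, Finset.mem_sdiff, Finset.mem_singleton]
      by_cases h1 : u = x
      · simp [h1, hx1]
      · by_cases h2 : u = x + 1
        · simp [h2, hx2]
        · simp [h1, h2]
    rw [bondEnergy, hbox, Finset.mul_sum, ← Finset.sum_neg_distrib]
    refine Finset.sum_le_sum fun A hA => ?_
    have hA := Finset.mem_powerset.1 hA
    have hAΛ : A ⊆ Λ := hA.trans Finset.sdiff_subset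
    have hxA : x ∉ A := fun h' => by simpa using hA h'
    have hxA' : x + 1 ∉ A := fun h' => by simpa using hA h'
    rw [Finset.inter_eq_left.2 (Finset.insert_subset hx1 hAΛ),
      Finset.inter_eq_left.2 (Finset.insert_subset hx2 hAΛ)]
    have hr := hW.r_pos x
    have hl := hW.l_pos x
    have h1 := hW.pos Λ (insert x A)
    have h2 := hW.pos Λ (insert (x + 1) A)
    have key := two_mul_sq_sqrt_sub_le_mul_log (mul_pos hr h1) (mul_pos hl h2)
    rw [Real.log_mul hr.ne' h1.ne', Real.log_mul hl.ne' h2.ne'] at key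
    have hdiff : f (insert (x + 1) A) - f (insert x A) =
        -(Real.log (r x) + Real.log (W Λ (insert x A)) -
          (Real.log (l x) + Real.log (W Λ (insert (x + 1) A)))) := by
      simp only [hf, Finset.sum_insert hxA, Finset.sum_insert hxA']
      linarith [hW.balance x]
    rw [hdiff]
    linarith
  have right : ∑ A ∈ (Λ \ {n, n + 1}).powerset,
      (r n * W (insert n (insert (n + 1) (Λ \ {n, n + 1}))) (insert n A) -
        l n * W (insert n (insert (n + 1) (Λ \ {n, n + 1}))) (insert (n + 1) A)) *
      (f (insert (n + 1) A ∩ Λ) - f (insert n A ∩ Λ)) ≤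
      current r l W 0 * V n + 8 * √(bondEnergy r l W n (Λ \ {n, n + 1})) := by
    have hn : n ∈ Λ := by simp [hΛ, hmn]
    have hn' : n + 1 ∉ Λ := by simp [hΛ]
    have hbox : insert n (Λ \ {n, n + 1}) = Λ := by
      ext u; simp only [Finset.mem_insert, Finset.mem_sdiff, Finset.mem_singleton]
      by_cases h1 : u = n
      · simp [h1, hn]
      · by_cases h2 : u = n + 1
        · simp [h2, hn']
        · simp [h1, h2]
    set Γ := Λ \ {n, n + 1} with hΓ
    have hnΓ : n ∉ Γ := by simp [hΓ]
    have hnΓ' : n + 1 ∉ Γ := by simp [hΓ]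
    rw [hW.current_eq 0 n, ← hW.sum_current Γ hnΓ hnΓ', Finset.sum_mul, ← sub_le_iff_le_add',
      ← Finset.sum_sub_distrib, bondEnergy]
    refine le_trans (le_of_eq ?_) (sum_mul_log_sub_le Γ.powerset
      (fun A => r n * W (insert n (insert (n + 1) Γ)) (insert n A))
      (fun A => l n * W (insert n (insert (n + 1) Γ)) (insert (n + 1) A))
      (fun A => W Λ A) (fun A => W Λ (insert n A)) ?_ ?_ ?_ ?_ ?_)
    · refine Finset.sum_congr rfl fun A hA => ?_
      have hA := Finset.mem_powerset.1 hA
      have hAΛ : A ⊆ Λ := hA.trans Finset.sdiff_subset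
      have hnA : n ∉ A := fun h' => hnΓ (hA h')
      rw [Finset.inter_eq_left.2 (Finset.insert_subset hn hAΛ),
        Finset.insert_inter_of_notMem hn', Finset.inter_eq_left.2 hAΛ]
      simp only [hf, Finset.sum_insert hnA]
      ring
    · exact fun A _ => mul_pos (hW.r_pos n) (hW.pos _ _)
    · exact fun A _ => mul_pos (hW.l_pos n) (hW.pos _ _)
    · intro A hA
      have := hW.weight_bond_le (x := n) (y := n + 1) (z := n + 1) (by omega) hnΓ' (Or.inr rfl)
        (Finset.mem_powerset.1 hA)
      rw [if_neg (by omega), hbox] at this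
      rw [Finset.insert_comm, hbox]
      exact (mul_le_of_le_one_left (hW.pos _ _).le (hW.l_le n)).trans this
    · intro A hA
      have := hW.weight_bond_le (x := n) (y := n + 1) (z := n) (by omega) hnΓ' (Or.inl rfl)
        (Finset.mem_powerset.1 hA)
      rw [if_pos rfl, hbox] at this
      rw [Finset.insert_comm, hbox]
      exact (mul_le_of_le_one_left (hW.pos _ _).le (hW.r_le n)).trans this
    · have := hW.sum_weight (insert n Γ)
      rw [Finset.sum_powerset_insert hnΓ, ← Finset.sum_add_distrib, hbox] at this
      exact this.le
  have left : ∑ A ∈ (Λ \ {m - 1, m - 1 + 1}).powerset,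
      (r (m - 1) * W (insert (m - 1) (insert (m - 1 + 1) (Λ \ {m - 1, m - 1 + 1})))
          (insert (m - 1) A) -
        l (m - 1) * W (insert (m - 1) (insert (m - 1 + 1) (Λ \ {m - 1, m - 1 + 1})))
          (insert (m - 1 + 1) A)) *
      (f (insert (m - 1 + 1) A ∩ Λ) - f (insert (m - 1) A ∩ Λ)) ≤
      - (current r l W 0 * V m) + 8 * √(bondEnergy r l W (m - 1) (Λ \ {m - 1, m})) := by
    have hm : m ∈ Λ := by simp [hΛ, hmn]
    have hm' : m - 1 ∉ Λ := by simp [hΛ]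
    have hbox : insert m (Λ \ {m - 1, m}) = Λ := by
      ext u; simp only [Finset.mem_insert, Finset.mem_sdiff, Finset.mem_singleton]
      by_cases h1 : u = m
      · simp [h1, hm]
      · by_cases h2 : u = m - 1
        · simp [h2, hm']
        · simp [h1, h2]
    have hcur := hW.sum_current (x := m - 1) (Λ \ {m - 1, m}) (by simp) (by simp)
    rw [hW.current_eq 0 (m - 1), ← hcur, bondEnergy]
    simp only [sub_add_cancel]
    set Γ := Λ \ {m - 1, m} with hΓ
    have hmΓ : m ∉ Γ := by simp [hΓ]
    have hmΓ' : m - 1 ∉ Γ := by simp [hΓ]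
    rw [Finset.sum_mul, ← sub_le_iff_le_add', sub_neg_eq_add, ← Finset.sum_add_distrib]
    simp_rw [sub_sq_comm (√(r (m - 1) * _))]
    refine le_trans (le_of_eq ?_) (sum_mul_log_sub_le Γ.powerset
      (fun A => l (m - 1) * W (insert (m - 1) (insert m Γ)) (insert m A))
      (fun A => r (m - 1) * W (insert (m - 1) (insert m Γ)) (insert (m - 1) A))
      (fun A => W Λ A) (fun A => W Λ (insert m A)) ?_ ?_ ?_ ?_ ?_)
    · refine Finset.sum_congr rfl fun A hA => ?_
      have hA := Finset.mem_powerset.1 hA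
      have hAΛ : A ⊆ Λ := hA.trans Finset.sdiff_subset
      have hmA : m ∉ A := fun h' => hmΓ (hA h')
      rw [Finset.inter_eq_left.2 (Finset.insert_subset hm hAΛ),
        Finset.insert_inter_of_notMem hm', Finset.inter_eq_left.2 hAΛ]
      simp only [hf, Finset.sum_insert hmA]
      ring
    · exact fun A _ => mul_pos (hW.l_pos _) (hW.pos _ _)
    · exact fun A _ => mul_pos (hW.r_pos _) (hW.pos _ _)
    · intro A hA
      have := hW.weight_bond_le (x := m) (y := m - 1) (z := m - 1) (by omega) hmΓ' (Or.inr rfl)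
        (Finset.mem_powerset.1 hA)
      rw [if_neg (by omega), hbox] at this
      rw [hbox]
      exact (mul_le_of_le_one_left (hW.pos _ _).le (hW.r_le _)).trans this
    · intro A hA
      have := hW.weight_bond_le (x := m) (y := m - 1) (z := m) (by omega) hmΓ' (Or.inl rfl)
        (Finset.mem_powerset.1 hA)
      rw [if_pos rfl, hbox] at this
      rw [hbox]
      exact (mul_le_of_le_one_left (hW.pos _ _).le (hW.l_le _)).trans this
    · have := hW.sum_weight (insert m Γ)
      rw [Finset.sum_powerset_insert hmΓ, ← Finset.sum_add_distrib, hbox] at this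
      exact this.le
  have bulk' := Finset.sum_le_sum bulk
  rw [Finset.sum_neg_distrib, ← Finset.mul_sum] at bulk'
  linarith

lemma weight_pair_add_le (hW : StationaryWeight r l V W) (x : ℤ) :
    r x * W {x, x + 1} {x} + l x * W {x, x + 1} {x + 1} ≤ 2 := by
  have h := hW.sum_weight {x, x + 1}
  rw [Finset.sum_powerset_insert (by simp), ← insert_empty_eq (x + 1),
    Finset.sum_powerset_insert (by simp), Finset.sum_powerset_insert (by simp)] at h
  simp only [Finset.powerset_empty, Finset.sum_singleton, insert_empty_eq] at h
  have h1 := mul_le_of_le_one_left (hW.pos {x, x + 1} {x}).le (hW.r_le x)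
  have h2 := mul_le_of_le_one_left (hW.pos {x, x + 1} {x + 1}).le (hW.l_le x)
  linarith [hW.pos {x, x + 1} ∅, hW.pos {x, x + 1} {x, x + 1}]

lemma bondEnergy_le_two (hW : StationaryWeight r l V W) {x : ℤ} (Γ : Finset ℤ) (hx : x ∉ Γ)
    (hx' : x + 1 ∉ Γ) : bondEnergy r l W x Γ ≤ 2 := by
  refine le_trans ?_ (hW.weight_pair_add_le x)
  rw [← hW.sum_weight_bond (Or.inl rfl) Γ hx hx', ← hW.sum_weight_bond (Or.inr rfl) Γ hx hx',
    Finset.mul_sum, Finset.mul_sum, ← Finset.sum_add_distrib]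
  refine Finset.sum_le_sum fun A _ => ?_
  have h1 := mul_pos (hW.r_pos x) (hW.pos (insert x (insert (x + 1) Γ)) (insert x A))
  have h2 := mul_pos (hW.l_pos x) (hW.pos (insert x (insert (x + 1) Γ)) (insert (x + 1) A))
  nlinarith [Real.sq_sqrt h1.le, Real.sq_sqrt h2.le,
    mul_nonneg (Real.sqrt_nonneg (r x * W (insert x (insert (x + 1) Γ)) (insert x A)))
      (Real.sqrt_nonneg (l x * W (insert x (insert (x + 1) Γ)) (insert (x + 1) A)))]

lemma sq_current_le (hW : StationaryWeight r l V W) {x : ℤ} (Γ : Finset ℤ) (hx : x ∉ Γ)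
    (hx' : x + 1 ∉ Γ) : current r l W 0 ^ 2 ≤ 4 * bondEnergy r l W x Γ := by
  rw [hW.current_eq 0 x]
  have hmono := hW.bondEnergy_mono (Finset.empty_subset Γ) hx hx'
  have hE : bondEnergy r l W x ∅ =
      (√(r x * W {x, x + 1} {x}) - √(l x * W {x, x + 1} {x + 1})) ^ 2 := by
    simp [bondEnergy]
  have ha := Real.sq_sqrt (mul_pos (hW.r_pos x) (hW.pos {x, x + 1} {x})).le
  have hb := Real.sq_sqrt (mul_pos (hW.l_pos x) (hW.pos {x, x + 1} {x + 1})).le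
  have hab := hW.weight_pair_add_le x
  set s := √(r x * W {x, x + 1} {x})
  set t := √(l x * W {x, x + 1} {x + 1})
  have hcur : current r l W x = s ^ 2 - t ^ 2 := by rw [ha, hb, current]
  have hst : (s + t) ^ 2 ≤ 4 := by nlinarith [sq_nonneg (s - t)]
  calc current r l W x ^ 2 = (s - t) ^ 2 * (s + t) ^ 2 := by rw [hcur]; ring
    _ ≤ (s - t) ^ 2 * 4 := by gcongr
    _ ≤ _ := by linarith

lemma sqrt_bondEnergy_le (hW : StationaryWeight r l V W) {x : ℤ} (Γ : Finset ℤ) (hx : x ∉ Γ)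
    (hx' : x + 1 ∉ Γ) : √(bondEnergy r l W x Γ) ≤ 2 := by
  rw [Real.sqrt_le_left (by norm_num)]
  linarith [hW.bondEnergy_le_two Γ hx hx']

lemma current_eq_zero (hW : StationaryWeight r l V W) {K : ℝ}
    (hK : ∀ N : ℕ, ∃ m n : ℤ, m + N ≤ n ∧ |V n - V m| ≤ K) : current r l W 0 = 0 := by
  by_contra hJ
  set J := current r l W 0 with hJdef
  have hJ2 : 0 < J ^ 2 := by positivity
  obtain ⟨N, hN⟩ := exists_nat_gt ((|J| * K + 32) / (J ^ 2 / 2))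
  rw [div_lt_iff₀ (by positivity)] at hN
  obtain ⟨m, n, hmn, hV⟩ := hK N
  have hmain := hW.energy_le (show m ≤ n by omega)
  have h1 := hW.sqrt_bondEnergy_le (x := n) (Finset.Icc m n \ {n, n + 1}) (by simp) (by simp)
  have h2 := hW.sqrt_bondEnergy_le (x := m - 1) (Finset.Icc m n \ {m - 1, m}) (by simp) (by simp)
  have h3 : J * (V n - V m) ≤ |J| * K :=
    (le_abs_self _).trans (by rw [abs_mul]; gcongr)
  have h4 : (N : ℝ) * (J ^ 2 / 4) ≤
      ∑ x ∈ Finset.Ico m n, bondEnergy r l W x (Finset.Icc m n \ {x, x + 1}) := by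
    have hcard : (N : ℝ) ≤ (Finset.Ico m n).card := by
      rw [Int.card_Ico]
      exact_mod_cast (by omega : N ≤ (n - m).toNat)
    calc (N : ℝ) * (J ^ 2 / 4) ≤ (Finset.Ico m n).card * (J ^ 2 / 4) := by gcongr
      _ = ∑ x ∈ Finset.Ico m n, J ^ 2 / 4 := by rw [Finset.sum_const, nsmul_eq_mul]
      _ ≤ _ := Finset.sum_le_sum fun x _ => by
        have := hW.sq_current_le (x := x) (Finset.Icc m n \ {x, x + 1}) (by simp) (by simp)
        linarith
  linarith

/-- The total Dirichlet form of the box `[-n, n]`. -/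
noncomputable def boxEnergy (r l : ℤ → ℝ) (W : Finset ℤ → Finset ℤ → ℝ) (n : ℕ) : ℝ :=
  ∑ x ∈ Finset.Ico (-n : ℤ) n, bondEnergy r l W x (Finset.Icc (-n : ℤ) n \ {x, x + 1})

lemma boxEnergy_add_le_succ (hW : StationaryWeight r l V W) (n : ℕ) :
    boxEnergy r l W n + bondEnergy r l W n (Finset.Icc (-n : ℤ) n \ {(n : ℤ), (n : ℤ) + 1}) +
      bondEnergy r l W (-n - 1) (Finset.Icc (-n : ℤ) n \ {-(n : ℤ) - 1, -(n : ℤ)}) ≤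
      boxEnergy r l W (n + 1) := by
  have hIco : Finset.Ico (-(n + 1 : ℕ) : ℤ) (n + 1 : ℕ) =
      insert (-n - 1 : ℤ) (insert (n : ℤ) (Finset.Ico (-n : ℤ) n)) := by
    ext u; simp only [Finset.mem_Ico, Finset.mem_insert]; omega
  have hmono : ∀ x : ℤ, bondEnergy r l W x (Finset.Icc (-n : ℤ) n \ {x, x + 1}) ≤
      bondEnergy r l W x (Finset.Icc (-(n + 1 : ℕ) : ℤ) (n + 1 : ℕ) \ {x, x + 1}) := fun x =>
    hW.bondEnergy_mono (Finset.sdiff_subset_sdiff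
      (Finset.Icc_subset_Icc (by push_cast; omega) (by push_cast; omega)) le_rfl)
      (by simp) (by simp)
  have h1 := hmono n
  have h2 := hmono (-n - 1)
  have h3 := Finset.sum_le_sum fun x (_ : x ∈ Finset.Ico (-n : ℤ) n) => hmono x
  rw [sub_add_cancel] at h2
  unfold boxEnergy
  rw [hIco, Finset.sum_insert (by simp), Finset.sum_insert (by simp), sub_add_cancel]
  linarith

lemma boxEnergy_eq_zero (hW : StationaryWeight r l V W) (hJ : current r l W 0 = 0) (k : ℕ) :
    boxEnergy r l W k = 0 := by
  have hnonneg : ∀ n, 0 ≤ boxEnergy r l W n := fun n =>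
    Finset.sum_nonneg fun _ _ => bondEnergy_nonneg _ _ _ _ _
  have hmono : Monotone (boxEnergy r l W) := monotone_nat_of_le_succ fun n => by
    linarith [hW.boxEnergy_add_le_succ n,
      bondEnergy_nonneg r l W n (Finset.Icc (-n : ℤ) n \ {(n : ℤ), (n : ℤ) + 1}),
      bondEnergy_nonneg r l W (-n - 1) (Finset.Icc (-n : ℤ) n \ {-(n : ℤ) - 1, -(n : ℤ)})]
  have hle : ∀ n : ℕ, boxEnergy r l W n ≤ 16 ∧
      boxEnergy r l W n + boxEnergy r l W n ^ 2 / 32 ≤ boxEnergy r l W (n + 1) := by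
    intro n
    have h := hW.energy_le (show (-n : ℤ) ≤ n by omega)
    rw [hJ, zero_mul, zero_add, ← boxEnergy] at h
    have hs := hW.boxEnergy_add_le_succ n
    have h1 := hW.sqrt_bondEnergy_le (x := n)
      (Finset.Icc (-n : ℤ) n \ {(n : ℤ), (n : ℤ) + 1}) (by simp) (by simp)
    have h2 := hW.sqrt_bondEnergy_le (x := -n - 1)
      (Finset.Icc (-n : ℤ) n \ {-(n : ℤ) - 1, -(n : ℤ)}) (by simp) (by simp)
    have h3 := Real.sq_sqrt (bondEnergy_nonneg r l W n
      (Finset.Icc (-n : ℤ) n \ {(n : ℤ), (n : ℤ) + 1}))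
    have h4 := Real.sq_sqrt (bondEnergy_nonneg r l W (-n - 1)
      (Finset.Icc (-n : ℤ) n \ {-(n : ℤ) - 1, -(n : ℤ)}))
    set s := √(bondEnergy r l W n (Finset.Icc (-n : ℤ) n \ {(n : ℤ), (n : ℤ) + 1}))
    set t := √(bondEnergy r l W (-n - 1) (Finset.Icc (-n : ℤ) n \ {-(n : ℤ) - 1, -(n : ℤ)}))
    refine ⟨by linarith, ?_⟩
    have hsq : boxEnergy r l W n ^ 2 ≤ (4 * s + 4 * t) ^ 2 :=
      pow_le_pow_left₀ (hnonneg n) (by linarith) 2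
    nlinarith [sq_nonneg (s - t)]
  by_contra hk
  have hpos : 0 < boxEnergy r l W k := lt_of_le_of_ne (hnonneg k) (Ne.symm hk)
  set g := boxEnergy r l W k with hg
  have hgrow : ∀ j : ℕ, j * (g ^ 2 / 32) ≤ boxEnergy r l W (k + j) := by
    intro j
    induction j with
    | zero => simpa using hpos.le
    | succ j ih =>
      have h1 := (hle (k + j)).2
      have h2 : g ^ 2 ≤ boxEnergy r l W (k + j) ^ 2 :=
        pow_le_pow_left₀ hpos.le (hmono (Nat.le_add_right k j)) 2
      rw [← add_assoc]
      push_cast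
      linarith
  obtain ⟨j, hj⟩ := exists_nat_gt (16 / (g ^ 2 / 32))
  rw [div_lt_iff₀ (by positivity)] at hj
  linarith [hgrow j, (hle (k + j)).1]

/-- A stationary weight with vanishing current satisfies the detailed balance equations. -/
lemma detailed_balance (hW : StationaryWeight r l V W) (hJ : current r l W 0 = 0) {x : ℤ}
    {Γ A : Finset ℤ} (hx : x ∉ Γ) (hx' : x + 1 ∉ Γ) (hA : A ⊆ Γ) :
    r x * W (insert x (insert (x + 1) Γ)) (insert x A) =
      l x * W (insert x (insert (x + 1) Γ)) (insert (x + 1) A) := by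
  obtain ⟨k, hk⟩ := exists_subset_Icc_neg (insert x (insert (x + 1) Γ))
  have hxk := hk (Finset.mem_insert_self _ _)
  have hxk' := hk (Finset.mem_insert_of_mem (Finset.mem_insert_self _ _))
  rw [Finset.mem_Icc] at hxk hxk'
  have hbox : bondEnergy r l W x (Finset.Icc (-k : ℤ) k \ {x, x + 1}) = 0 :=
    (Finset.sum_eq_zero_iff_of_nonneg fun _ _ => bondEnergy_nonneg _ _ _ _ _).1
      (hW.boxEnergy_eq_zero hJ k) x (Finset.mem_Ico.2 (by omega))
  have hΓ : Γ ⊆ Finset.Icc (-k : ℤ) k \ {x, x + 1} := fun u hu =>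
    Finset.mem_sdiff.2 ⟨hk (by simp [hu]), by
      simp only [Finset.mem_insert, Finset.mem_singleton, not_or]
      exact ⟨fun h => hx (h ▸ hu), fun h => hx' (h ▸ hu)⟩⟩
  have hzero : bondEnergy r l W x Γ = 0 := le_antisymm
    (hbox ▸ hW.bondEnergy_mono hΓ (by simp) (by simp)) (bondEnergy_nonneg _ _ _ _ _)
  have h := (Finset.sum_eq_zero_iff_of_nonneg fun _ _ => sq_nonneg _).1 hzero A
    (Finset.mem_powerset.2 hA)
  rw [sq_eq_zero_iff, sub_eq_zero, Real.sqrt_inj (mul_pos (hW.r_pos x) (hW.pos _ _)).le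
    (mul_pos (hW.l_pos x) (hW.pos _ _)).le] at h
  exact h

end StationaryWeight

/-- The configurations whose set of occupied sites in `Λ` is `A ∩ Λ`. -/
def cyl (Λ A : Finset ℤ) : Set (ℤ → Bool) := {η | ∀ x ∈ Λ, η x = decide (x ∈ A)}

/-- The configuration with set of occupied sites `A`. -/
def cfg (A : Finset ℤ) : ℤ → Bool := fun x => decide (x ∈ A)

lemma measurableSet_cyl (Λ A : Finset ℤ) : MeasurableSet (cyl Λ A) := by
  have : cyl Λ A = ⋂ x ∈ Λ, (fun η : ℤ → Bool => η x) ⁻¹' {decide (x ∈ A)} := by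
    ext η; simp [cyl]
  rw [this]
  exact Finset.measurableSet_biInter _ fun x _ => measurable_pi_apply x (MeasurableSet.singleton _)

lemma eq_sum_indicator_cyl {ψ : (ℤ → Bool) → ℝ} {Δ : Finset ℤ} (hψ : DependsOn ψ (Δ : Set ℤ)) :
    ψ = fun η => ∑ A ∈ Δ.powerset, (cyl Δ A).indicator (fun _ => ψ (cfg A)) η := by
  funext η
  rw [Finset.sum_eq_single_of_mem (Δ.filter (fun x => η x = true))
    (Finset.mem_powerset.2 (Finset.filter_subset _ _))]
  · rw [Set.indicator_of_mem]
    · refine hψ fun x hx => ?_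
      simp [cfg, Finset.mem_coe.1 hx]
    · intro x hx
      simp [hx]
  · intro A hA hne
    refine Set.indicator_of_notMem (fun hη => hne ?_) _
    ext x
    rw [Finset.mem_filter]
    constructor
    · intro hx
      have hxΔ := Finset.mem_powerset.1 hA hx
      exact ⟨hxΔ, by simp [hη x hxΔ, hx]⟩
    · rintro ⟨hxΔ, hx⟩
      simpa [hη x hxΔ] using hx

lemma integrable_of_dependsOn (μ : Measure (ℤ → Bool)) [IsFiniteMeasure μ]
    {ψ : (ℤ → Bool) → ℝ} {Δ : Finset ℤ} (hψ : DependsOn ψ (Δ : Set ℤ)) : Integrable ψ μ := by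
  rw [eq_sum_indicator_cyl hψ]
  exact integrable_finsetSum _ fun A _ =>
    (integrable_const _).indicator (measurableSet_cyl Δ A)

lemma integral_of_dependsOn (μ : Measure (ℤ → Bool)) [IsFiniteMeasure μ]
    {ψ : (ℤ → Bool) → ℝ} {Δ : Finset ℤ} (hψ : DependsOn ψ (Δ : Set ℤ)) :
    ∫ η, ψ η ∂μ = ∑ A ∈ Δ.powerset, μ.real (cyl Δ A) * ψ (cfg A) := by
  conv_lhs => rw [eq_sum_indicator_cyl hψ]
  rw [integral_finsetSum _ fun A _ =>
    (integrable_const _).indicator (measurableSet_cyl Δ A)]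
  refine Finset.sum_congr rfl fun A _ => ?_
  rw [integral_indicator (measurableSet_cyl Δ A), setIntegral_const, smul_eq_mul]

/-- The rate at which the values at `x` and `x + 1` are exchanged. -/
def bondRate (p : ℤ → ℤ → ℝ) (x : ℤ) (η : ℤ → Bool) : ℝ :=
  (if η x = true ∧ η (x + 1) = false then p x (x + 1) else 0) +
    if η (x + 1) = true ∧ η x = false then p (x + 1) x else 0

lemma swapConfig_comm (x y : ℤ) (η : ℤ → Bool) : swapConfig x y η = swapConfig y x η := by
  funext u
  simp only [swapConfig]
  split_ifs <;> simp_all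

lemma exclGen_eq_sum {p : ℤ → ℤ → ℝ} (hnn : ∀ x y : ℤ, |x - y| ≠ 1 → p x y = 0)
    {f : (ℤ → Bool) → ℝ} {m n : ℤ} (hf : DependsOn f (Finset.Icc m n : Set ℤ)) (η : ℤ → Bool) :
    exclGen p f η = ∑ x ∈ Finset.Icc (m - 1) n,
      bondRate p x η * (f (swapConfig x (x + 1) η) - f η) := by
  set T : ℤ → ℤ → ℝ := fun x y =>
    if η x = true ∧ η y = false then p x y * (f (swapConfig x y η) - f η) else 0 with hT
  have hfar : ∀ x y, y ≠ x + 1 → y ≠ x - 1 → T x y = 0 := by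
    intro x y h1 h2
    have : p x y = 0 := hnn x y fun h => by
      rcases (abs_eq zero_le_one).1 h with h | h <;> omega
    simp [hT, this]
  have hout : ∀ x y, x ∉ Finset.Icc m n → y ∉ Finset.Icc m n → T x y = 0 := by
    intro x y hx hy
    have : f (swapConfig x y η) = f η := hf fun u hu => by
      have h1 : u ≠ x := fun h => hx (h ▸ hu)
      have h2 : u ≠ y := fun h => hy (h ▸ hu)
      simp [swapConfig, h1, h2]
    simp [hT, this]
  have hinner : ∀ x, ∑' y, T x y = T x (x + 1) + T x (x - 1) := by
    intro x
    rw [tsum_eq_sum (s := {x + 1, x - 1}), Finset.sum_pair (by omega)]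
    intro y hy
    simp only [Finset.mem_insert, Finset.mem_singleton, not_or] at hy
    exact hfar x y hy.1 hy.2
  have hs1 : ∀ x ∉ Finset.Icc (m - 1) n, T x (x + 1) = 0 := fun x hx =>
    hout _ _ (by simp only [Finset.mem_Icc] at *; omega) (by simp only [Finset.mem_Icc] at *; omega)
  have hs2 : ∀ x ∉ Finset.Icc (m - 1) n, T (x + 1) x = 0 := fun x hx =>
    hout _ _ (by simp only [Finset.mem_Icc] at *; omega) (by simp only [Finset.mem_Icc] at *; omega)
  have hsum2 : HasSum (fun x => T x (x - 1)) (∑ x ∈ Finset.Icc (m - 1) n, T (x + 1) x) := by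
    rw [← (Equiv.addRight (1 : ℤ)).hasSum_iff]
    simpa [Function.comp_def] using hasSum_sum_of_ne_finset_zero hs2
  have hsum1 : HasSum (fun x => T x (x + 1)) (∑ x ∈ Finset.Icc (m - 1) n, T x (x + 1)) :=
    hasSum_sum_of_ne_finset_zero hs1
  change ∑' x, ∑' y, T x y = _
  simp_rw [hinner]
  rw [(hsum1.add hsum2).tsum_eq, ← Finset.sum_add_distrib]
  refine Finset.sum_congr rfl fun x _ => ?_
  simp only [hT, bondRate, swapConfig_comm (x + 1) x, add_mul, ite_mul, zero_mul]

lemma dependsOn_bondRate_mul (p : ℤ → ℤ → ℝ) {φ : (ℤ → Bool) → ℝ} {x : ℤ} {Δ : Set ℤ}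
    (hφ : DependsOn φ Δ) (hx : x ∈ Δ) (hx' : x + 1 ∈ Δ) :
    DependsOn (fun η => bondRate p x η * φ η) Δ := fun η ξ h => by
  simp only [bondRate, h x hx, h (x + 1) hx', hφ h]

lemma dependsOn_swapConfig {f : (ℤ → Bool) → ℝ} {x y : ℤ} {Δ : Set ℤ} (hf : DependsOn f Δ)
    (hx : x ∈ Δ) (hy : y ∈ Δ) : DependsOn (fun η => f (swapConfig x y η)) Δ := fun η ξ h =>
  hf fun u hu => by simp only [swapConfig, h u hu, h x hx, h y hy]

lemma swapConfig_cfg_left {x y : ℤ} {A : Finset ℤ} (hxy : x ≠ y) (hx : x ∉ A) (hy : y ∉ A) :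
    swapConfig x y (cfg (insert x A)) = cfg (insert y A) := by
  funext u
  simp only [swapConfig, cfg]
  split_ifs with h1 h2
  · subst h1; simp [hxy, hxy.symm, hx, hy]
  · subst h2; simp
  · simp [h1, h2]

lemma integral_bondRate_mul (p : ℤ → ℤ → ℝ) (μ : Measure (ℤ → Bool)) [IsFiniteMeasure μ] {x : ℤ}
    {Γ : Finset ℤ} (hx : x ∉ Γ) (hx' : x + 1 ∉ Γ) {φ : (ℤ → Bool) → ℝ}
    (hφ : DependsOn φ (insert x (insert (x + 1) Γ) : Finset ℤ)) :
    ∫ η, bondRate p x η * φ η ∂μ = ∑ A ∈ Γ.powerset,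
      (p x (x + 1) * μ.real (cyl (insert x (insert (x + 1) Γ)) (insert x A)) *
          φ (cfg (insert x A)) +
        p (x + 1) x * μ.real (cyl (insert x (insert (x + 1) Γ)) (insert (x + 1) A)) *
          φ (cfg (insert (x + 1) A))) := by
  rw [integral_of_dependsOn μ (dependsOn_bondRate_mul p hφ (by simp) (by simp)),
    Finset.sum_powerset_insert (by simp [hx]),
    Finset.sum_powerset_insert hx', Finset.sum_powerset_insert hx', ← Finset.sum_add_distrib,
    ← Finset.sum_add_distrib, ← Finset.sum_add_distrib]
  refine Finset.sum_congr rfl fun A hA => ?_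
  have hxA : x ∉ A := fun h => hx (Finset.mem_powerset.1 hA h)
  have hxA' : x + 1 ∉ A := fun h => hx' (Finset.mem_powerset.1 hA h)
  have e0 : bondRate p x (cfg A) = 0 := by simp [bondRate, cfg, hxA, hxA']
  have e1 : bondRate p x (cfg (insert x A)) = p x (x + 1) := by simp [bondRate, cfg, hxA']
  have e2 : bondRate p x (cfg (insert (x + 1) A)) = p (x + 1) x := by simp [bondRate, cfg, hxA]
  have e3 : bondRate p x (cfg (insert x (insert (x + 1) A))) = 0 := by simp [bondRate, cfg]
  rw [e0, e1, e2, e3]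
  ring

lemma subset_insert_insert_sdiff (Λ : Finset ℤ) (x y : ℤ) :
    Λ ⊆ insert x (insert y (Λ \ {x, y})) := fun u hu => by
  simp only [Finset.mem_insert, Finset.mem_sdiff, Finset.mem_singleton]
  tauto

lemma integral_mul_exclGen {p : ℤ → ℤ → ℝ} (hnn : ∀ x y : ℤ, |x - y| ≠ 1 → p x y = 0)
    (μ : Measure (ℤ → Bool)) [IsFiniteMeasure μ] {f g : (ℤ → Bool) → ℝ} {m n : ℤ}
    (hf : DependsOn f (Finset.Icc m n : Set ℤ)) (hg : DependsOn g (Finset.Icc m n : Set ℤ)) :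
    ∫ η, f η * exclGen p g η ∂μ = ∑ x ∈ Finset.Icc (m - 1) n,
      ∑ A ∈ (Finset.Icc m n \ {x, x + 1}).powerset,
      (p x (x + 1) * μ.real (cyl (insert x (insert (x + 1) (Finset.Icc m n \ {x, x + 1})))
          (insert x A)) *
          (f (cfg (insert x A)) * (g (cfg (insert (x + 1) A)) - g (cfg (insert x A)))) +
        p (x + 1) x * μ.real (cyl (insert x (insert (x + 1) (Finset.Icc m n \ {x, x + 1})))
          (insert (x + 1) A)) *
          (f (cfg (insert (x + 1) A)) * (g (cfg (insert x A)) - g (cfg (insert (x + 1) A))))) := by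
  have hdep : ∀ x : ℤ, DependsOn (fun η => f η * (g (swapConfig x (x + 1) η) - g η))
      (insert x (insert (x + 1) (Finset.Icc m n \ {x, x + 1})) : Finset ℤ) := fun x η ξ h => by
    have hsub := Finset.coe_subset.2 (subset_insert_insert_sdiff (Finset.Icc m n) x (x + 1))
    have hswap : g (swapConfig x (x + 1) η) = g (swapConfig x (x + 1) ξ) :=
      dependsOn_swapConfig (fun η ξ h => hg fun u hu => h u (hsub hu)) (by simp) (by simp) h
    simp only [hf fun u hu => h u (hsub hu), hg fun u hu => h u (hsub hu), hswap]
  have hpt : ∀ η, f η * exclGen p g η = ∑ x ∈ Finset.Icc (m - 1) n,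
      bondRate p x η * (f η * (g (swapConfig x (x + 1) η) - g η)) := fun η => by
    rw [exclGen_eq_sum hnn hg, Finset.mul_sum]
    exact Finset.sum_congr rfl fun x _ => by ring
  simp_rw [hpt]
  rw [integral_finsetSum]
  · refine Finset.sum_congr rfl fun x _ => ?_
    rw [integral_bondRate_mul p μ (by simp) (by simp) (hdep x)]
    refine Finset.sum_congr rfl fun A hA => ?_
    have hxA : x ∉ A := fun h => by simpa using Finset.mem_powerset.1 hA h
    have hxA' : x + 1 ∉ A := fun h => by simpa using Finset.mem_powerset.1 hA h
    rw [swapConfig_cfg_left (by omega) hxA hxA', swapConfig_comm,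
      swapConfig_cfg_left (by omega) hxA' hxA]
  · exact fun x _ => integrable_of_dependsOn μ
      (dependsOn_bondRate_mul p (hdep x) (by simp) (by simp))

/-- The weight of `cyl Λ A` under the Bernoulli product with odds `π`. -/
noncomputable def bernoulliWeight (π : ℤ → ℝ) (Λ A : Finset ℤ) : ℝ :=
  ∏ x ∈ Λ, if x ∈ A then π x / (1 + π x) else 1 / (1 + π x)

lemma bernoulliWeight_pos {π : ℤ → ℝ} (hπ : ∀ x, 0 < π x) (Λ A : Finset ℤ) :
    0 < bernoulliWeight π Λ A :=
  Finset.prod_pos fun x _ => by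
    have := hπ x
    split_ifs <;> positivity

lemma bernoulliWeight_insert (π : ℤ → ℝ) {Λ A : Finset ℤ} {y : ℤ} (hy : y ∉ Λ) :
    bernoulliWeight π (insert y Λ) A =
      (if y ∈ A then π y / (1 + π y) else 1 / (1 + π y)) * bernoulliWeight π Λ A :=
  Finset.prod_insert hy

lemma bernoulliWeight_insert_right (π : ℤ → ℝ) {Λ A : Finset ℤ} {y : ℤ} (hy : y ∉ Λ) :
    bernoulliWeight π Λ (insert y A) = bernoulliWeight π Λ A :=
  Finset.prod_congr rfl fun x hx => by
    have : x ≠ y := fun h => hy (h ▸ hx)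
    simp [this]

lemma bernoulliWeight_consistent {π : ℤ → ℝ} (hπ : ∀ x, 0 < π x) {Λ A : Finset ℤ} {y : ℤ}
    (hy : y ∉ Λ) (hA : A ⊆ Λ) : bernoulliWeight π Λ A =
      bernoulliWeight π (insert y Λ) A + bernoulliWeight π (insert y Λ) (insert y A) := by
  have hyA : y ∉ A := fun h => hy (hA h)
  have : 1 + π y ≠ 0 := by linarith [hπ y]
  rw [bernoulliWeight_insert π hy, bernoulliWeight_insert π hy, bernoulliWeight_insert_right π hy,
    if_neg hyA, if_pos (Finset.mem_insert_self _ _)]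
  field_simp

lemma bernoulliWeight_balance {p : ℤ → ℤ → ℝ} {π : ℤ → ℝ} (hrev : IsReversible p π) {x : ℤ}
    {Γ A : Finset ℤ} (hx : x ∉ Γ) (hx' : x + 1 ∉ Γ) (hA : A ⊆ Γ) :
    p x (x + 1) * bernoulliWeight π (insert x (insert (x + 1) Γ)) (insert x A) =
      p (x + 1) x * bernoulliWeight π (insert x (insert (x + 1) Γ)) (insert (x + 1) A) := by
  have hxA : x ∉ A := fun h => hx (hA h)
  have hxA' : x + 1 ∉ A := fun h => hx' (hA h)
  have h1 : 1 + π x ≠ 0 := by linarith [hrev.1 x]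
  have h2 : 1 + π (x + 1) ≠ 0 := by linarith [hrev.1 (x + 1)]
  rw [bernoulliWeight_insert π (by simp [hx]), bernoulliWeight_insert π hx',
    bernoulliWeight_insert π (by simp [hx]), bernoulliWeight_insert π hx',
    bernoulliWeight_insert_right π hx, bernoulliWeight_insert_right π hx',
    if_pos (Finset.mem_insert_self _ _), if_pos (Finset.mem_insert_self _ _),
    if_neg (by simp [hxA']), if_neg (by simp [hxA])]
  field_simp
  linear_combination bernoulliWeight π Γ A * hrev.2 x (x + 1)

lemma real_cyl_consistent (μ : Measure (ℤ → Bool)) [IsFiniteMeasure μ] {Λ A : Finset ℤ} {y : ℤ}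
    (hy : y ∉ Λ) (hA : A ⊆ Λ) :
    μ.real (cyl Λ A) = μ.real (cyl (insert y Λ) A) + μ.real (cyl (insert y Λ) (insert y A)) := by
  have hyA : y ∉ A := fun h => hy (hA h)
  have hne : ∀ x ∈ Λ, x ≠ y := fun x hx h => hy (h ▸ hx)
  rw [← measureReal_union _ (measurableSet_cyl _ _)]
  · congr 1
    ext η
    simp only [cyl, Set.mem_ofPred_eq, Set.mem_union, Finset.forall_mem_insert]
    constructor
    · intro h
      cases hη : η y
      · exact Or.inl ⟨by simp [hyA], h⟩
      · exact Or.inr ⟨by simp, fun x hx => by simp [h x hx, hne x hx]⟩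
    · rintro (h | h)
      · exact h.2
      · exact fun x hx => by simp [h.2 x hx, hne x hx]
  · rw [Set.disjoint_left]
    intro η h1 h2
    have e1 := h1 y (Finset.mem_insert_self _ _)
    have e2 := h2 y (Finset.mem_insert_self _ _)
    simp [hyA] at e1
    simp [e1] at e2

/-- Adding the reversible Bernoulli product measure to an invariant measure gives a stationary
weight that charges every cylinder. -/
lemma stationaryWeight_of_invariant {p : ℤ → ℤ → ℝ} {π : ℤ → ℝ} (hp : IsTransition p)
    (hnn : ∀ x y : ℤ, |x - y| ≠ 1 → p x y = 0)
    (hpos : ∀ x y : ℤ, |x - y| = 1 → 0 < p x y) (hrev : IsReversible p π)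
    {μ : Measure (ℤ → Bool)} (hμ : ExclInvariant p μ) :
    StationaryWeight (fun x => p x (x + 1)) (fun x => p (x + 1) x) (fun x => Real.log (π x))
      (fun Λ A => μ.real (cyl Λ A) + bernoulliWeight π Λ A) := by
  have := hμ.1
  have hle : ∀ x y, p x y ≤ 1 := fun x y => le_hasSum (hp.2.1 x) y fun z _ => hp.1 x z
  have hr : ∀ x, 0 < p x (x + 1) := fun x => hpos _ _ (by simp)
  have hl : ∀ x, 0 < p (x + 1) x := fun x => hpos _ _ (by simp)
  refine ⟨hr, fun x => hle _ _, hl, fun x => hle _ _, fun x => ?_,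
    fun Λ A => add_pos_of_nonneg_of_pos measureReal_nonneg (bernoulliWeight_pos hrev.1 Λ A), ?_,
    fun Λ A y hy hA => ?_, fun m n _ f => ?_⟩
  · rw [← Real.log_mul (hrev.1 x).ne' (hr x).ne', ← Real.log_mul (hrev.1 _).ne' (hl x).ne',
      hrev.2 x (x + 1)]
  · simp [cyl, bernoulliWeight]
    norm_num
  · rw [real_cyl_consistent μ hy hA, bernoulliWeight_consistent hrev.1 hy hA]
    ring
  · have hF : DependsOn (fun η : ℤ → Bool => f ((Finset.Icc m n).filter (fun x => η x = true)))
        (Finset.Icc m n : Set ℤ) := fun η ξ h => by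
      simp only
      congr 1
      exact Finset.filter_congr fun x hx => by rw [h x hx]
    have hcfg : ∀ A : Finset ℤ, (Finset.Icc m n).filter (fun x => cfg A x = true) =
        A ∩ Finset.Icc m n := fun A => by
      ext x; simp [cfg, and_comm]
    have h := integral_mul_exclGen hnn μ (f := fun _ => 1) (fun _ _ _ => rfl) hF
    simp only [one_mul, hμ.2 _ ⟨Finset.Icc m n, fun η ξ h => hF h⟩, hcfg] at h
    rw [h]
    refine Finset.sum_congr rfl fun x _ => Finset.sum_congr rfl fun A hA => ?_
    have hb := bernoulliWeight_balance hrev (x := x) (by simp) (by simp)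
      (Finset.mem_powerset.1 hA)
    linear_combination (f (insert (x + 1) A ∩ Finset.Icc m n) -
      f (insert x A ∩ Finset.Icc m n)) * hb

lemma setOf_mapClusterPt_eq_singleton {X Y : Type*} [TopologicalSpace Y] [T2Space Y]
    {F : Filter X} [F.NeBot] {u : X → Y} {l : Y} (h : Tendsto u F (𝓝 l)) :
    {l' | MapClusterPt l' F u} = {l} := by
  ext l'
  refine ⟨fun h' => ?_, ?_⟩
  · have : (𝓝 l' ⊓ 𝓝 l).NeBot := ClusterPt.mono h' h
    exact eq_of_nhds_neBot this
  · rintro rfl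
    exact h.mapClusterPt

lemma setOf_mapClusterPt_ofReal_of_log_atTop {F : Filter ℤ} [F.NeBot] {π : ℤ → ℝ}
    (hπ : ∀ x, 0 < π x) (h : Tendsto (fun x => Real.log (π x)) F atTop) :
    {l | MapClusterPt l F (fun x => ENNReal.ofReal (π x))} = {⊤} := by
  refine setOf_mapClusterPt_eq_singleton (ENNReal.tendsto_ofReal_nhds_top.2 ?_)
  simpa [Function.comp_def, Real.exp_log (hπ _)] using Real.tendsto_exp_atTop.comp h

lemma setOf_mapClusterPt_ofReal_of_log_atBot {F : Filter ℤ} [F.NeBot] {π : ℤ → ℝ}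
    (hπ : ∀ x, 0 < π x) (h : Tendsto (fun x => Real.log (π x)) F atBot) :
    {l | MapClusterPt l F (fun x => ENNReal.ofReal (π x))} = {0} := by
  refine setOf_mapClusterPt_eq_singleton ?_
  rw [← ENNReal.ofReal_zero]
  refine ENNReal.tendsto_ofReal ?_
  simpa [Function.comp_def, Real.exp_log (hπ _)] using Real.tendsto_exp_atBot.comp h

/-- For a nearest-neighbor kernel on `ℤ` with rates bounded below, unless the
limit point sets of `π` are `{0}` at `-∞` and `{∞}` at `+∞` (or vice versa), every invariant
probability measure of the exclusion process is reversible. -/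
theorem invariant_measures_reversible
    (p : ℤ → ℤ → ℝ) (π : ℤ → ℝ) (hp : IsTransition p)
    (hnn : ∀ x y : ℤ, |x - y| ≠ 1 → p x y = 0)
    (hinf : ∃ δ : ℝ, 0 < δ ∧ ∀ x y : ℤ, |x - y| = 1 → δ ≤ p x y)
    (hrev : IsReversible p π)
    (h : ¬ ((limPtsAtBot π = {0} ∧ limPtsAtTop π = {⊤}) ∨
      (limPtsAtBot π = {⊤} ∧ limPtsAtTop π = {0}))) :
    ∀ μ : Measure (ℤ → Bool), ExclInvariant p μ → IsReversibleMeasure p μ := by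
  intro μ hμ f g hf hg
  have := hμ.1
  obtain ⟨δ, hδ, hδp⟩ := hinf
  have hW := stationaryWeight_of_invariant hp hnn (fun x y hxy => hδ.trans_le (hδp x y hxy)) hrev hμ
  have hincr : ∀ x, |Real.log (π (x + 1)) - Real.log (π x)| ≤ -Real.log δ := fun x => by
    have hb := hW.balance x
    have h1 := Real.log_le_log hδ (hδp x (x + 1) (by simp))
    have h2 := Real.log_le_log hδ (hδp (x + 1) x (by simp))
    have h3 := Real.log_nonpos (hW.r_pos x).le (hW.r_le x)
    have h4 := Real.log_nonpos (hW.l_pos x).le (hW.l_le x)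
    rw [abs_le]
    constructor <;> linarith
  obtain ⟨K, hK⟩ := exists_far_pair_of_not_tendsto hincr fun hlim => h <| hlim.imp
    (fun hl => ⟨setOf_mapClusterPt_ofReal_of_log_atBot hrev.1 hl.1,
      setOf_mapClusterPt_ofReal_of_log_atTop hrev.1 hl.2⟩)
    (fun hl => ⟨setOf_mapClusterPt_ofReal_of_log_atTop hrev.1 hl.1,
      setOf_mapClusterPt_ofReal_of_log_atBot hrev.1 hl.2⟩)
  have hJ := hW.current_eq_zero hK
  obtain ⟨F, hF⟩ := hf
  obtain ⟨G, hG⟩ := hg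
  obtain ⟨k, hk⟩ := exists_subset_Icc_neg (F ∪ G)
  have hfk : DependsOn f (Finset.Icc (-k : ℤ) k : Set ℤ) := fun η ξ hηξ =>
    hF η ξ fun x hx => hηξ x (hk (Finset.mem_union_left _ hx))
  have hgk : DependsOn g (Finset.Icc (-k : ℤ) k : Set ℤ) := fun η ξ hηξ =>
    hG η ξ fun x hx => hηξ x (hk (Finset.mem_union_right _ hx))
  rw [integral_mul_exclGen hnn μ hfk hgk, integral_mul_exclGen hnn μ hgk hfk]
  refine Finset.sum_congr rfl fun x _ => Finset.sum_congr rfl fun A hA => ?_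
  have hA := Finset.mem_powerset.1 hA
  have hb := hW.detailed_balance hJ (x := x) (by simp) (by simp) hA
  have hB := bernoulliWeight_balance hrev (x := x) (by simp) (by simp) hA
  linear_combination (f (cfg (insert x A)) * g (cfg (insert (x + 1) A)) -
    g (cfg (insert x A)) * f (cfg (insert (x + 1) A))) * (hb - hB)
end

section
/- Let p be a transition probability function on ℤ which is irreducible and admits a reversible measure π. Let q : ℤ → [0,∞) satisfy ∑_z q(z) = 1, ∑_z |z| q(z) < ∞ and ∑_z z q(z) = 0, and suppose that lim_{x→+∞} p(x,x+z) = q(z) for every z ∈ ℤ. Then q is symmetric: q(z) = q(−z) for all z ∈ ℤ. -/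
open MeasureTheory Filter Topology

/-- If the limiting kernel prefers the jump `z` to `-z`, then `π` increases along steps of
size `z` near `+∞`. -/
theorem IsReversible.eventually_lt {p : ℤ → ℤ → ℝ} {π q : ℤ → ℝ} (hrev : IsReversible p π)
    (hp : ∀ x y, 0 ≤ p x y)
    (hlim : ∀ z : ℤ, Tendsto (fun x : ℤ => p x (x + z)) atTop (𝓝 (q z)))
    {z : ℤ} (hz : q (-z) < q z) : ∀ᶠ x in atTop, π x < π (x + z) := by
  have hback : Tendsto (fun x : ℤ => p (x + z) x) atTop (𝓝 (q (-z))) := by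
    simpa [Function.comp_def] using
      (hlim (-z)).comp (tendsto_atTop_add_const_right atTop z tendsto_id)
  filter_upwards [hback.eventually_lt (hlim z) hz] with x hx
  by_contra! hle
  have hbal := hrev.2 x (x + z)
  nlinarith [hrev.1 x, hp (x + z) x, mul_le_mul_of_nonneg_right hle (hp (x + z) x),
    mul_lt_mul_of_pos_left hx (hrev.1 x)]

/-- A function increasing along steps of size `z` beyond `N` increases along positive multiples
of `z`. -/
theorem lt_add_mul_of_lt_add {f : ℤ → ℝ} {N z : ℤ} (hz : 0 ≤ z)
    (hf : ∀ x ≥ N, f x < f (x + z)) {x : ℤ} (hx : N ≤ x) (n : ℕ) :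
    f x < f (x + (n + 1 : ℕ) * z) := by
  induction n with
  | zero => simpa using hf x hx
  | succ n ih =>
    have hstep := hf (x + (n + 1 : ℕ) * z)
      (by nlinarith [mul_nonneg (Int.natCast_nonneg (n + 1)) hz])
    refine (ih.trans hstep).trans_eq (congrArg f ?_)
    push_cast
    ring

/-- A function on `ℤ` cannot increase near `+∞` along steps of size `z` and decrease along
steps of size `w`. -/
theorem not_eventually_lt_and_gt {f : ℤ → ℝ} {z w : ℤ} (hz : 0 < z) (hw : 0 < w)
    (hfz : ∀ᶠ x in atTop, f x < f (x + z)) (hfw : ∀ᶠ x in atTop, f (x + w) < f x) : False := by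
  obtain ⟨N, hN⟩ := eventually_atTop.1 (hfz.and hfw)
  obtain ⟨a, rfl⟩ := Int.eq_succ_of_zero_lt hz
  obtain ⟨b, rfl⟩ := Int.eq_succ_of_zero_lt hw
  have hup := lt_add_mul_of_lt_add hz.le (fun x hx => (hN x hx).1) le_rfl b
  have hdown := lt_add_mul_of_lt_add (f := fun x => -f x) hw.le
    (fun x hx => neg_lt_neg (hN x hx).2) le_rfl a
  simp only [neg_lt_neg_iff] at hdown
  rw [mul_comm ((a + 1 : ℕ) : ℤ)] at hdown
  exact lt_asymm hup hdown

/-- A function on `ℤ` with mean zero whose values dominate those of its reflection on the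
positive integers is even. -/
theorem eq_neg_of_hasSum_mul_zero {q : ℤ → ℝ} (hq : HasSum (fun z : ℤ => (z : ℝ) * q z) 0)
    (hle : ∀ z > 0, q (-z) ≤ q z) (z : ℤ) : q z = q (-z) := by
  have hneg : HasSum (fun z : ℤ => ((-z : ℤ) : ℝ) * q (-z)) 0 := (Equiv.neg ℤ).hasSum_iff.2 hq
  have hsum : HasSum (fun z : ℤ => (z : ℝ) * (q z - q (-z))) 0 := by
    convert hq.add hneg using 2 with z
    · push_cast
      ring
    · simp
  have hnonneg : ∀ z : ℤ, 0 ≤ (z : ℝ) * (q z - q (-z)) := by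
    intro z
    rcases lt_trichotomy z 0 with hz | rfl | hz
    · have h := hle (-z) (by lia)
      rw [neg_neg] at h
      exact mul_nonneg_of_nonpos_of_nonpos (by exact_mod_cast hz.le) (sub_nonpos.2 h)
    · simp
    · exact mul_nonneg (by exact_mod_cast hz.le) (sub_nonneg.2 (hle z hz))
  rcases eq_or_ne z 0 with rfl | hz
  · simp
  · have h := congrFun ((hasSum_zero_iff_of_nonneg hnonneg).1 hsum) z
    exact sub_eq_zero.1 ((mul_eq_zero.1 h).resolve_left (by exact_mod_cast hz))

/-- If an irreducible kernel on `ℤ` admitting a reversible measure is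
asymptotically (at `+∞`) equal to a mean-zero kernel `q` with finite first moment, then `q`
is symmetric. -/
theorem limit_kernel_symmetric
    (p : ℤ → ℤ → ℝ) (π q : ℤ → ℝ) (hp : IsTransition p)
    (hirr : IrreducibleKernel p) (hrev : IsReversible p π)
    (hq0 : ∀ z, 0 ≤ q z) (hq1 : HasSum q 1)
    (hqabs : Summable (fun z : ℤ => |(z : ℝ)| * q z))
    (hqmean : HasSum (fun z : ℤ => (z : ℝ) * q z) 0)
    (hlim : ∀ z : ℤ, Tendsto (fun x : ℤ => p x (x + z)) atTop (nhds (q z))) :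
    ∀ z : ℤ, q z = q (-z) := by
  by_cases hle : ∀ z > 0, q (-z) ≤ q z
  · exact eq_neg_of_hasSum_mul_zero hqmean hle
  · push Not at hle
    obtain ⟨w, hw, hqw⟩ := hle
    have hdown : ∀ᶠ x in atTop, π (x + w) < π x := by
      have h := hrev.eventually_lt hp.1 hlim (z := -w) (by simpa using hqw)
      simpa using (tendsto_atTop_add_const_right atTop w tendsto_id).eventually h
    have hge : ∀ z > 0, q z ≤ q (-z) := by
      intro z hz
      by_contra! hqz
      exact not_eventually_lt_and_gt hz hw (hrev.eventually_lt hp.1 hlim hqz) hdown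
    intro z
    have hmean : HasSum (fun z : ℤ => (z : ℝ) * -q z) 0 := by simpa using hqmean.neg
    exact neg_injective
      (eq_neg_of_hasSum_mul_zero (q := fun z => -q z) hmean (fun z hz => neg_le_neg (hge z hz)) z)
end

section
/- Let p be a nearest-neighbor transition probability function on ℤ (p(x,y) = 0 whenever |x−y| ≠ 1) and let μ be an invariant probability measure on {0,1}^ℤ for the exclusion process. Define flux(μ,x) = p(x,x+1) μ{η : η(x)=1, η(x+1)=0} − p(x+1,x) μ{η : η(x)=0, η(x+1)=1}. Then flux(μ,x) = flux(μ,y) for all x, y ∈ ℤ; that is, the flux of μ is independent of x. -/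
open MeasureTheory Filter Topology

/-- The flux of a measure `μ` across the bond `(x, x+1)`. -/
noncomputable def flux (p : ℤ → ℤ → ℝ) (μ : Measure (ℤ → Bool)) (x : ℤ) : ℝ :=
  p x (x + 1) * (μ {η | η x = true ∧ η (x + 1) = false}).toReal
    - p (x + 1) x * (μ {η | η x = false ∧ η (x + 1) = true}).toReal

/-- The occupation variable of a site, as a real-valued function on configurations. -/
def occupation {S : Type*} (x : S) (η : S → Bool) : ℝ := if η x = true then 1 else 0

lemma isCylinder_occupation {S : Type*} (x : S) : IsCylinder (occupation x) :=
  ⟨{x}, fun η ξ h => by simp [occupation, h x (Finset.mem_singleton_self x)]⟩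

/-- The rate at which a particle jumps from `a` to `b` in the configuration `η`. -/
def jumpRate {S : Type*} (p : S → S → ℝ) (a b : S) (η : S → Bool) : ℝ :=
  if η a = true ∧ η b = false then p a b else 0

lemma measurableSet_jump {S : Type*} (a b : S) :
    MeasurableSet {η : S → Bool | η a = true ∧ η b = false} :=
  (measurableSet_eq_fun (measurable_pi_apply a) measurable_const).inter
    (measurableSet_eq_fun (measurable_pi_apply b) measurable_const)

lemma jumpRate_eq_indicator {S : Type*} (p : S → S → ℝ) (a b : S) :
    jumpRate p a b =
      {η : S → Bool | η a = true ∧ η b = false}.indicator (fun _ => p a b) := by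
  ext η
  simp [jumpRate, Set.indicator_apply]

lemma integrable_jumpRate {S : Type*} (p : S → S → ℝ) (μ : Measure (S → Bool))
    [IsFiniteMeasure μ] (a b : S) : Integrable (jumpRate p a b) μ := by
  rw [jumpRate_eq_indicator]
  exact (integrable_const _).indicator (measurableSet_jump a b)

lemma integral_jumpRate {S : Type*} (p : S → S → ℝ) (μ : Measure (S → Bool)) (a b : S) :
    ∫ η, jumpRate p a b η ∂μ = p a b * (μ {η | η a = true ∧ η b = false}).toReal := by
  rw [jumpRate_eq_indicator, integral_indicator_const _ (measurableSet_jump a b), smul_eq_mul,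
    mul_comm]
  rfl

lemma flux_eq_integral (p : ℤ → ℤ → ℝ) (μ : Measure (ℤ → Bool)) (x : ℤ) :
    flux p μ x = ∫ η, jumpRate p x (x + 1) η ∂μ - ∫ η, jumpRate p (x + 1) x η ∂μ := by
  rw [integral_jumpRate, integral_jumpRate, flux]
  simp only [and_comm]

lemma exclGen_occupation (p : ℤ → ℤ → ℝ) (hnn : ∀ x y : ℤ, |x - y| ≠ 1 → p x y = 0)
    (x : ℤ) (η : ℤ → Bool) :
    exclGen p (occupation (x + 1)) η =
      (jumpRate p x (x + 1) η - jumpRate p (x + 1) x η) -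
        (jumpRate p (x + 1) (x + 1 + 1) η - jumpRate p (x + 1 + 1) (x + 1) η) := by
  set F : ℤ → ℤ → ℝ := fun a b => if η a = true ∧ η b = false then
    p a b * (occupation (x + 1) (swapConfig a b η) - occupation (x + 1) η) else 0 with hF
  have far (a b : ℤ) (hab : |a - b| ≠ 1) : F a b = 0 := by simp [hF, hnn a b hab]
  have off (a b : ℤ) (ha : a ≠ x + 1) (hb : b ≠ x + 1) : F a b = 0 := by
    simp [hF, occupation, swapConfig, ha.symm, hb.symm]
  have out (a : ℤ) (ha : a ≠ x + 1) : F a (x + 1) = jumpRate p a (x + 1) η := by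
    simp only [hF, jumpRate]
    split_ifs with h
    · simp [occupation, swapConfig, ha.symm, h.1, h.2]
    · rfl
  have into (b : ℤ) : F (x + 1) b = -jumpRate p (x + 1) b η := by
    simp only [hF, jumpRate]
    split_ifs with h
    · simp [occupation, swapConfig, h.1, h.2]
    · simp
  have row (a : ℤ) (ha : a ≠ x + 1) : ∑' b, F a b = F a (x + 1) :=
    tsum_eq_single _ fun b hb => off a b ha hb
  have site : ∑' b, F (x + 1) b = F (x + 1) x + F (x + 1) (x + 1 + 1) := by
    rw [tsum_eq_sum (s := {x, x + 1 + 1}), Finset.sum_pair (by omega)]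
    intro b hb
    simp only [Finset.mem_insert, Finset.mem_singleton, not_or] at hb
    exact far _ _ (by grind)
  have total : ∑' a, ∑' b, F a b = ∑ a ∈ {x, x + 1, x + 1 + 1}, ∑' b, F a b := by
    refine tsum_eq_sum fun a ha => ?_
    simp only [Finset.mem_insert, Finset.mem_singleton, not_or] at ha
    rw [row a ha.2.1]
    exact far _ _ (by grind)
  change ∑' a, ∑' b, F a b = _
  rw [total, Finset.sum_insert (by simp; omega), Finset.sum_pair (by omega), site,
    row x (by omega), row (x + 1 + 1) (by omega), out x (by omega),
    out (x + 1 + 1) (by omega), into, into]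
  ring

lemma flux_add_one (p : ℤ → ℤ → ℝ) (hnn : ∀ x y : ℤ, |x - y| ≠ 1 → p x y = 0)
    (μ : Measure (ℤ → Bool)) (hμ : ExclInvariant p μ) (x : ℤ) :
    flux p μ (x + 1) = flux p μ x := by
  have := hμ.1
  have h := hμ.2 _ (isCylinder_occupation (x + 1))
  have hi (a b : ℤ) := integrable_jumpRate p μ a b
  simp only [exclGen_occupation p hnn] at h
  have hd (a b c d : ℤ) : Integrable (fun η => jumpRate p a b η - jumpRate p c d η) μ :=
    (hi a b).sub (hi c d)
  rw [integral_sub (hd _ _ _ _) (hd _ _ _ _), integral_sub (hi _ _) (hi _ _),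
    integral_sub (hi _ _) (hi _ _), ← flux_eq_integral, ← flux_eq_integral] at h
  linarith

/-- For a nearest-neighbor kernel on `ℤ` and an invariant measure `μ`,
the flux of `μ` across a bond is independent of the bond. -/
theorem flux_independent_of_site
    (p : ℤ → ℤ → ℝ) (hp : IsTransition p)
    (hnn : ∀ x y : ℤ, |x - y| ≠ 1 → p x y = 0)
    (μ : Measure (ℤ → Bool)) (hμ : ExclInvariant p μ) :
    ∀ x y : ℤ, flux p μ x = flux p μ y := by
  have key (x : ℤ) : flux p μ x = flux p μ 0 := by
    induction x using Int.induction_on with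
    | zero => rfl
    | succ n ih => rw [flux_add_one p hnn μ hμ, ih]
    | pred n ih => rw [← ih, ← flux_add_one p hnn μ hμ (-n - 1), sub_add_cancel]
  intro x y
  rw [key x, key y]
end

section
/- Let p be a nearest-neighbor transition probability function on ℤ (p(x,y) = 0 whenever |x−y| ≠ 1) and let μ be a reversible probability measure on {0,1}^ℤ for the exclusion process, i.e. ∫ f · Ωg dμ = ∫ g · Ωf dμ for all cylinder functions f, g. Then flux(μ,x) = p(x,x+1) μ{η : η(x)=1, η(x+1)=0} − p(x+1,x) μ{η : η(x)=0, η(x+1)=1} = 0 for every x ∈ ℤ. -/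
open MeasureTheory Filter Topology

/-- The indicator of the event that `a` is occupied and `b` is empty. -/
noncomputable def jumpIndicator {S : Type*} (a b : S) : (S → Bool) → ℝ :=
  {η : S → Bool | η a = true ∧ η b = false}.indicator 1

lemma isCylinder_jumpIndicator {S : Type*} [DecidableEq S] (a b : S) :
    IsCylinder (jumpIndicator a b) := by
  refine ⟨{a, b}, fun η ξ h => ?_⟩
  have ha := h a (by simp)
  have hb := h b (by simp)
  simp [jumpIndicator, Set.indicator_apply, ha, hb]

/-- From a configuration with `a` occupied and `b` empty, the only jump leading to a configuration
with `b` occupied and `a` empty is the one from `a` to `b`. -/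
lemma jumpIndicator_mul_exclGen {S : Type*} [DecidableEq S] (p : S → S → ℝ) (a b : S)
    (η : S → Bool) :
    jumpIndicator a b η * exclGen p (jumpIndicator b a) η = p a b * jumpIndicator a b η := by
  by_cases h : η a = true ∧ η b = false
  · obtain ⟨ha, hb⟩ := h
    have hab : b ≠ a := by rintro rfl; simp [ha] at hb
    have key (u v : S) (huv : ¬ (u = a ∧ v = b)) :
        (if η u = true ∧ η v = false then
          p u v * (jumpIndicator b a (swapConfig u v η) - jumpIndicator b a η) else 0) = 0 := by
      simp only [jumpIndicator, swapConfig, Set.indicator_apply, Set.mem_ofPred_eq]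
      grind
    have hgen : exclGen p (jumpIndicator b a) η = p a b := by
      rw [exclGen, tsum_eq_single a, tsum_eq_single b]
      · simp [jumpIndicator, swapConfig, ha, hb, hab]
      · exact fun v hv => key a v fun h => hv h.2
      · intro u hu
        simp only [key u _ fun h => hu h.1, tsum_zero]
    rw [hgen, mul_comm]
  · simp [jumpIndicator, h]

lemma integral_jumpIndicator {S : Type*} (μ : Measure (S → Bool)) (a b : S) :
    ∫ η, jumpIndicator a b η ∂μ = (μ {η | η a = true ∧ η b = false}).toReal := by
  have hs : MeasurableSet {η : S → Bool | η a = true ∧ η b = false} :=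
    (measurableSet_eq_fun (measurable_pi_apply a) measurable_const).inter
      (measurableSet_eq_fun (measurable_pi_apply b) measurable_const)
  rw [jumpIndicator, integral_indicator_one hs, Measure.real]

/-- Reversible measures of the exclusion process satisfy detailed balance on every bond. -/
lemma IsReversibleMeasure.detailed_balance {S : Type*} [DecidableEq S] {p : S → S → ℝ}
    {μ : Measure (S → Bool)} (hμ : IsReversibleMeasure p μ) (a b : S) :
    p a b * (μ {η | η a = true ∧ η b = false}).toReal
      = p b a * (μ {η | η b = true ∧ η a = false}).toReal := by
  have h := hμ _ _ (isCylinder_jumpIndicator a b) (isCylinder_jumpIndicator b a)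
  simpa only [jumpIndicator_mul_exclGen, integral_const_mul, integral_jumpIndicator] using h

/-- For a nearest-neighbor kernel on `ℤ` and a reversible probability
measure `μ` for the exclusion process, the flux of `μ` vanishes at every bond. -/
theorem flux_eq_zero_of_reversible
    (p : ℤ → ℤ → ℝ) (hp : IsTransition p)
    (hnn : ∀ x y : ℤ, |x - y| ≠ 1 → p x y = 0)
    (μ : Measure (ℤ → Bool)) (hprob : IsProbabilityMeasure μ)
    (hμ : IsReversibleMeasure p μ) :
    ∀ x : ℤ, flux p μ x = 0 := by
  intro x
  have h := hμ.detailed_balance x (x + 1)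
  simp only [flux, h, and_comm, sub_self]
end
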